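/- Let V be a MOSVA and W a V-bimodule, both satisfying the pole-order condition. Fix a positive integer n, an integer 0 ≤ l ≤ n, and w ∈ W such that Y_W^L(u,x)w ∈ W[[x]] and Y_W^{s(R)}(u,x)w ∈ W[[x]] for every u ∈ V. Then for all u_1,…,u_n ∈ V, the map (z_1,…,z_n) ↦ E(Y_W^L(u_1,z_1)⋯Y_W^L(u_l,z_l)Y_W^{s(R)}(u_{l+1},z_{l+1})⋯Y_W^{s(R)}(u_n,z_n)w) is a \overline{W}-valued rational function in z_1,…,z_n with the only possible poles at z_i = z_j (1 ≤ i < j ≤ n), i.e., it belongs to W̃_{z_1,…,z_n}. -/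

import Mathlib

set_option autoImplicit false
set_option maxHeartbeats 1000000

open scoped BigOperators

noncomputable section

namespace VA

/-- Absolute convergence of a series of complex numbers indexed by `ι` to the sum `s`. -/
def AbsConvTo {ι : Type*} (f : ι → ℂ) (s : ℂ) : Prop :=
  Summable (fun i => ‖f i‖) ∧ HasSum f s

/-- The configuration-space condition: the entries of `z` are pairwise distinct. -/
def Conf {ι : Type*} (z : ι → ℂ) : Prop := ∀ i j : ι, i ≠ j → z i ≠ z j

/-- `‖z 0‖ > ‖z 1‖ > ⋯ > ‖z (n-1)‖`. -/
def Ordered {n : ℕ} (z : Fin n → ℂ) : Prop := ∀ i j : Fin n, i < j → ‖z j‖ < ‖z i‖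

/-- `‖z 0‖ > ‖z 1‖ > ⋯ > ‖z (n-1)‖ > 0`. -/
def OrderedPos {n : ℕ} (z : Fin n → ℂ) : Prop := Ordered z ∧ ∀ i, 0 < ‖z i‖

/-- A rational function in the variables `z i`, `i : ι`, whose only possible poles are
at `z i = 0` and on the diagonals `z i = z j` (`i ≠ j`); it is recorded as a numerator
polynomial together with the orders of the poles. -/
structure RatFn (ι : Type*) [Fintype ι] [DecidableEq ι] where
  num : MvPolynomial ι ℂ
  a : ι → ℕ
  b : ι → ι → ℕ

def RatFn.eval {ι : Type*} [Fintype ι] [DecidableEq ι] (R : RatFn ι) (z : ι → ℂ) : ℂ :=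
  MvPolynomial.eval z R.num /
    ((∏ i, z i ^ R.a i) * ∏ q ∈ Finset.univ.offDiag, (z q.1 - z q.2) ^ R.b q.1 q.2)

/-- A rational function in the variables `z i`, `i : ι`, whose only possible poles are
on the diagonals `z i = z j` (`i ≠ j`). -/
structure DiagRatFn (ι : Type*) [Fintype ι] [DecidableEq ι] where
  num : MvPolynomial ι ℂ
  b : ι → ι → ℕ

def DiagRatFn.eval {ι : Type*} [Fintype ι] [DecidableEq ι] (R : DiagRatFn ι) (z : ι → ℂ) : ℂ :=
  MvPolynomial.eval z R.num / ∏ q ∈ Finset.univ.offDiag, (z q.1 - z q.2) ^ R.b q.1 q.2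

/-- A linear functional belongs to the graded dual iff its restriction to all but
finitely many homogeneous components vanishes. -/
def InGradedDual {ι : Type*} {M : Type*} [AddCommGroup M] [Module ℂ M]
    (proj : ι → M →ₗ[ℂ] M) (φ : M →ₗ[ℂ] ℂ) : Prop :=
  (Function.support fun i => φ ∘ₗ proj i).Finite

/-- Iterated application: `compApply n f w = f 0 (f 1 (⋯ (f (n-1) w)))`. -/
def compApply {M : Type*} : (n : ℕ) → (Fin n → (M → M)) → M → M
  | 0, _, w => w
  | n+1, f, w => f 0 (compApply n (fun i => f i.succ) w)

section Graded

variable (W : Type*) [AddCommGroup W] [Module ℂ W]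

/-- A `ℂ`-grading of `W`, recorded via the projections onto the homogeneous
subspaces, whose weights have lower-bounded real parts. -/
structure CGrading where
  proj : ℂ → W →ₗ[ℂ] W
  proj_comp : ∀ m n : ℂ, proj m ∘ₗ proj n = if m = n then proj n else 0
  proj_finite : ∀ w : W, (Function.support fun n => proj n w).Finite
  proj_sum : ∀ w : W, (∑ᶠ n : ℂ, proj n w) = w
  lower_bound : ∃ B : ℝ, ∀ n : ℂ, n.re < B → proj n = 0

/-- A `ℤ`-grading of `V` with lower-bounded weights. -/
structure ZGrading where
  proj : ℤ → W →ₗ[ℂ] W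
  proj_comp : ∀ m n : ℤ, proj m ∘ₗ proj n = if m = n then proj n else 0
  proj_finite : ∀ w : W, (Function.support fun n => proj n w).Finite
  proj_sum : ∀ w : W, (∑ᶠ n : ℤ, proj n w) = w
  lower_bound : ∃ B : ℤ, ∀ n : ℤ, n < B → proj n = 0

variable {W}

/-- The grading operator `d` of a `ℂ`-graded space. -/
def CGrading.d (G : CGrading W) (w : W) : W := ∑ᶠ n : ℂ, n • G.proj n w

/-- The grading operator `d` of a `ℤ`-graded space. -/
def ZGrading.d (G : ZGrading W) (v : W) : W := ∑ᶠ n : ℤ, (n : ℂ) • G.proj n v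

/-- The operator `z^d` on a `ℤ`-graded space. -/
def ZGrading.zd (G : ZGrading W) (z : ℂ) (v : W) : W := ∑ᶠ n : ℤ, (z ^ n) • G.proj n v

/-- The algebraic completion `∏ₙ W_[n]`, realized as the submodule of functions
`ℂ → W` recording a homogeneous component in each weight. -/
def CGrading.compSub (G : CGrading W) : Submodule ℂ (ℂ → W) where
  carrier := {f | ∀ n, G.proj n (f n) = f n}
  add_mem' := by
    intro a b ha hb n
    simp only [Pi.add_apply, map_add, ha n, hb n]
  zero_mem' := by
    intro n
    simp
  smul_mem' := by
    intro c f hf n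
    simp only [Pi.smul_apply, map_smul, hf n]

/-- The algebraic completion of a graded space. -/
abbrev CGrading.Comp (G : CGrading W) : Type _ := ↥G.compSub

/-- The pairing between the graded dual and the algebraic completion. -/
def CGrading.pair (G : CGrading W) (φ : W →ₗ[ℂ] ℂ) (f : G.Comp) : ℂ :=
  ∑ᶠ n : ℂ, φ (f.1 n)

/-- The embedding of `W` into its algebraic completion. -/
def CGrading.emb (G : CGrading W) (w : W) : G.Comp :=
  ⟨fun n => G.proj n w, by
    intro n
    have h := congrArg (fun T : W →ₗ[ℂ] W => T w) (G.proj_comp n n)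
    simpa using h⟩

/-- The componentwise extension of an operator on `W` to the algebraic completion. -/
def CGrading.ext (G : CGrading W) (L : W → W) (f : G.Comp) : G.Comp :=
  ⟨fun m => ∑ᶠ n : ℂ, G.proj m (L (f.1 n)), by
    intro m
    show G.proj m (∑ᶠ n : ℂ, G.proj m (L (f.1 n))) = ∑ᶠ n : ℂ, G.proj m (L (f.1 n))
    by_cases h : (Function.support fun n => G.proj m (L (f.1 n))).Finite
    · have h1 := AddMonoidHom.map_finsum (G.proj m).toAddMonoidHom h
      simp only [LinearMap.toAddMonoidHom_coe] at h1
      rw [h1]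
      refine finsum_congr fun n => ?_
      have h2 := congrArg (fun T : W →ₗ[ℂ] W => T (L (f.1 n))) (G.proj_comp m m)
      simpa using h2
    · rw [finsum_of_infinite_support h]
      simp⟩

/-- The operator `z^d` on the algebraic completion, acting on the component of
weight `n` by `z ^ n` (complex power). -/
def CGrading.zd (G : CGrading W) (z : ℂ) (f : G.Comp) : G.Comp :=
  ⟨fun n => (z ^ n) • f.1 n, by
    intro n
    rw [map_smul, f.2 n]⟩

end Graded


section VOA

/-- A meromorphic open-string vertex algebra (MOSVA): a lower-bounded `ℤ`-graded
space with a vertex operator map (recorded through its coefficients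
`Y u v k = (Y_V)_k(u)v`, the coefficient of `x^{-k-1}` in `Y_V(u,x)v`) and a
vacuum, satisfying the grading, vacuum, `D`-derivative/commutator, rationality and
associativity axioms. -/
structure MOSVA (V : Type*) [AddCommGroup V] [Module ℂ V] where
  gr : ZGrading V
  Y : V →ₗ[ℂ] V →ₗ[ℂ] (ℤ → V)
  vac : V
  /-- lower truncation of vertex operators -/
  trunc : ∀ u v : V, ∃ N : ℤ, ∀ k : ℤ, N ≤ k → Y u v k = 0
  /-- identity property `Y(𝟏,x) = 1` -/
  identity : ∀ (v : V) (k : ℤ), Y vac v k = if k = -1 then v else 0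
  /-- creation property: `Y(u,x)𝟏 ∈ V[[x]]` and `lim_{x→0} Y(u,x)𝟏 = u` -/
  creation : ∀ (u : V) (k : ℤ), 0 ≤ k → Y u vac k = 0
  creation_lim : ∀ u : V, Y u vac (-1) = u
  /-- the `d`-commutator formula, written in terms of coefficients -/
  d_comm : ∀ (u v : V) (k : ℤ),
    gr.d (Y u v k) = Y (gr.d u) v k + (-(k : ℂ) - 1) • Y u v k + Y u (gr.d v) k
  /-- the `D`-derivative property (`D_V u = (Y_V)_{-2}(u)𝟏`) -/
  D_deriv : ∀ (u v : V) (k : ℤ),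
    Y (Y u vac (-2)) v k = (-(k : ℂ)) • Y u v (k - 1)
  /-- the `D`-commutator formula -/
  D_comm : ∀ (u v : V) (k : ℤ),
    Y (Y u v k) vac (-2) - Y u (Y v vac (-2)) k = (-(k : ℂ)) • Y u v (k - 1)
  /-- rationality of products: matrix coefficients of products of vertex operators
  converge absolutely in the ordered region to rational functions with the only
  possible poles at `z i = 0` and `z i = z j` -/
  rationality : ∀ (n : ℕ) (u : Fin n → V) (v : V) (φ : V →ₗ[ℂ] ℂ),
    InGradedDual gr.proj φ → ∃ R : RatFn (Fin n), ∀ z : Fin n → ℂ, OrderedPos z →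
      AbsConvTo (fun k : Fin n → ℤ =>
          φ (compApply n (fun i x => Y (u i) x (k i)) v) * ∏ i, z i ^ (-(k i) - 1))
        (R.eval z)
  /-- rationality of iterates and associativity: products and iterates converge to a
  common rational function -/
  associativity : ∀ (u₁ u₂ v : V) (φ : V →ₗ[ℂ] ℂ), InGradedDual gr.proj φ →
    ∃ R : RatFn (Fin 2),
      (∀ z₁ z₂ : ℂ, ‖z₂‖ < ‖z₁‖ → 0 < ‖z₂‖ →
        AbsConvTo (fun k : ℤ × ℤ =>
            φ (Y u₁ (Y u₂ v k.2) k.1) * z₁ ^ (-k.1 - 1) * z₂ ^ (-k.2 - 1))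
          (R.eval ![z₁, z₂])) ∧
      (∀ z₁ z₂ : ℂ, ‖z₁ - z₂‖ < ‖z₂‖ → 0 < ‖z₁ - z₂‖ →
        AbsConvTo (fun k : ℤ × ℤ =>
            φ (Y (Y u₁ u₂ k.1) v k.2) * (z₁ - z₂) ^ (-k.1 - 1) * z₂ ^ (-k.2 - 1))
          (R.eval ![z₁, z₂]))

variable {V : Type*} [AddCommGroup V] [Module ℂ V]

/-- The operator `D_V`. -/
def MOSVA.D (A : MOSVA V) (v : V) : V := A.Y v A.vac (-2)

/-- The pole-order condition for a MOSVA. -/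
def MOSVA.PoleOrder (A : MOSVA V) : Prop :=
  ∀ u₁ v : V, ∃ C : ℕ, ∀ φ : V →ₗ[ℂ] ℂ, InGradedDual A.gr.proj φ → ∀ u₂ : V,
    ∃ R : RatFn (Fin 2), R.a 0 ≤ C ∧
      ∀ z₁ z₂ : ℂ, ‖z₂‖ < ‖z₁‖ → 0 < ‖z₂‖ →
        AbsConvTo (fun k : ℤ × ℤ =>
            φ (A.Y u₁ (A.Y u₂ v k.2) k.1) * z₁ ^ (-k.1 - 1) * z₂ ^ (-k.2 - 1))
          (R.eval ![z₁, z₂])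

/-- A bimodule for a MOSVA: a `ℂ`-graded space with left and right vertex operator
maps (recorded through their coefficients), satisfying the left module, right module
and compatibility axioms. -/
structure Bimod (A : MOSVA V) (W : Type*) [AddCommGroup W] [Module ℂ W] where
  gr : CGrading W
  YL : V →ₗ[ℂ] W →ₗ[ℂ] (ℤ → W)
  YR : W →ₗ[ℂ] V →ₗ[ℂ] (ℤ → W)
  DW : W →ₗ[ℂ] W
  /-- `D_W` has weight one -/
  DW_wt : ∀ n : ℂ, DW ∘ₗ gr.proj n = gr.proj (n + 1) ∘ₗ DW ∘ₗ gr.proj n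
  truncL : ∀ (u : V) (w : W), ∃ N : ℤ, ∀ k : ℤ, N ≤ k → YL u w k = 0
  truncR : ∀ (w : W) (u : V), ∃ N : ℤ, ∀ k : ℤ, N ≤ k → YR w u k = 0
  identityL : ∀ (w : W) (k : ℤ), YL A.vac w k = if k = -1 then w else 0
  creationR : ∀ (w : W) (k : ℤ), 0 ≤ k → YR w A.vac k = 0
  creationR_lim : ∀ w : W, YR w A.vac (-1) = w
  d_commL : ∀ (u : V) (w : W) (k : ℤ),
    gr.d (YL u w k) = YL (A.gr.d u) w k + (-(k : ℂ) - 1) • YL u w k + YL u (gr.d w) k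
  d_commR : ∀ (w : W) (u : V) (k : ℤ),
    gr.d (YR w u k) = YR (gr.d w) u k + (-(k : ℂ) - 1) • YR w u k + YR w (A.gr.d u) k
  D_derivL : ∀ (u : V) (w : W) (k : ℤ),
    YL (A.D u) w k = (-(k : ℂ)) • YL u w (k - 1)
  D_commL : ∀ (u : V) (w : W) (k : ℤ),
    DW (YL u w k) - YL u (DW w) k = (-(k : ℂ)) • YL u w (k - 1)
  D_derivR : ∀ (w : W) (u : V) (k : ℤ),
    YR (DW w) u k = (-(k : ℂ)) • YR w u (k - 1)
  D_commR : ∀ (w : W) (u : V) (k : ℤ),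
    DW (YR w u k) - YR w (A.D u) k = (-(k : ℂ)) • YR w u (k - 1)
  /-- rationality for products of left vertex operators -/
  rationalityL : ∀ (n : ℕ) (u : Fin n → V) (w : W) (φ : W →ₗ[ℂ] ℂ),
    InGradedDual gr.proj φ → ∃ R : RatFn (Fin n), ∀ z : Fin n → ℂ, OrderedPos z →
      AbsConvTo (fun k : Fin n → ℤ =>
          φ (compApply n (fun i x => YL (u i) x (k i)) w) * ∏ i, z i ^ (-(k i) - 1))
        (R.eval z)
  /-- rationality of iterates and associativity for the left vertex operator map -/
  associativityL : ∀ (u₁ u₂ : V) (w : W) (φ : W →ₗ[ℂ] ℂ), InGradedDual gr.proj φ →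
    ∃ R : RatFn (Fin 2),
      (∀ z₁ z₂ : ℂ, ‖z₂‖ < ‖z₁‖ → 0 < ‖z₂‖ →
        AbsConvTo (fun k : ℤ × ℤ =>
            φ (YL u₁ (YL u₂ w k.2) k.1) * z₁ ^ (-k.1 - 1) * z₂ ^ (-k.2 - 1))
          (R.eval ![z₁, z₂])) ∧
      (∀ z₁ z₂ : ℂ, ‖z₁ - z₂‖ < ‖z₂‖ → 0 < ‖z₁ - z₂‖ →
        AbsConvTo (fun k : ℤ × ℤ =>
            φ (YL (A.Y u₁ u₂ k.1) w k.2) * (z₁ - z₂) ^ (-k.1 - 1) * z₂ ^ (-k.2 - 1))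
          (R.eval ![z₁, z₂]))
  /-- rationality for products `Y_W^R(w,z₁)Y_V(u₁,z₂)⋯Y_V(u_{n-1},z_n)u_n` -/
  rationalityR : ∀ (n : ℕ) (w : W) (v : Fin (n+1) → V) (φ : W →ₗ[ℂ] ℂ),
    InGradedDual gr.proj φ → ∃ R : RatFn (Fin (n+1)),
      ∀ z : Fin (n+1) → ℂ, OrderedPos z →
        AbsConvTo (fun k : Fin (n+1) → ℤ =>
            φ (YR w (compApply n (fun i x => A.Y (v i.castSucc) x (k i.succ))
                (v (Fin.last n))) (k 0)) * ∏ i, z i ^ (-(k i) - 1))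
          (R.eval z)
  /-- rationality of iterates and associativity for the right vertex operator map -/
  associativityR : ∀ (w : W) (u₁ u₂ : V) (φ : W →ₗ[ℂ] ℂ), InGradedDual gr.proj φ →
    ∃ R : RatFn (Fin 2),
      (∀ z₁ z₂ : ℂ, ‖z₂‖ < ‖z₁‖ → 0 < ‖z₂‖ →
        AbsConvTo (fun k : ℤ × ℤ =>
            φ (YR w (A.Y u₁ u₂ k.2) k.1) * z₁ ^ (-k.1 - 1) * z₂ ^ (-k.2 - 1))
          (R.eval ![z₁, z₂])) ∧
      (∀ z₁ z₂ : ℂ, ‖z₁ - z₂‖ < ‖z₂‖ → 0 < ‖z₁ - z₂‖ →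
        AbsConvTo (fun k : ℤ × ℤ =>
            φ (YR (YR w u₁ k.1) u₂ k.2) * (z₁ - z₂) ^ (-k.1 - 1) * z₂ ^ (-k.2 - 1))
          (R.eval ![z₁, z₂]))
  /-- compatibility: rationality of mixed products
  `Y_W^L(u₁,z₁)⋯Y_W^L(u_p,z_p)Y_W^R(w,z₀)Y_V(v₁,⋅)⋯Y_V(v_{q},⋅)v_{q+1}` -/
  compatRat : ∀ (p q : ℕ) (u : Fin p → V) (w : W) (v : Fin (q+1) → V)
      (φ : W →ₗ[ℂ] ℂ), InGradedDual gr.proj φ →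
    ∃ R : RatFn (Fin p ⊕ Fin (q+1)),
      ∀ (zL : Fin p → ℂ) (z0 : ℂ) (zR : Fin q → ℂ),
        Ordered zL → (∀ i, ‖z0‖ < ‖zL i‖) → (∀ j, ‖zR j‖ < ‖z0‖) → Ordered zR →
        0 < ‖z0‖ → (∀ j, 0 < ‖zR j‖) →
        AbsConvTo (fun K : (Fin p → ℤ) × ℤ × (Fin q → ℤ) =>
            φ (compApply p (fun i x => YL (u i) x (K.1 i))
                (YR w (compApply q (fun j x => A.Y (v j.castSucc) x (K.2.2 j))
                  (v (Fin.last q))) K.2.1))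
              * (∏ i, zL i ^ (-(K.1 i) - 1)) * z0 ^ (-K.2.1 - 1)
              * ∏ j, zR j ^ (-(K.2.2 j) - 1))
          (R.eval (Sum.elim zL (Fin.cons z0 zR)))
  /-- compatibility: associativity for the left and right vertex operator maps -/
  compatAssoc : ∀ (u v : V) (w : W) (φ : W →ₗ[ℂ] ℂ), InGradedDual gr.proj φ →
    ∃ R : RatFn (Fin 2),
      (∀ z₁ z₂ : ℂ, ‖z₂‖ < ‖z₁‖ → 0 < ‖z₂‖ →
        AbsConvTo (fun k : ℤ × ℤ =>
            φ (YL u (YR w v k.2) k.1) * z₁ ^ (-k.1 - 1) * z₂ ^ (-k.2 - 1))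
          (R.eval ![z₁, z₂])) ∧
      (∀ z₁ z₂ : ℂ, ‖z₁ - z₂‖ < ‖z₂‖ → 0 < ‖z₁ - z₂‖ →
        AbsConvTo (fun k : ℤ × ℤ =>
            φ (YR (YL u w k.1) v k.2) * (z₁ - z₂) ^ (-k.1 - 1) * z₂ ^ (-k.2 - 1))
          (R.eval ![z₁, z₂]))

variable {W : Type*} [AddCommGroup W] [Module ℂ W] {A : MOSVA V}

/-- The opposite right vertex operator map
`Y_W^{s(R)}(v,x)w = e^{xD_W}Y_W^R(w,-x)v`, through its coefficients. -/
def Bimod.YsR (B : Bimod A W) (v : V) (w : W) (k : ℤ) : W :=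
  ∑ᶠ m : ℕ, (((-1 : ℂ) ^ (k + (m : ℤ) + 1)) * ((m.factorial : ℂ))⁻¹) •
    ((B.DW ^ m) (B.YR w v (k + (m : ℤ))))

/-- The pole-order condition for a bimodule over a MOSVA. -/
def Bimod.PoleOrder (B : Bimod A W) : Prop :=
  (∀ (u₁ : V) (w : W), ∃ C : ℕ, ∀ φ : W →ₗ[ℂ] ℂ, InGradedDual B.gr.proj φ → ∀ u₂ : V,
    ∃ R : RatFn (Fin 2), R.a 0 ≤ C ∧
      ∀ z₁ z₂ : ℂ, ‖z₂‖ < ‖z₁‖ → 0 < ‖z₂‖ →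
        AbsConvTo (fun k : ℤ × ℤ =>
            φ (B.YL u₁ (B.YL u₂ w k.2) k.1) * z₁ ^ (-k.1 - 1) * z₂ ^ (-k.2 - 1))
          (R.eval ![z₁, z₂])) ∧
  (∀ (u₂ : V) (w : W), ∃ C : ℕ, ∀ φ : W →ₗ[ℂ] ℂ, InGradedDual B.gr.proj φ → ∀ u₁ : V,
    ∃ R : RatFn (Fin 2), R.a 0 ≤ C ∧
      ∀ z₁ z₂ : ℂ, ‖z₂‖ < ‖z₁‖ → 0 < ‖z₂‖ →
        AbsConvTo (fun k : ℤ × ℤ =>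
            φ (B.YR w (A.Y u₁ u₂ k.2) k.1) * z₁ ^ (-k.1 - 1) * z₂ ^ (-k.2 - 1))
          (R.eval ![z₁, z₂])) ∧
  (∀ (u₁ u₂ : V), ∃ C : ℕ, ∀ φ : W →ₗ[ℂ] ℂ, InGradedDual B.gr.proj φ → ∀ w : W,
    ∃ R : RatFn (Fin 2), R.a 0 ≤ C ∧
      ∀ z₁ z₂ : ℂ, ‖z₂‖ < ‖z₁‖ → 0 < ‖z₂‖ →
        AbsConvTo (fun k : ℤ × ℤ =>
            φ (B.YL u₁ (B.YR w u₂ k.2) k.1) * z₁ ^ (-k.1 - 1) * z₂ ^ (-k.2 - 1))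
          (R.eval ![z₁, z₂]))

end VOA


section Cochains

variable {V : Type*} [AddCommGroup V] [Module ℂ V]
variable {W : Type*} [AddCommGroup W] [Module ℂ W] {A : MOSVA V}

/-- A `W̄`-valued rational function in the variables `z i`, `i : ι`, with the only
possible poles at `z i = z j`: a map from configuration space to the algebraic
completion whose pairings with graded-dual functionals are such rational functions,
with pole orders uniform in the functional, as witnessed by a formal power series
with coefficients in `W` (condition (ii)). -/
def CGrading.WTilde (G : CGrading W) {ι : Type*} [Fintype ι] [DecidableEq ι]
    (f : (ι → ℂ) → G.Comp) : Prop :=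
  (∀ φ : W →ₗ[ℂ] ℂ, InGradedDual G.proj φ →
      ∃ R : DiagRatFn ι, ∀ z : ι → ℂ, Conf z → G.pair φ (f z) = R.eval z) ∧
  ∃ (p : ι → ι → ℤ) (b : (ι → ℕ) → W),
    ∀ φ : W →ₗ[ℂ] ℂ, InGradedDual G.proj φ →
      (Function.support fun k => φ (b k)).Finite ∧
      ∀ z : ι → ℂ, Conf z →
        (∏ q ∈ Finset.univ.offDiag, (z q.1 - z q.2) ^ (p q.1 q.2)) * G.pair φ (f z)
          = ∑ᶠ k : ι → ℕ, φ (b k) * ∏ i, z i ^ (k i)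

/-- The pattern of left/right vertex operators: the `i`-th operator is
`Y_W^L(u i, z i)` if `isL i`, and `Y_W^{s(R)}(u i, z i)` otherwise; `k` records the
coefficient extracted from each operator. -/
def patOps (B : Bimod A W) {n : ℕ} (isL : Fin n → Bool) (u : Fin n → V)
    (k : Fin n → ℤ) : Fin n → (W → W) :=
  fun i => if isL i then fun x => B.YL (u i) x (k i) else fun x => B.YsR (u i) x (k i)

/-- The pattern with `l` left operators followed by `n - l` opposite right operators. -/
def prefixPat (n l : ℕ) : Fin n → Bool := fun i => decide ((i : ℕ) < l)

/-- A vector `w` such that `Y_W^L(u,x)w ∈ W[[x]]` and `Y_W^{s(R)}(u,x)w ∈ W[[x]]`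
for every `u ∈ V`. -/
def Bimod.RegVec (B : Bimod A W) (w : W) : Prop :=
  ∀ (u : V) (k : ℤ), 0 ≤ k → B.YL u w k = 0 ∧ B.YsR u w k = 0

/-- `f` represents the `W̄`-valued rational function
`E(Y^{L/sR}(u 0, z 0)⋯Y^{L/sR}(u (n-1), z (n-1)) w)` (with the operators prescribed
by the pattern `isL`): `f` is a `W̄`-valued rational function with only diagonal
poles whose pairings are the sums of the corresponding series of matrix coefficients
on the region `|z 0| > ⋯ > |z (n-1)| > 0`. -/
def RepEPat (B : Bimod A W) {n : ℕ} (isL : Fin n → Bool) (u : Fin n → V) (w : W)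
    (f : (Fin n → ℂ) → B.gr.Comp) : Prop :=
  B.gr.WTilde f ∧
  ∀ φ : W →ₗ[ℂ] ℂ, InGradedDual B.gr.proj φ → ∀ z : Fin n → ℂ, OrderedPos z →
    AbsConvTo (fun k : Fin n → ℤ =>
        φ (compApply n (patOps B isL u k) w) * ∏ i, z i ^ (-(k i) - 1))
      (B.gr.pair φ (f z))

/-- `f` represents the `W̄`-valued rational function given by a product of groups of
vertex operators, with group `i` of size `α i` and left/right pattern `isL`;
the variables are indexed by the sigma type `(i : Fin N) × Fin (α i)`. -/
def RepESig (B : Bimod A W) {N : ℕ} (α : Fin N → ℕ)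
    (isL : (i : Fin N) → Fin (α i) → Bool)
    (u : (i : Fin N) → Fin (α i) → V) (w : W)
    (f : (((i : Fin N) × Fin (α i)) → ℂ) → B.gr.Comp) : Prop :=
  B.gr.WTilde f ∧
  ∀ φ : W →ₗ[ℂ] ℂ, InGradedDual B.gr.proj φ →
    ∀ Z : (i : Fin N) → Fin (α i) → ℂ,
      (∀ (i : Fin N) (s t : Fin (α i)), s < t → ‖Z i t‖ < ‖Z i s‖) →
      (∀ (i j : Fin N), i < j → ∀ (s : Fin (α i)) (t : Fin (α j)), ‖Z j t‖ < ‖Z i s‖) →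
      (∀ (i : Fin N) (s : Fin (α i)), 0 < ‖Z i s‖) →
      AbsConvTo (fun K : (i : Fin N) → Fin (α i) → ℤ =>
          φ (compApply N (fun i x => compApply (α i) (fun s y =>
              if isL i s then B.YL (u i s) y (K i s) else B.YsR (u i s) y (K i s)) x) w)
            * ∏ i, ∏ s, Z i s ^ (-(K i s) - 1))
        (B.gr.pair φ (f (fun q => Z q.1 q.2)))

/-- Multilinearity of a map on `n`-tuples of vectors. -/
def IsMultilinear {M : Type*} [AddCommMonoid M] [Module ℂ M] {n : ℕ}
    (Φ : (Fin n → V) → M) : Prop :=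
  (∀ (v : Fin n → V) (i : Fin n) (x y : V),
      Φ (Function.update v i (x + y)) = Φ (Function.update v i x) + Φ (Function.update v i y)) ∧
  ∀ (v : Fin n → V) (i : Fin n) (c : ℂ) (x : V),
      Φ (Function.update v i (c • x)) = c • Φ (Function.update v i x)

/-- The `D`-derivative property of a map `Φ : V^{⊗n} → W̃_{z₁,…,zₙ}`. -/
def DDerivProp (A : MOSVA V) (B : Bimod A W) {n : ℕ}
    (Φ : (Fin n → V) → (Fin n → ℂ) → B.gr.Comp) : Prop :=
  (∀ (v : Fin n → V) (i : Fin n) (φ : W →ₗ[ℂ] ℂ), InGradedDual B.gr.proj φ →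
    ∀ z : Fin n → ℂ, Conf z →
      HasDerivAt (fun t : ℂ => B.gr.pair φ (Φ v (Function.update z i t)))
        (B.gr.pair φ (Φ (Function.update v i (A.D (v i))) z)) (z i)) ∧
  (∀ (v : Fin n → V) (φ : W →ₗ[ℂ] ℂ), InGradedDual B.gr.proj φ →
    ∀ z : Fin n → ℂ, Conf z →
      B.gr.pair φ (B.gr.ext (⇑B.DW) (Φ v z)) =
        ∑ i, B.gr.pair φ (Φ (Function.update v i (A.D (v i))) z))

/-- The `d`-conjugation property of a map `Φ : V^{⊗n} → W̃_{z₁,…,zₙ}`. -/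
def DConjProp (A : MOSVA V) (B : Bimod A W) {n : ℕ}
    (Φ : (Fin n → V) → (Fin n → ℂ) → B.gr.Comp) : Prop :=
  ∀ (v : Fin n → V) (φ : W →ₗ[ℂ] ℂ), InGradedDual B.gr.proj φ →
    ∀ (z : Fin n → ℂ) (c : ℂ), c ≠ 0 → Conf z → Conf (fun i => c * z i) →
      B.gr.pair φ (B.gr.zd c (Φ v z)) =
        B.gr.pair φ (Φ (fun i => A.gr.zd c (v i)) (fun i => c * z i))

/-- Composability of `Φ : V^{⊗n} → W̃` with `m` vertex operators. -/
def ComposableWith (A : MOSVA V) (B : Bimod A W) (n m : ℕ)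
    (Φ : (Fin n → V) → (Fin n → ℂ) → B.gr.Comp) : Prop :=
  ∃ Cb : V → V → ℕ,
  ∀ (α : Fin (n+1) → ℕ), (∑ i, α i) = m + n →
  ∀ l₀ : ℕ, l₀ ≤ α 0 →
  ∀ u : (i : Fin (n+1)) → Fin (α i) → V,
  ∀ φ : W →ₗ[ℂ] ℂ, InGradedDual B.gr.proj φ →
  ∃ R : DiagRatFn ((i : Fin (n+1)) × Fin (α i)),
    (∀ q q' : (i : Fin (n+1)) × Fin (α i), R.b q q' ≤ Cb (u q.1 q.2) (u q'.1 q'.2)) ∧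
    ∀ (z : (i : Fin (n+1)) → Fin (α i) → ℂ) (ζ : Fin n → ℂ),
      (∀ s t : Fin (α 0), s < t → ‖z 0 t‖ < ‖z 0 s‖) →
      (∀ (j : Fin (α 0)) (i : Fin n) (t : Fin (α i.succ)),
          ‖ζ i‖ + ‖z i.succ t - ζ i‖ < ‖z 0 j‖) →
      (∀ (i : Fin n) (s t : Fin (α i.succ)), s < t →
          ‖z i.succ t - ζ i‖ < ‖z i.succ s - ζ i‖) →
      (∀ (i j : Fin n), i < j → ∀ (s : Fin (α i.succ)) (t : Fin (α j.succ)),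
          ‖(z i.succ s - ζ i) - (z j.succ t - ζ j)‖ < ‖ζ i - ζ j‖) →
      AbsConvTo (fun K : (i : Fin (n+1)) → Fin (α i) → ℤ =>
          B.gr.pair φ
            (compApply (α 0) (fun j => B.gr.ext (fun x =>
                if (j : ℕ) < l₀ then B.YL (u 0 j) x (K 0 j) else B.YsR (u 0 j) x (K 0 j)))
              (Φ (fun i => compApply (α i.succ)
                    (fun s x => A.Y (u i.succ s) x (K i.succ s)) A.vac) ζ))
            * (∏ j, z 0 j ^ (-(K 0 j) - 1))
            * ∏ i : Fin n, ∏ s, (z i.succ s - ζ i) ^ (-(K i.succ s) - 1))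
        (R.eval (fun q => z q.1 q.2))

/-- The set `Ĉ^n_m(V,W)`: maps `V^{⊗n} → W̃_{z₁,…,zₙ}` that are linear, satisfy the
`D`-derivative and `d`-conjugation properties and are composable with `m` vertex
operators. -/
def IsCochain (A : MOSVA V) (B : Bimod A W) (n m : ℕ)
    (Φ : (Fin n → V) → (Fin n → ℂ) → B.gr.Comp) : Prop :=
  IsMultilinear Φ ∧ (∀ v, B.gr.WTilde (Φ v)) ∧ DDerivProp A B Φ ∧ DConjProp A B Φ ∧
    ComposableWith A B n m Φ

/-- `Ψ` represents `E_W^{(1,0)} ∘₂ Φ`, i.e. the map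
`v ↦ E(Y_W^L(v 0, z 0) Φ(v 1 ⊗ ⋯ ⊗ v n)(z 1,…,z n))`. -/
def RepLeft (A : MOSVA V) (B : Bimod A W) {n : ℕ}
    (Φ : (Fin n → V) → (Fin n → ℂ) → B.gr.Comp)
    (Ψ : (Fin (n+1) → V) → (Fin (n+1) → ℂ) → B.gr.Comp) : Prop :=
  (∀ v, B.gr.WTilde (Ψ v)) ∧
  ∀ (v : Fin (n+1) → V) (φ : W →ₗ[ℂ] ℂ), InGradedDual B.gr.proj φ →
    ∀ (z₀ : ℂ) (zt : Fin n → ℂ), Conf (Fin.cons z₀ zt) →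
      (∀ i, ‖zt i‖ < ‖z₀‖) → (∀ i, 0 < ‖zt i‖) →
      AbsConvTo (fun k : ℤ =>
          B.gr.pair φ (B.gr.ext (fun x => B.YL (v 0) x k) (Φ (Fin.tail v) zt))
            * z₀ ^ (-k - 1))
        (B.gr.pair φ (Ψ v (Fin.cons z₀ zt)))

/-- `Ψ` represents `E_W^{(0,1)} ∘₂ Φ`, i.e. the map
`v ↦ E(Y_W^{s(R)}(v (n+1), z (n+1)) Φ(v 1 ⊗ ⋯ ⊗ v n)(z 1,…,z n))`. -/
def RepRight (A : MOSVA V) (B : Bimod A W) {n : ℕ}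
    (Φ : (Fin n → V) → (Fin n → ℂ) → B.gr.Comp)
    (Ψ : (Fin (n+1) → V) → (Fin (n+1) → ℂ) → B.gr.Comp) : Prop :=
  (∀ v, B.gr.WTilde (Ψ v)) ∧
  ∀ (v : Fin (n+1) → V) (φ : W →ₗ[ℂ] ℂ), InGradedDual B.gr.proj φ →
    ∀ (zl : ℂ) (zi : Fin n → ℂ), Conf (Fin.snoc zi zl) →
      (∀ i, ‖zi i‖ < ‖zl‖) → (∀ i, 0 < ‖zi i‖) →
      AbsConvTo (fun k : ℤ =>
          B.gr.pair φ (B.gr.ext (fun x => B.YsR (v (Fin.last n)) x k) (Φ (Fin.init v) zi))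
            * zl ^ (-k - 1))
        (B.gr.pair φ (Ψ v (Fin.snoc zi zl)))

/-- Replace the two adjacent entries `i, i+1` of an `(n+1)`-tuple by a single entry. -/
def mergeAt {M : Type*} {n : ℕ} (i : Fin n) (v : Fin (n+1) → M) (a : M) : Fin n → M :=
  fun j => if j < i then v j.castSucc else if j = i then a else v j.succ

/-- `Ψ` represents `Φ ∘ᵢ E_V^{(2)}`, i.e. the map
`v ↦ E(Φ(v 1 ⊗ ⋯ ⊗ Y_V(v i, z i − ζ)Y_V(v (i+1), z (i+1) − ζ)𝟏 ⊗ ⋯ ⊗ v (n+1))(…,ζ,…))`. -/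
def RepCirc (A : MOSVA V) (B : Bimod A W) {n : ℕ} (i : Fin n)
    (Φ : (Fin n → V) → (Fin n → ℂ) → B.gr.Comp)
    (Ψ : (Fin (n+1) → V) → (Fin (n+1) → ℂ) → B.gr.Comp) : Prop :=
  (∀ v, B.gr.WTilde (Ψ v)) ∧
  ∀ (v : Fin (n+1) → V) (φ : W →ₗ[ℂ] ℂ), InGradedDual B.gr.proj φ →
    ∀ (z : Fin (n+1) → ℂ) (ζ : ℂ), Conf z → Conf (mergeAt i z ζ) →
      ‖z i.succ - ζ‖ < ‖z i.castSucc - ζ‖ → 0 < ‖z i.succ - ζ‖ →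
      (∀ j : Fin (n+1), j ≠ i.castSucc → j ≠ i.succ →
        ‖z i.castSucc - ζ‖ < ‖z j - z i.castSucc‖ ∧ ‖z i.succ - ζ‖ < ‖z j - z i.succ‖) →
      AbsConvTo (fun k : ℤ × ℤ =>
          B.gr.pair φ
            (Φ (mergeAt i v (A.Y (v i.castSucc) (A.Y (v i.succ) A.vac k.2) k.1))
              (mergeAt i z ζ))
            * (z i.castSucc - ζ) ^ (-k.1 - 1) * (z i.succ - ζ) ^ (-k.2 - 1))
        (B.gr.pair φ (Ψ v z))

/-- `Ψ` represents the coboundary `δ̂Φ = E_W^{(1,0)}∘₂Φ + Σᵢ (−1)^i Φ∘ᵢE_V^{(2)}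
+ (−1)^{n+1} E_W^{(0,1)}∘₂Φ` of the `n`-cochain `Φ`. -/
def IsDelta (A : MOSVA V) (B : Bimod A W) {n : ℕ}
    (Φ : (Fin n → V) → (Fin n → ℂ) → B.gr.Comp)
    (Ψ : (Fin (n+1) → V) → (Fin (n+1) → ℂ) → B.gr.Comp) : Prop :=
  ∃ (gL gR : (Fin (n+1) → V) → (Fin (n+1) → ℂ) → B.gr.Comp)
    (gC : Fin n → (Fin (n+1) → V) → (Fin (n+1) → ℂ) → B.gr.Comp),
    RepLeft A B Φ gL ∧ RepRight A B Φ gR ∧ (∀ i, RepCirc A B i Φ (gC i)) ∧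
    ∀ v z, Ψ v z = gL v z + (∑ i : Fin n, ((-1 : ℂ) ^ ((i : ℕ) + 1)) • gC i v z)
      + ((-1 : ℂ) ^ (n + 1)) • gR v z

end Cochains

/-! ### Formal series and polynomial multiplication -/

section Formal

variable {ι : Type*} {M : Type*} [AddCommGroup M] [Module ℂ M]

/-- The coefficient shift corresponding to multiplication by a monomial. -/
def shiftEnd (m : ι → ℤ) : Module.End ℂ ((ι → ℤ) → M) where
  toFun F k := F (k - m)
  map_add' _ _ := rfl
  map_smul' _ _ := rfl

/-- Monomials acting on families of coefficients. -/
def shiftHom : Multiplicative (ι →₀ ℕ) →* Module.End ℂ ((ι → ℤ) → M) where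
  toFun m := shiftEnd (fun i => ((Multiplicative.toAdd m i : ℕ) : ℤ))
  map_one' := by
    ext F k
    change F _ = F k
    congr 1
    ext i
    simp
  map_mul' m m' := by
    ext F k
    change F _ = F _
    congr 1
    ext i
    simp only [toAdd_mul, Finsupp.add_apply, Pi.sub_apply]
    push_cast
    ring

/-- Multiplication of formal series by polynomials. -/
def act : MvPolynomial ι ℂ →ₐ[ℂ] Module.End ℂ ((ι → ℤ) → M) :=
  AddMonoidAlgebra.lift ℂ (Module.End ℂ ((ι → ℤ) → M)) (ι →₀ ℕ) shiftHom

theorem act_C (c : ℂ) (F : (ι → ℤ) → M) : act (MvPolynomial.C c) F = c • F := by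
  have : MvPolynomial.C c = algebraMap ℂ (MvPolynomial ι ℂ) c := rfl
  rw [this, AlgHom.commutes]
  rfl

theorem act_monomial (m : ι →₀ ℕ) (F : (ι → ℤ) → M) (k : ι → ℤ) :
    act (MvPolynomial.monomial m 1) F k = F (fun i => k i - (m i : ℤ)) := by
  have : act (M := M) (MvPolynomial.monomial m 1) = shiftHom (Multiplicative.ofAdd m) := by
    unfold act
    erw [AddMonoidAlgebra.lift_single]
    simp
  rw [this]
  rfl

theorem act_mul (p q : MvPolynomial ι ℂ) (F : (ι → ℤ) → M) :
    act (p * q) F = act p (act q F) := by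
  rw [map_mul]; rfl

theorem act_add (p q : MvPolynomial ι ℂ) (F : (ι → ℤ) → M) :
    act (p + q) F = act p F + act q F := by
  rw [map_add]; rfl

theorem act_sub (p q : MvPolynomial ι ℂ) (F : (ι → ℤ) → M) :
    act (p - q) F = act p F - act q F := by
  rw [map_sub]; rfl

theorem act_one (F : (ι → ℤ) → M) : act (1 : MvPolynomial ι ℂ) F = F := by
  rw [map_one]; rfl

theorem act_comm (p q : MvPolynomial ι ℂ) (F : (ι → ℤ) → M) :
    act p (act q F) = act q (act p F) := by
  rw [← act_mul, mul_comm, act_mul]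

/-- The polynomials whose action commutes with `Ω`. -/
def intertwiner {M' : Type*} [AddCommGroup M'] [Module ℂ M']
    (Ω : ((ι → ℤ) → M) →ₗ[ℂ] ((ι → ℤ) → M')) : Subalgebra ℂ (MvPolynomial ι ℂ) where
  carrier := {q | ∀ F, Ω (act q F) = act q (Ω F)}
  mul_mem' := by
    intro p q hp hq F
    rw [act_mul, act_mul, hp, hq]
  add_mem' := by
    intro p q hp hq F
    rw [act_add, act_add, map_add, hp, hq]
  algebraMap_mem' := by
    intro c F
    rw [AlgHom.commutes, AlgHom.commutes]
    exact map_smul Ω c F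

variable [DecidableEq ι]

theorem act_X (i : ι) (F : (ι → ℤ) → M) (k : ι → ℤ) :
    act (MvPolynomial.X i) F k = F (k - Pi.single i 1) := by
  rw [MvPolynomial.X, act_monomial]
  congr 1
  ext j
  by_cases h : j = i
  · subst h; simp
  · simp [h]

theorem act_X_pow (i : ι) (c : ℕ) (F : (ι → ℤ) → M) (k : ι → ℤ) :
    act (MvPolynomial.X i ^ c) F k = F (k - Pi.single i (c : ℤ)) := by
  induction c generalizing F k with
  | zero => simp
  | succ c ih =>
    rw [pow_succ, act_mul, ih, act_X]
    congr 1
    rw [sub_sub, ← Pi.single_add]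
    push_cast
    rfl

omit [DecidableEq ι] in
/-- A property closed under shifts and linear combinations is closed under `act`. -/
theorem act_induction (S : ((ι → ℤ) → M) → Prop)
    (hadd : ∀ F G, S F → S G → S (F + G)) (hsmul : ∀ (c : ℂ) F, S F → S (c • F))
    (hX : ∀ i F, S F → S (act (MvPolynomial.X i) F)) (q : MvPolynomial ι ℂ)
    (F : (ι → ℤ) → M) (hF : S F) : S (act q F) := by
  induction q using MvPolynomial.induction_on generalizing F with
  | C a => rw [act_C]; exact hsmul _ _ hF
  | add p q hp hq => rw [act_add]; exact hadd _ _ (hp F hF) (hq F hF)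
  | mul_X p i hp => rw [act_mul]; exact hp _ (hX i F hF)

/-- Vanishing in negative degrees of the variable `r`. -/
def NN (r : ι) (F : (ι → ℤ) → M) : Prop := ∀ k, k r < 0 → F k = 0

theorem NN.act {r : ι} {F : (ι → ℤ) → M} (h : NN r F) (q : MvPolynomial ι ℂ) :
    NN r (act q F) := by
  refine act_induction (NN r) ?_ ?_ ?_ q F h
  · intro F G hF hG k hk
    simp [hF k hk, hG k hk]
  · intro c F hF k hk
    simp [hF k hk]
  · intro i F hF k hk
    rw [act_X]
    apply hF
    by_cases hi : r = i
    · subst hi; simp; omega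
    · simpa [hi] using hk

theorem NN.of_X_pow {r a : ι} (hra : r ≠ a) {F : (ι → ℤ) → M} (c : ℕ)
    (h : NN r (VA.act (MvPolynomial.X a ^ c) F)) : NN r F := by
  intro k hk
  have := h (k + Pi.single a (c : ℤ)) (by simpa [hra] using hk)
  rw [act_X_pow] at this
  simpa using this

theorem NN.of_dvd {r : ι} {F : (ι → ℤ) → M} {p q : MvPolynomial ι ℂ} (hpq : p ∣ q)
    (h : NN r (VA.act p F)) : NN r (VA.act q F) := by
  obtain ⟨s, rfl⟩ := hpq
  rw [mul_comm, act_mul]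
  exact h.act s

end Formal

/-! ### Substitution operators -/

/-- The binomial coefficient `C(a + j, j)`. -/
def cf (a : ℤ) (j : ℕ) : ℂ := (∏ i ∈ Finset.range j, ((a : ℂ) + 1 + i)) / (j.factorial : ℂ)

theorem cf_zero (a : ℤ) : cf a 0 = 1 := by simp [cf]

theorem cf_succ_mul (a : ℤ) (j : ℕ) : ((j : ℂ) + 1) * cf a (j + 1) = (a + 1 + j) * cf a j := by
  have h : (j.factorial : ℂ) ≠ 0 := by exact_mod_cast j.factorial_ne_zero
  have h' : (j : ℂ) + 1 ≠ 0 := by exact_mod_cast j.succ_ne_zero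
  simp only [cf, Finset.prod_range_succ, Nat.factorial_succ]
  push_cast
  field_simp

theorem cf_succ_mul' (a : ℤ) (j : ℕ) : ((j : ℂ) + 1) * cf (a - 1) (j + 1) = a * cf a j := by
  have h : (j.factorial : ℂ) ≠ 0 := by exact_mod_cast j.factorial_ne_zero
  have h' : (j : ℂ) + 1 ≠ 0 := by exact_mod_cast j.succ_ne_zero
  simp only [cf, Finset.prod_range_succ', Nat.factorial_succ]
  push_cast
  field_simp
  have : ∀ i ∈ Finset.range j, ((a : ℂ) - 1 + 1 + (i + 1)) = a + 1 + i := by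
    intro i _; ring
  rw [Finset.prod_congr rfl this]
  ring

theorem cf_pascal (a : ℤ) (j : ℕ) : cf a (j + 1) = cf (a - 1) (j + 1) + cf a j := by
  have h' : (j : ℂ) + 1 ≠ 0 := by exact_mod_cast j.succ_ne_zero
  apply mul_left_cancel₀ h'
  rw [mul_add, cf_succ_mul, cf_succ_mul']
  ring

theorem cf_eq_zero {a : ℤ} {j : ℕ} (ha : a < 0) (haj : 0 ≤ a + j) : cf a j = 0 := by
  unfold cf
  rw [Finset.prod_eq_zero (i := (-a - 1).toNat)]
  · simp
  · rw [Finset.mem_range]; omega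
  · have : (((-a - 1).toNat : ℤ) : ℂ) = ((-a - 1 : ℤ) : ℂ) := by
      rw [Int.toNat_of_nonneg (by omega)]
    have h2 : (((-a - 1).toNat : ℕ) : ℂ) = ((-a - 1 : ℤ) : ℂ) := by
      rw [← this]; push_cast; rfl
    rw [h2]; push_cast; ring

theorem finsum_eq_range {M : Type*} [AddCommMonoid M] {f : ℕ → M} {K : ℕ}
    (h : ∀ j, K ≤ j → f j = 0) : ∑ᶠ j, f j = ∑ j ∈ Finset.range K, f j := by
  apply finsum_eq_sum_of_support_subset
  intro j hj
  rw [Finset.coe_range, Set.mem_Iio]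
  by_contra hk
  exact hj (h j (by omega))

theorem finsum_cf_pascal {M : Type*} [AddCommGroup M] [Module ℂ M] (a : ℤ) {f : ℕ → M} {K : ℕ}
    (h : ∀ j, K ≤ j → f j = 0) :
    ∑ᶠ j, cf a j • f j = ∑ᶠ j, cf (a - 1) j • f j + ∑ᶠ j, cf a j • f (j + 1) := by
  rw [finsum_eq_range (K := K + 1), finsum_eq_range (K := K + 1), finsum_eq_range (K := K)]
  · rw [Finset.sum_range_succ', Finset.sum_range_succ', cf_zero, cf_zero, add_right_comm,
      ← Finset.sum_add_distrib]
    congr 1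
    refine Finset.sum_congr rfl fun j _ => ?_
    rw [cf_pascal, add_smul]
  all_goals
    intro j hj
    rw [h _ (by omega), smul_zero]

section Subst

variable {M : Type*} [AddCommGroup M] [Module ℂ M]

/-- The substitution `x ↦ x + y` in a formal series in `x, y`, expanded in nonnegative
powers of `y`. -/
def T2 (F : ℤ → ℤ → M) (a b : ℤ) : M := ∑ᶠ j : ℕ, cf a j • F (a + j) (b - j)

/-- Multiplication by `x + ε y`. -/
def Qe (ε : ℂ) : Module.End ℂ (ℤ → ℤ → M) where
  toFun K a b := K (a - 1) b + ε • K a (b - 1)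
  map_add' K L := by
    funext a b
    simp only [Pi.add_apply, smul_add]
    abel
  map_smul' c K := by
    funext a b
    simp only [Pi.smul_apply, smul_add, RingHom.id_apply]
    rw [smul_comm ε c]

variable {ι : Type*} [DecidableEq ι]

/-- The substitution `x_i ↦ x_i + x_n`, expanded in nonnegative powers of `x_n`. -/
def TT (i n : ι) (F : (ι → ℤ) → M) (k : ι → ℤ) : M :=
  ∑ᶠ j : ℕ, cf (k i) j • F (k + Pi.single i (j : ℤ) - Pi.single n (j : ℤ))

/-- The exponents of `x_n` are bounded below when the exponents other than those of
`x_i, x_n` are fixed. -/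
def LB (i n : ι) (F : (ι → ℤ) → M) : Prop :=
  ∀ k : ι → ℤ, ∃ N : ℤ, ∀ k' : ι → ℤ, (∀ j, j ≠ i → j ≠ n → k' j = k j) → k' n < N → F k' = 0

theorem LB.act {i n : ι} {F : (ι → ℤ) → M} (h : LB i n F) (q : MvPolynomial ι ℂ) :
    LB i n (act q F) := by
  refine act_induction (LB i n) ?_ ?_ ?_ q F h
  · intro F G hF hG k
    obtain ⟨N, hN⟩ := hF k
    obtain ⟨N', hN'⟩ := hG k
    refine ⟨min N N', fun k' hk' hlt => ?_⟩
    simp [hN k' hk' (by omega), hN' k' hk' (by omega)]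
  · intro c F hF k
    obtain ⟨N, hN⟩ := hF k
    refine ⟨N, fun k' hk' hlt => ?_⟩
    simp [hN k' hk' hlt]
  · intro m F hF k
    obtain ⟨N, hN⟩ := hF (k - Pi.single m 1)
    refine ⟨N, fun k' hk' hlt => ?_⟩
    rw [act_X]
    refine hN _ (fun j hji hjn => ?_) ?_
    · simp [hk' j hji hjn]
    · by_cases hm : n = m
      · subst hm; simp; omega
      · simpa [hm] using hlt

omit [Module ℂ M] in
theorem LB.exists_bound {i n : ι} (hin : i ≠ n) {F : (ι → ℤ) → M} (h : LB i n F) (k : ι → ℤ) :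
    ∃ K : ℕ, ∀ j, K ≤ j → F (k + Pi.single i (j : ℤ) - Pi.single n (j : ℤ)) = 0 := by
  obtain ⟨N, hN⟩ := h k
  refine ⟨(k n - N + 1).toNat, fun j hj => hN _ (fun m hmi hmn => ?_) ?_⟩
  · simp [hmi, hmn]
  · simp [hin.symm]; omega

theorem TT_add {i n : ι} (hin : i ≠ n) {F G : (ι → ℤ) → M} (hF : LB i n F) (hG : LB i n G) :
    TT i n (F + G) = TT i n F + TT i n G := by
  funext k
  obtain ⟨K, hK⟩ := hF.exists_bound hin k
  obtain ⟨K', hK'⟩ := hG.exists_bound hin k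
  simp only [TT, Pi.add_apply]
  rw [finsum_eq_range (K := max K K'), finsum_eq_range (K := max K K'),
    finsum_eq_range (K := max K K'), ← Finset.sum_add_distrib]
  · simp only [smul_add]
  all_goals
    intro j hj
    simp [hK j (by omega), hK' j (by omega)]

theorem TT_smul (i n : ι) (c : ℂ) (F : (ι → ℤ) → M) : TT i n (c • F) = c • TT i n F := by
  funext k
  simp only [TT, Pi.smul_apply]
  rw [smul_finsum]
  simp only [smul_comm c]

theorem TT_X {i n : ι} (hin : i ≠ n) {F : (ι → ℤ) → M} (hF : LB i n F) :
    TT i n (act (MvPolynomial.X i) F) = act (MvPolynomial.X i + MvPolynomial.X n) (TT i n F) := by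
  funext k
  rw [act_add, Pi.add_apply, act_X, act_X]
  simp only [TT]
  obtain ⟨K, hK⟩ := hF.exists_bound hin (k - Pi.single i 1)
  have := finsum_cf_pascal (k i)
    (f := fun j : ℕ => F (k - Pi.single i 1 + Pi.single i (j : ℤ) - Pi.single n (j : ℤ))) hK
  have e1 : (k - Pi.single i 1 : ι → ℤ) i = k i - 1 := by simp
  have e2 : (k - Pi.single n 1 : ι → ℤ) i = k i := by simp [hin]
  rw [e1, e2]
  refine Eq.trans (finsum_congr fun j => ?_)
    (this.trans (congrArg₂ _ rfl (finsum_congr fun j => ?_)))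
  · rw [act_X]
    congr 2
    abel
  · congr 2
    push_cast
    simp only [Pi.single_add]
    abel

theorem TT_X_ne {i n m : ι} (hm : m ≠ i) (F : (ι → ℤ) → M) :
    TT i n (act (MvPolynomial.X m) F) = act (MvPolynomial.X m) (TT i n F) := by
  funext k
  rw [act_X]
  simp only [TT]
  have e1 : (k - Pi.single m 1 : ι → ℤ) i = k i := by simp [hm.symm]
  rw [e1]
  refine finsum_congr fun j => ?_
  rw [act_X]
  congr 2
  abel

/-- The substitution `x_i ↦ x_i + x_n` on polynomials. -/
def tau (i n : ι) : MvPolynomial ι ℂ →ₐ[ℂ] MvPolynomial ι ℂ :=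
  MvPolynomial.aeval fun j =>
    if j = i then MvPolynomial.X i + MvPolynomial.X n else MvPolynomial.X j

theorem TT_act {i n : ι} (hin : i ≠ n) (q : MvPolynomial ι ℂ) {F : (ι → ℤ) → M}
    (hF : LB i n F) : TT i n (act q F) = act (tau i n q) (TT i n F) := by
  induction q using MvPolynomial.induction_on generalizing F with
  | C c =>
    rw [act_C, TT_smul]
    simp [tau]
  | add p q hp hq =>
    rw [act_add, map_add, act_add, TT_add hin (hF.act p) (hF.act q), hp hF, hq hF]
  | mul_X p m hp =>
    rw [act_mul, hp (hF.act _), map_mul, act_mul]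
    congr 1
    by_cases hm : m = i
    · subst hm
      rw [TT_X hin hF]
      simp [tau]
    · rw [TT_X_ne hm]
      simp [tau, hm]

theorem tau_X_self (i n : ι) :
    tau i n (MvPolynomial.X i) = MvPolynomial.X i + MvPolynomial.X n := by
  simp [tau]

theorem tau_X_ne {i n m : ι} (hm : m ≠ i) : tau i n (MvPolynomial.X m) = MvPolynomial.X m := by
  simp [tau, hm]

theorem NN.of_TT {i n r : ι} (hin : i ≠ n) (hrn : r ≠ n) {F : (ι → ℤ) → M} (hF : LB i n F)
    (h : NN r (TT i n F)) : NN r F := by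
  intro k
  obtain ⟨N, hN⟩ := hF k
  have key : ∀ (d : ℕ) (k' : ι → ℤ), (∀ j, j ≠ i → j ≠ n → k' j = k j) → k' n - N < d →
      k' r < 0 → F k' = 0 := by
    intro d
    induction d with
    | zero =>
      intro k' hk' hd hr
      exact hN k' hk' (by omega)
    | succ d ih =>
      intro k' hk' hd hr
      have h1 := h k' hr
      simp only [TT] at h1
      rw [finsum_eq_single _ 0] at h1
      · simpa [cf_zero] using h1
      · intro j hj
        have hj' : 1 ≤ j := Nat.one_le_iff_ne_zero.mpr hj
        by_cases hri : r = i
        · subst hri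
          by_cases hneg : k' r + j < 0
          · rw [ih _ (fun m hmi hmn => by simp [hmi, hmn, hk' m hmi hmn])
              (by simp [hin.symm]; omega) (by simpa [hin] using hneg), smul_zero]
          · rw [cf_eq_zero hr (by omega), zero_smul]
        · rw [ih _ (fun m hmi hmn => by simp [hmi, hmn, hk' m hmi hmn])
              (by simp [hin.symm]; omega) (by simpa [hri, hrn] using hr), smul_zero]
  intro hr
  exact key (k n - N + 1).toNat k (fun _ _ _ => rfl) (by omega) hr

end Subst

/-! ### Transfer between two variables and families -/

section Transfer

variable {M M' : Type*} [AddCommGroup M] [Module ℂ M] [AddCommGroup M'] [Module ℂ M']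

theorem Qe_apply (ε : ℂ) (K : ℤ → ℤ → M) (a b : ℤ) :
    Qe ε K a b = K (a - 1) b + ε • K a (b - 1) := rfl

theorem Qe_pow_map (ε : ℂ) (C : ℕ) (ℓ : M →ₗ[ℂ] M') (K : ℤ → ℤ → M) :
    (Qe ε ^ C) (fun a b => ℓ (K a b)) = fun a b => ℓ ((Qe ε ^ C) K a b) := by
  induction C generalizing K with
  | zero => rfl
  | succ C ih =>
    rw [pow_succ, Module.End.mul_apply, pow_succ, Module.End.mul_apply, ← ih]
    congr 1
    funext a b
    simp only [Qe_apply, map_add, map_smul]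

/-- Uniform truncation in the second exponent. -/
def TB (F : ℤ → ℤ → M) : Prop := ∃ N : ℤ, ∀ a b, b < N → F a b = 0

theorem T2_map (ℓ : M →ₗ[ℂ] M') {F : ℤ → ℤ → M} (hF : TB F) :
    T2 (fun a b => ℓ (F a b)) = fun a b => ℓ (T2 F a b) := by
  obtain ⟨N, hN⟩ := hF
  funext a b
  have h : ∀ j : ℕ, (b - N + 1).toNat ≤ j → F (a + j) (b - j) = 0 :=
    fun j hj => hN _ _ (by omega)
  simp only [T2]
  rw [finsum_eq_range (K := (b - N + 1).toNat), finsum_eq_range (K := (b - N + 1).toNat), map_sum]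
  · simp only [map_smul]
  · intro j hj; rw [h j hj, smul_zero]
  · intro j hj; rw [h j hj, map_zero, smul_zero]

variable {ι : Type*} [DecidableEq ι]

/-- Invariance of a parameter under changes in the coordinates `i, n`. -/
def Indep {α : Type*} (i n : ι) (K : (ι → ℤ) → α) : Prop :=
  ∀ k k' : ι → ℤ, (∀ j, j ≠ i → j ≠ n → k j = k' j) → K k = K k'

theorem act_family (i n : ι) (hin : i ≠ n) (ε : ℂ) (C : ℕ) (K : (ι → ℤ) → ℤ → ℤ → M)
    (hK : Indep i n K) (k : ι → ℤ) :
    act ((MvPolynomial.X i + MvPolynomial.C ε * MvPolynomial.X n) ^ C)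
      (fun k => K k (k i) (k n)) k = (Qe ε ^ C) (K k) (k i) (k n) := by
  induction C generalizing K k with
  | zero => rw [pow_zero, act_one]; rfl
  | succ C ih =>
    rw [pow_succ, act_mul, pow_succ, Module.End.mul_apply]
    rw [← ih (fun k => Qe ε (K k))]
    · refine congrFun (congrArg _ (funext fun k => ?_)) k
      rw [act_add, act_mul, act_C, Pi.add_apply, Pi.smul_apply, act_X, act_X, Qe_apply]
      rw [hK (k - Pi.single i 1) k, hK (k - Pi.single n 1) k]
      · simp [hin, hin.symm]
      · intro j hi hn; simp [hn]
      · intro j hi hn; simp [hi]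
    · intro k k' h
      simp only [hK k k' h]

theorem TT_family (i n : ι) (hin : i ≠ n) (K : (ι → ℤ) → ℤ → ℤ → M)
    (hK : Indep i n K) (k : ι → ℤ) :
    TT i n (fun k => K k (k i) (k n)) k = T2 (K k) (k i) (k n) := by
  simp only [TT, T2]
  refine finsum_congr fun j => ?_
  obtain ⟨k', hk'⟩ : ∃ k' : ι → ℤ, k' = k + Pi.single i (j : ℤ) - Pi.single n (j : ℤ) := ⟨_, rfl⟩
  rw [← hk', hK k' k]
  · simp [hk', hin, hin.symm]
  · intro m hi hn; simp [hk', hi, hn]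

theorem act_TT_family {i n : ι} (hin : i ≠ n) {C : ℕ} {F H : (ι → ℤ) → ℤ → ℤ → M}
    {ℓ : (ι → ℤ) → M →ₗ[ℂ] M'} (hF : Indep i n F) (hH : Indep i n H) (hℓ : Indep i n ℓ)
    (hTB : ∀ k, TB (F k)) (h : ∀ k, (Qe 1 ^ C) (T2 (F k) - H k) = 0) :
    act ((MvPolynomial.X i + MvPolynomial.X n) ^ C)
      (TT i n (fun k => ℓ k (F k (k i) (k n)))) =
    act ((MvPolynomial.X i + MvPolynomial.X n) ^ C) (fun k => ℓ k (H k (k i) (k n))) := by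
  rw [← sub_eq_zero, ← map_sub]
  have e : (TT i n (fun k => ℓ k (F k (k i) (k n))) - fun k => ℓ k (H k (k i) (k n))) =
      fun k => (fun k a b => ℓ k ((T2 (F k) - H k) a b)) k (k i) (k n) := by
    funext k
    have := TT_family i n hin (fun k a b => ℓ k (F k a b))
      (fun k k' hk => by simp only [hF k k' hk, hℓ k k' hk]) k
    simp only [Pi.sub_apply, map_sub]
    rw [this, T2_map _ (hTB k)]
  rw [e]
  funext k
  have := act_family i n hin 1 C (fun k a b => ℓ k ((T2 (F k) - H k) a b))
      (fun k k' hk => by simp only [hF k k' hk, hℓ k k' hk, hH k k' hk]) k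
  rw [map_one, one_mul] at this
  rw [this, Qe_pow_map, h]
  simp

/-- A pointwise linear operator on families. -/
def ptw (ℓ : (ι → ℤ) → M →ₗ[ℂ] M') : ((ι → ℤ) → M) →ₗ[ℂ] ((ι → ℤ) → M') where
  toFun F k := ℓ k (F k)
  map_add' F G := by funext k; simp
  map_smul' c F := by funext k; simp

theorem X_mem_intertwiner {ℓ : (ι → ℤ) → M →ₗ[ℂ] M'} {j : ι}
    (h : ∀ k : ι → ℤ, ℓ (k - Pi.single j 1) = ℓ k) :
    MvPolynomial.X j ∈ intertwiner (ptw ℓ) := by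
  intro F
  funext k
  rw [act_X]
  change ℓ k (act _ F k) = ℓ (k - Pi.single j 1) (F (k - Pi.single j 1))
  rw [h, act_X]

/-- Iterated application of modes along a list of indices. -/
def ops (Z : ι → M →ₗ[ℂ] (ℤ → M)) : List ι → (ι → ℤ) → M →ₗ[ℂ] M
  | [], _ => LinearMap.id
  | j :: L, k => LinearMap.proj (k j) ∘ₗ Z j ∘ₗ ops Z L k

variable (Z : ι → M →ₗ[ℂ] (ℤ → M))

omit [DecidableEq ι] in
theorem ops_nil (k : ι → ℤ) (x : M) : ops Z [] k x = x := rfl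

omit [DecidableEq ι] in
theorem ops_cons (j : ι) (L : List ι) (k : ι → ℤ) (x : M) :
    ops Z (j :: L) k x = Z j (ops Z L k x) (k j) := rfl

omit [DecidableEq ι] in
theorem ops_append (A B : List ι) (k : ι → ℤ) (x : M) :
    ops Z (A ++ B) k x = ops Z A k (ops Z B k x) := by
  induction A with
  | nil => rfl
  | cons a A ih => rw [List.cons_append, ops_cons, ops_cons, ih]

omit [DecidableEq ι] in
theorem ops_congr {L : List ι} {k k' : ι → ℤ} (h : ∀ j ∈ L, k j = k' j) :
    ops Z L k = ops Z L k' := by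
  induction L with
  | nil => rfl
  | cons a L ih =>
    ext x
    rw [ops_cons, ops_cons, ih fun j hj => h j (List.mem_cons_of_mem _ hj), h a (by simp)]

theorem X_mem_intertwiner_ops {L : List ι} {j : ι} (hj : j ∉ L) :
    MvPolynomial.X j ∈ intertwiner (ptw (ops Z L)) := by
  apply X_mem_intertwiner
  intro k
  apply ops_congr
  intro m hm
  have : m ≠ j := fun h => hj (h ▸ hm)
  simp [this]

end Transfer

/-! ### Weak associativity and pole orders of products -/

section WeakAssoc

variable {V W : Type*} [AddCommGroup V] [Module ℂ V] [AddCommGroup W] [Module ℂ W]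

/-- Weak associativity with exponent `C` for the modes `YW` over the modes `Y`. -/
def WeakAssoc (Y : V →ₗ[ℂ] V →ₗ[ℂ] (ℤ → V)) (YW : V →ₗ[ℂ] W →ₗ[ℂ] (ℤ → W)) (C : ℕ)
    (u₁ u₂ : V) (w : W) : Prop :=
  (Qe 1 ^ C) (T2 (fun a b => YW u₁ (YW u₂ w b) a) - fun a b => YW (Y u₁ u₂ a) w b) = 0

open MvPolynomial in
/-- The polynomial clearing the poles of `x_i` against the variables in `L`. -/
def clr {ι : Type*} (p : ι → ℕ) (i : ι) (L : List ι) : MvPolynomial ι ℂ :=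
  (L.map fun j => (X i - X j) ^ p j).prod

open MvPolynomial in
/-- The polynomial clearing the poles of `x_i` against `x_n + x_j`, `j ∈ B`. -/
def clr' {ι : Type*} (p : ι → ℕ) (i n : ι) (B : List ι) : MvPolynomial ι ℂ :=
  (B.map fun j => (X i - X n - X j) ^ p j).prod

variable {ι : Type*} [DecidableEq ι]

open MvPolynomial in
theorem tau_clr {a n i : ι} (p : ι → ℕ) (hia : i ≠ a) {L : List ι} (ha : a ∉ L) :
    tau a n (clr p i L) = clr p i L := by
  unfold clr
  rw [map_list_prod, List.map_map]
  congr 1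
  apply List.map_congr_left
  intro j hj
  have : j ≠ a := fun h => ha (h ▸ hj)
  simp [tau_X_ne this, tau_X_ne hia]

open MvPolynomial in
theorem tau_clr' {a n i : ι} (p : ι → ℕ) (hia : i ≠ a) (hna : n ≠ a) {L : List ι} (ha : a ∉ L) :
    tau a n (clr' p i n L) = clr' p i n L := by
  unfold clr'
  rw [map_list_prod, List.map_map]
  congr 1
  apply List.map_congr_left
  intro j hj
  have : j ≠ a := fun h => ha (h ▸ hj)
  simp [tau_X_ne this, tau_X_ne hia, tau_X_ne hna]

open MvPolynomial in
theorem tau_self_clr' {n i : ι} (p : ι → ℕ) (hin : i ≠ n) {L : List ι} (hi : i ∉ L) :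
    tau i n (clr' p i n L) = clr p i L := by
  unfold clr' clr
  rw [map_list_prod, List.map_map]
  congr 1
  apply List.map_congr_left
  intro j hj
  have : j ≠ i := fun h => hi (h ▸ hj)
  simp [tau_X_ne this, tau_X_ne hin.symm, tau_X_self]

variable {Y : V →ₗ[ℂ] V →ₗ[ℂ] (ℤ → V)} {YW : V →ₗ[ℂ] W →ₗ[ℂ] (ℤ → W)}

open MvPolynomial in
/-- Induction step: regularity in `x_i` of the product along `i :: L ++ [n]` from that of the
product along `i :: L` applied to `u n`. -/
theorem NN_ops_append (CV : V → V → ℕ) (u : ι → V) (w : W) (c : V → ℕ)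
    (hc : ∀ v a, a < -(c v : ℤ) → YW v w a = 0)
    (hWA : ∀ u₁ u₂, WeakAssoc Y YW (c u₁) u₁ u₂ w) (i n : ι) (L : List ι)
    (hnd : (i :: (L ++ [n])).Nodup)
    (hV : NN i (act (X i ^ (CV (u i) (u n)) * clr (fun j => CV (u i) (u j)) i L)
      (fun k => ops (fun j => Y (u j)) (i :: L) k (u n)))) :
    NN i (act (X i ^ (c (u i)) * clr (fun j => CV (u i) (u j)) i (L ++ [n]))
      (fun k => ops (fun j => YW (u j)) (i :: (L ++ [n])) k w)) := by
  set p : ι → ℕ := fun j => CV (u i) (u j) with hp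
  have hin : i ≠ n := by rintro rfl; simp at hnd
  have hiL : i ∉ L := by
    intro h; simp [h] at hnd
  have hnL : n ∉ L := by
    intro h
    have := (List.nodup_cons.mp hnd).2
    rw [List.nodup_append] at this
    exact this.2.2 n h n (by simp) rfl
  have hLnd : L.Nodup := ((List.nodup_append.mp (List.nodup_cons.mp hnd).2)).1
  let vB : List ι → (ι → ℤ) → V := fun B k => ops (fun j => Y (u j)) B k (u n)
  let G : List ι → List ι → (ι → ℤ) → W := fun A B k =>
    ops (fun j => YW (u j)) (i :: A) k (YW (vB B k) w (k n))
  have vB_congr : ∀ (B : List ι) (k k' : ι → ℤ), (∀ j ∈ B, k j = k' j) → vB B k = vB B k' := by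
    intro B k k' h
    simp only [vB, ops_congr _ h]
  have GLB : ∀ (a : ι) (A B : List ι), a ∉ B → n ∉ B → LB a n (G A B) := by
    intro a A B ha hn k
    refine ⟨-(c (vB B k) : ℤ), fun k' hk' hlt => ?_⟩
    have : vB B k' = vB B k := vB_congr B _ _ fun j hj =>
      hk' j (fun h => ha (h ▸ hj)) (fun h => hn (h ▸ hj))
    simp only [G]
    rw [this, hc _ _ hlt, map_zero]
  have hTB : ∀ (u₁ u₂ : V), TB (fun a b => YW u₁ (YW u₂ w b) a) := by
    intro u₁ u₂
    refine ⟨-(c u₂ : ℤ), fun a b hb => ?_⟩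
    simp only [hc _ _ hb, map_zero, Pi.zero_apply]
  have key : ∀ A B : List ι, A ++ B = L →
      NN i (act (X i ^ (c (u i)) * (X i - X n) ^ p n * clr p i A * clr' p i n B) (G A B)) := by
    intro A
    induction A using List.reverseRecOn with
    | nil =>
      intro B hB
      rw [List.nil_append] at hB
      subst hB
      apply NN.of_TT hin hin ((GLB i [] B hiL hnL).act _)
      rw [TT_act hin _ (GLB i [] B hiL hnL)]
      have e1 : tau i n (X i ^ (c (u i)) * (X i - X n) ^ p n * clr p i [] * clr' p i n B) =
          (X i ^ p n * clr p i B) * (X i + X n) ^ c (u i) := by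
        simp only [map_mul, map_pow, map_sub, tau_X_self, tau_X_ne hin.symm,
          tau_self_clr' p hin hiL]
        simp [clr]
        ring
      rw [e1, act_mul]
      have e2 := act_TT_family (M' := W) hin (C := c (u i))
        (F := fun k a b => YW (u i) (YW (vB B k) w b) a)
        (H := fun k a b => YW (Y (u i) (vB B k) a) w b) (ℓ := fun _ => LinearMap.id)
        (fun k k' h => by
          simp only [vB_congr B k k' fun j hj =>
            h j (fun e => hiL (e ▸ hj)) (fun e => hnL (e ▸ hj))])
        (fun k k' h => by
          simp only [vB_congr B k k' fun j hj =>
            h j (fun e => hiL (e ▸ hj)) (fun e => hnL (e ▸ hj))])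
        (fun _ _ _ => rfl) (fun k => hTB _ _) (fun k => hWA _ _)
      have e3 : G [] B = fun k => (LinearMap.id : W →ₗ[ℂ] W)
        (YW (u i) (YW (vB B k) w (k n)) (k i)) := rfl
      rw [e3, e2, act_comm]
      apply NN.act
      have e4 : (fun k : ι → ℤ => (LinearMap.id : W →ₗ[ℂ] W)
          (YW (Y (u i) (vB B k) (k i)) w (k n))) =
          ptw (fun k : ι → ℤ => LinearMap.proj (k n) ∘ₗ YW.flip w)
            (fun k => ops (fun j => Y (u j)) (i :: B) k (u n)) := rfl
      have hX : ∀ j, j ≠ n → X j ∈ intertwiner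
          (ptw (fun k : ι → ℤ => (LinearMap.proj (k n) : (ℤ → W) →ₗ[ℂ] W) ∘ₗ YW.flip w)) := by
        intro j hj
        apply X_mem_intertwiner
        intro k
        simp [hj.symm]
      have hmem : X i ^ p n * clr p i B ∈ intertwiner
          (ptw (fun k : ι → ℤ => (LinearMap.proj (k n) : (ℤ → W) →ₗ[ℂ] W) ∘ₗ YW.flip w)) := by
        refine mul_mem (pow_mem (hX i hin) _) (list_prod_mem ?_)
        intro x hx
        obtain ⟨j, hj, rfl⟩ := List.mem_map.mp hx
        exact pow_mem (sub_mem (hX i hin) (hX j fun e => hnL (e ▸ hj))) _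
      rw [e4, ← hmem]
      intro k hk
      change (LinearMap.proj (k n) ∘ₗ YW.flip w) _ = 0
      rw [hV k hk, map_zero]
    | append_singleton A a ih =>
      intro B hB
      have h0 := ih (a :: B) (by simpa using hB)
      have haL : a ∈ L := by rw [← hB]; simp
      have hia : i ≠ a := fun e => hiL (e ▸ haL)
      have han : a ≠ n := fun e => hnL (e ▸ haL)
      have hnB : n ∉ B := fun h => hnL (by rw [← hB]; simp [h])
      have hiB : i ∉ B := fun h => hiL (by rw [← hB]; simp [h])
      have hnA : n ∉ A := fun h => hnL (by rw [← hB]; simp [h])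
      have hnd' := hLnd
      rw [← hB, List.append_assoc, List.singleton_append, List.nodup_append] at hnd'
      have haB : a ∉ B := (List.nodup_cons.mp hnd'.2.1).1
      have haA : a ∉ A := fun h => hnd'.2.2 a h a (by simp) rfl
      have hLB := GLB a (A ++ [a]) B haB hnB
      apply NN.of_X_pow hia (c (u a))
      rw [← act_mul]
      apply NN.of_TT han hin (hLB.act _)
      rw [TT_act han _ hLB]
      have e1 : tau a n (X a ^ c (u a) * (X i ^ (c (u i)) * (X i - X n) ^ p n *
          clr p i (A ++ [a]) * clr' p i n B)) =
          (X i ^ (c (u i)) * (X i - X n) ^ p n * clr p i A * clr' p i n (a :: B)) *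
            (X a + X n) ^ c (u a) := by
        have : clr p i (A ++ [a]) = clr p i A * (X i - X a) ^ p a := by simp [clr]
        rw [this]
        have : clr' p i n (a :: B) = (X i - X n - X a) ^ p a * clr' p i n B := by simp [clr']
        rw [this]
        simp only [map_mul, map_pow, map_sub, tau_X_self, tau_X_ne han.symm, tau_X_ne hia,
          tau_clr p hia haA, tau_clr' p hia han.symm haB]
        rw [show (X i - (X a + X n) : MvPolynomial ι ℂ) = X i - X n - X a by ring]
        ring
      rw [e1, act_mul]
      have hind : ∀ k k' : ι → ℤ, (∀ j, j ≠ a → j ≠ n → k j = k' j) → vB B k = vB B k' :=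
        fun k k' h => vB_congr B k k' fun j hj =>
          h j (fun e => haB (e ▸ hj)) (fun e => hnB (e ▸ hj))
      have e2 := act_TT_family (M' := W) han (C := c (u a))
        (F := fun k a' b => YW (u a) (YW (vB B k) w b) a')
        (H := fun k a' b => YW (Y (u a) (vB B k) a') w b)
        (ℓ := fun k => ops (fun j => YW (u j)) (i :: A) k)
        (fun k k' h => by simp only [hind k k' h])
        (fun k k' h => by simp only [hind k k' h])
        (fun k k' h => ops_congr _ fun j hj => by
          rcases List.mem_cons.mp hj with rfl | hj
          · exact h _ hia hin
          · exact h j (fun e => haA (e ▸ hj)) (fun e => hnA (e ▸ hj)))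
        (fun k => hTB _ _) (fun k => hWA _ _)
      have e3 : G (A ++ [a]) B = fun k => ops (fun j => YW (u j)) (i :: A) k
          (YW (u a) (YW (vB B k) w (k n)) (k a)) := by
        funext k
        simp only [G]
        rw [← List.cons_append, ops_append]
        rfl
      rw [e3, e2, act_comm]
      exact NN.act h0 _
  have := key L [] (by simp)
  have e : X i ^ (c (u i)) * clr p i (L ++ [n]) =
      X i ^ (c (u i)) * (X i - X n) ^ p n * clr p i L * clr' p i n [] := by
    simp [clr, clr']
    ring
  rw [e]
  convert this using 3 with k
  simp only [G]
  rw [← List.cons_append, ops_append]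
  rfl

open MvPolynomial in
theorem NN_ops_nil (p : ι → ℕ) (u : ι → V) (w : W) (c : V → ℕ)
    (hc : ∀ v a, a < -(c v : ℤ) → YW v w a = 0) (i : ι) :
    NN i (act (X i ^ (c (u i)) * clr p i [])
      (fun k => ops (fun j => YW (u j)) [i] k w)) := by
  intro k hk
  have : clr p i [] = 1 := by simp [clr]
  rw [this, mul_one, act_X_pow, ops_cons, ops_nil]
  apply hc
  simp
  omega

open MvPolynomial in
theorem NN_ops_self (CV : V → V → ℕ) (hc : ∀ u v a, a < -(CV u v : ℤ) → Y u v a = 0)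
    (hWA : ∀ u₁ u₂ v, WeakAssoc Y Y (CV u₁ v) u₁ u₂ v) (u : ι → V) (i : ι) (L : List ι)
    (v : V) (hnd : (i :: L).Nodup) :
    NN i (act (X i ^ (CV (u i) v) * clr (fun j => CV (u i) (u j)) i L)
      (fun k => ops (fun j => Y (u j)) (i :: L) k v)) := by
  induction L using List.reverseRecOn generalizing v with
  | nil => exact NN_ops_nil _ u v (fun u => CV u v) (fun u a => hc u v a) i
  | append_singleton L n ih =>
    refine NN_ops_append CV u v (fun u => CV u v) (fun u a => hc u v a)
      (fun u₁ u₂ => hWA u₁ u₂ v) i n L hnd (ih _ ?_)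
    rw [← List.cons_append] at hnd
    exact hnd.of_append_left

open MvPolynomial in
/-- Products of modes acting on `w` have poles in `x_i` only at `0` and at the later variables,
with orders depending on pairs of vectors only. -/
theorem NN_ops (CV : V → V → ℕ) (hV : ∀ u v a, a < -(CV u v : ℤ) → Y u v a = 0)
    (hVA : ∀ u₁ u₂ v, WeakAssoc Y Y (CV u₁ v) u₁ u₂ v) (w : W) (c : V → ℕ)
    (hc : ∀ v a, a < -(c v : ℤ) → YW v w a = 0)
    (hWA : ∀ u₁ u₂, WeakAssoc Y YW (c u₁) u₁ u₂ w)
    (u : ι → V) (i : ι) (L : List ι) (hnd : (i :: L).Nodup) :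
    NN i (act (X i ^ (c (u i)) * clr (fun j => CV (u i) (u j)) i L)
      (fun k => ops (fun j => YW (u j)) (i :: L) k w)) := by
  rcases L.eq_nil_or_concat with rfl | ⟨L', n, rfl⟩
  · exact NN_ops_nil _ u w c hc i
  · rw [List.concat_eq_append] at hnd ⊢
    refine NN_ops_append CV u w c hc hWA i n L' hnd (NN_ops_self CV hV hVA u i L' (u n) ?_)
    rw [← List.cons_append] at hnd
    exact hnd.of_append_left

end WeakAssoc

/-! ### From convergent expansions to formal identities -/

section Analytic

theorem AbsConvTo.add {ι : Type*} {f g : ι → ℂ} {s t : ℂ} (hf : AbsConvTo f s)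
    (hg : AbsConvTo g t) : AbsConvTo (fun i => f i + g i) (s + t) :=
  ⟨Summable.of_nonneg_of_le (fun _ => norm_nonneg _) (fun _ => norm_add_le _ _) (hf.1.add hg.1),
    hf.2.add hg.2⟩

theorem AbsConvTo.mul_left {ι : Type*} {f : ι → ℂ} {s : ℂ} (c : ℂ) (hf : AbsConvTo f s) :
    AbsConvTo (fun i => c * f i) (c * s) :=
  ⟨by simpa only [norm_mul] using hf.1.mul_left ‖c‖, hf.2.mul_left c⟩

theorem AbsConvTo.comp_equiv {ι κ : Type*} {f : ι → ℂ} {s : ℂ} (e : κ ≃ ι) (hf : AbsConvTo f s) :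
    AbsConvTo (fun i => f (e i)) s :=
  ⟨(e.summable_iff (f := fun i => ‖f i‖)).mpr hf.1, (e.hasSum_iff (f := f)).mpr hf.2⟩

theorem AbsConvTo.congr {ι : Type*} {f g : ι → ℂ} {s t : ℂ} (hf : AbsConvTo f s)
    (hfg : ∀ i, f i = g i) (hst : s = t) : AbsConvTo g t := by
  have : f = g := funext hfg
  rw [← this, ← hst]
  exact hf

section AC

variable {ι : Type*} [Fintype ι]

/-- The formal series `F` converges absolutely at `z` to `s`. -/
def AC (z : ι → ℂ) (F : (ι → ℤ) → ℂ) (s : ℂ) : Prop :=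
  AbsConvTo (fun k => F k * ∏ i, z i ^ k i) s

theorem prod_zpow_add {z : ι → ℂ} (hz : ∀ i, z i ≠ 0) (k m : ι → ℤ) :
    ∏ i, z i ^ (k + m) i = (∏ i, z i ^ k i) * ∏ i, z i ^ m i := by
  rw [← Finset.prod_mul_distrib]
  exact Finset.prod_congr rfl fun i _ => zpow_add₀ (hz i) _ _

variable [DecidableEq ι]

theorem prod_zpow_single (z : ι → ℂ) (i : ι) (c : ℤ) :
    ∏ j, z j ^ (Pi.single i c : ι → ℤ) j = z i ^ c := by
  rw [Finset.prod_eq_single i]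
  · simp
  · intro j _ hj; simp [hj]
  · simp

theorem AC.act {z : ι → ℂ} (hz : ∀ i, z i ≠ 0) (q : MvPolynomial ι ℂ) {F : (ι → ℤ) → ℂ} {s : ℂ}
    (h : AC z F s) : AC z (act q F) (MvPolynomial.eval z q * s) := by
  induction q using MvPolynomial.induction_on generalizing F s with
  | C c =>
    refine (h.mul_left c).congr (fun k => ?_) (by simp)
    rw [act_C, Pi.smul_apply, smul_eq_mul, mul_assoc]
  | add p q hp hq =>
    refine ((hp h).add (hq h)).congr (fun k => ?_) ?_
    · rw [act_add, Pi.add_apply, add_mul]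
    · rw [map_add, add_mul]
  | mul_X p i hp =>
    have h1 : AC z (VA.act (MvPolynomial.X i) F) (z i * s) := by
      refine ((h.mul_left (z i)).comp_equiv (Equiv.subRight (Pi.single i 1))).congr
        (fun k => ?_) rfl
      rw [act_X, Equiv.subRight_apply]
      have := prod_zpow_add hz (k - Pi.single i 1) (Pi.single i 1)
      rw [sub_add_cancel, prod_zpow_single, zpow_one] at this
      rw [this]
      ring
    refine (hp h1).congr (fun k => ?_) ?_
    · rw [act_mul]
    · rw [map_mul, MvPolynomial.eval_X, mul_assoc]

/-- The constant series `1`. -/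
def delta : (ι → ℤ) → ℂ := fun k => if k = 0 then 1 else 0

omit [DecidableEq ι] in
theorem AC_delta (z : ι → ℂ) : AC z delta 1 := by
  have hs : ∀ k : ι → ℤ, k ≠ 0 → delta k * ∏ i, z i ^ k i = 0 := by
    intro k hk
    simp [delta, hk]
  have h2 := hasSum_single (f := fun k : ι → ℤ => delta k * ∏ i, z i ^ k i) 0 hs
  have e : delta (0 : ι → ℤ) * ∏ i, z i ^ (0 : ι → ℤ) i = 1 := by simp [delta]
  rw [e] at h2
  exact ⟨h2.summable.norm, h2⟩

theorem TT_delta {i n : ι} (hin : i ≠ n) : TT i n (delta : (ι → ℤ) → ℂ) = delta := by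
  funext k
  simp only [TT]
  rw [finsum_eq_single _ 0]
  · simp [cf_zero]
  · intro j hj
    by_cases h : k + Pi.single i (j : ℤ) - Pi.single n (j : ℤ) = 0
    · have h1 := congrFun h i
      simp [hin] at h1
      rw [cf_eq_zero (by omega) (by omega), zero_smul]
    · simp [delta, h]

end AC

theorem laurent_unique {r : ℝ} (hr : 0 < r) {c : ℤ → ℂ}
    (hs : ∀ z : ℂ, ‖z‖ = r → HasSum (fun k : ℤ => c k * z ^ k) 0) : c = 0 := by
  have : Fact ((0 : ℝ) < 1) := ⟨one_pos⟩
  set d : ℤ → ℂ := fun k => c k * (r : ℂ) ^ k with hd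
  have hrC : (r : ℂ) ≠ 0 := by exact_mod_cast hr.ne'
  have hsum : Summable fun k => ‖d k‖ := by
    have := (hs (r : ℂ) (by simp [abs_of_pos hr])).summable.norm
    simpa [hd] using this
  have hS : Summable (fun k : ℤ => d k • (fourier k : C(AddCircle (1 : ℝ), ℂ))) := by
    apply Summable.of_norm
    refine hsum.congr fun k => ?_
    rw [norm_smul, fourier_norm, mul_one]
  obtain ⟨g, hg⟩ := hS
  have hg0 : g = 0 := by
    ext x
    have h1 : HasSum (fun k : ℤ => d k * fourier k x) (g x) := by
      have := (ContinuousMap.evalCLM ℂ x).hasSum hg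
      simpa using this
    have h2 : HasSum (fun k : ℤ => d k * fourier k x) 0 := by
      have hnorm : ‖(r : ℂ) * (x.toCircle : ℂ)‖ = r := by
        rw [norm_mul, Circle.norm_coe, mul_one]
        simp [abs_of_pos hr]
      refine (hs _ hnorm).congr_fun ?_
      intro k
      rw [fourier_apply, AddCircle.toCircle_zsmul, mul_zpow, hd]
      simp [mul_assoc]
    simpa using h1.unique h2
  rw [hg0] at hg
  have hL := (ContinuousMap.toLp (E := ℂ) 2 AddCircle.haarAddCircle ℂ).hasSum hg
  rw [map_zero] at hL
  funext k
  have hk := (innerSL ℂ (fourierLp (T := 1) 2 k)).hasSum hL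
  rw [map_zero] at hk
  have hsing := hasSum_single (f := fun b : ℤ => (innerSL ℂ (fourierLp (T := 1) 2 k))
    (ContinuousMap.toLp (E := ℂ) 2 AddCircle.haarAddCircle ℂ (d b • fourier b))) k (by
      intro j hj
      have := (orthonormal_iff_ite.mp (orthonormal_fourier (T := 1))) k j
      rw [map_smul, map_smul]
      change d j • inner ℂ (fourierLp 2 k) (fourierLp 2 j) = 0
      rw [this, if_neg hj.symm, smul_zero])
  have h0 := hsing.unique hk
  rw [map_smul, map_smul] at h0
  have h1 : d k • inner ℂ (fourierLp (T := 1) 2 k) (fourierLp 2 k) = 0 := h0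
  rw [(orthonormal_iff_ite.mp (orthonormal_fourier (T := 1))) k k, if_pos rfl, smul_eq_mul,
    mul_one] at h1
  exact (mul_eq_zero.mp h1).resolve_right (zpow_ne_zero _ hrC)

theorem AC_unique {r s : ℝ} (hr : 0 < r) (hs : 0 < s) {G : (Fin 2 → ℤ) → ℂ}
    (h : ∀ z : Fin 2 → ℂ, ‖z 0‖ = r → ‖z 1‖ = s → AC z G 0) : G = 0 := by
  have h1 : ∀ x y : ℂ, ‖x‖ = r → ‖y‖ = s →
      HasSum (fun k : ℤ × ℤ => G ![k.1, k.2] * (x ^ k.1 * y ^ k.2)) 0 := by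
    intro x y hx hy
    have := ((h ![x, y] hx hy).comp_equiv (finTwoArrowEquiv ℤ).symm).2
    simpa [Fin.prod_univ_two] using this
  have h2 : ∀ (a : ℤ) (y : ℂ), ‖y‖ = s → HasSum (fun b : ℤ => G ![a, b] * y ^ b) 0 := by
    intro a y hy
    have hsm : ∀ a : ℤ, Summable (fun b : ℤ => G ![a, b] * y ^ b) := by
      intro a
      have h3 := (h1 r y (by simp [abs_of_pos hr]) hy).summable.prod_factor a
      have hrC : (r : ℂ) ≠ 0 := by exact_mod_cast hr.ne'
      refine (h3.mul_left ((r : ℂ) ^ a)⁻¹).congr fun b => ?_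
      have := zpow_ne_zero a hrC
      field_simp
    have h4 : (fun a => ∑' b : ℤ, G ![a, b] * y ^ b) = 0 := by
      apply laurent_unique hr
      intro x hx
      refine (h1 x y hx hy).prod_fiberwise fun a => ?_
      refine ((hsm a).hasSum.mul_right (x ^ a)).congr_fun ?_
      intro b
      ring
    have h5 := (hsm a).hasSum
    rwa [show ∑' b : ℤ, G ![a, b] * y ^ b = 0 from congrFun h4 a] at h5
  funext k
  have h3 : (fun b : ℤ => G ![k 0, b]) = 0 := laurent_unique hs fun y hy => h2 (k 0) y hy
  have h4 : ![k 0, k 1] = k := by ext i; fin_cases i <;> rfl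
  have := congrFun h3 (k 1)
  rwa [h4] at this

end Analytic

/-! ### Weak associativity from associativity and the pole-order condition -/

section Assoc

open MvPolynomial

/-- The denominator of a rational function, as a polynomial. -/
def RatFn.den {ι : Type*} [Fintype ι] [DecidableEq ι] (R : RatFn ι) : MvPolynomial ι ℂ :=
  (∏ i, X i ^ R.a i) * ∏ q ∈ Finset.univ.offDiag, (X q.1 - X q.2) ^ R.b q.1 q.2

theorem RatFn.eval_eq {ι : Type*} [Fintype ι] [DecidableEq ι] (R : RatFn ι) (z : ι → ℂ) :
    R.eval z = MvPolynomial.eval z R.num / MvPolynomial.eval z R.den := by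
  simp [RatFn.eval, RatFn.den, map_prod]

theorem RatFn.den_ne_zero {ι : Type*} [Fintype ι] [DecidableEq ι] (R : RatFn ι) {z : ι → ℂ}
    (hz : ∀ i, z i ≠ 0) (hd : ∀ i j, i ≠ j → z i ≠ z j) : MvPolynomial.eval z R.den ≠ 0 := by
  simp only [RatFn.den, map_mul, map_prod, map_pow, map_sub, eval_X]
  refine mul_ne_zero (Finset.prod_ne_zero_iff.mpr fun i _ => pow_ne_zero _ (hz i))
    (Finset.prod_ne_zero_iff.mpr fun q hq => pow_ne_zero _ (sub_ne_zero.mpr (hd _ _ ?_)))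
  exact (Finset.mem_offDiag.mp hq).2.2

theorem vec2_ne {z₁ z₂ : ℂ} (h : z₁ ≠ z₂) :
    ∀ i j : Fin 2, i ≠ j → ![z₁, z₂] i ≠ ![z₁, z₂] j := by
  intro i j hij
  fin_cases i <;> fin_cases j <;> simp_all [h.symm]

theorem vec2_ne_zero {z₁ z₂ : ℂ} (h1 : z₁ ≠ 0) (h2 : z₂ ≠ 0) :
    ∀ i : Fin 2, ![z₁, z₂] i ≠ 0 := by
  intro i
  fin_cases i <;> simp_all

theorem RatFn.agree {R₁ R : RatFn (Fin 2)}
    (h : ∀ z₁ z₂ : ℂ, ‖z₂‖ < ‖z₁‖ → 0 < ‖z₂‖ → R₁.eval ![z₁, z₂] = R.eval ![z₁, z₂])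
    {z₁ z₂ : ℂ} (h1 : z₁ ≠ 0) (h2 : z₂ ≠ 0) (h12 : z₁ ≠ z₂) :
    R₁.eval ![z₁, z₂] = R.eval ![z₁, z₂] := by
  have key : R₁.num * R.den = R.num * R₁.den := by
    let S : ℕ → ℂ := fun m => ((m : ℂ) + 2)
    have hS : Function.Injective S := by
      intro a b hab
      simpa [S] using hab
    let S' : ℕ → ℂ := fun m => ((m : ℂ) + 2)⁻¹
    have hS' : Function.Injective S' := by
      intro a b hab
      simpa [S'] using hab
    have hn : ∀ m : ℕ, ‖(m : ℂ) + 2‖ = m + 2 := by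
      intro m
      have : (m : ℂ) + 2 = ((m + 2 : ℕ) : ℂ) := by push_cast; rfl
      rw [this, Complex.norm_natCast]
      push_cast
      rfl
    refine MvPolynomial.funext_set ![Set.range S, Set.range S'] ?_ ?_
    · intro i
      fin_cases i
      · exact Set.infinite_range_of_injective hS
      · exact Set.infinite_range_of_injective hS'
    · intro x hx
      obtain ⟨m, hm⟩ := hx 0 (Set.mem_univ _)
      obtain ⟨m', hm'⟩ := hx 1 (Set.mem_univ _)
      have ex : x = ![S m, S' m'] := by
        ext i; fin_cases i
        · exact hm.symm
        · exact hm'.symm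
      have hm0 : (0 : ℝ) ≤ m := Nat.cast_nonneg m
      have hm0' : (0 : ℝ) ≤ m' := Nat.cast_nonneg m'
      have n1 : ‖S m‖ = m + 2 := hn m
      have n2 : ‖S' m'‖ = (m' + 2 : ℝ)⁻¹ := by
        change ‖((m' : ℂ) + 2)⁻¹‖ = _
        rw [norm_inv, hn]
      have l2 : 0 < ‖S' m'‖ := by rw [n2]; positivity
      have l3 : ‖S' m'‖ ≤ 1 := by
        rw [n2]; exact inv_le_one_of_one_le₀ (by linarith)
      have l1 : ‖S' m'‖ < ‖S m‖ := by rw [n1]; linarith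
      have := h (S m) (S' m') l1 l2
      rw [← ex, RatFn.eval_eq, RatFn.eval_eq] at this
      have hz : ∀ i, x i ≠ 0 := by
        rw [ex]
        exact vec2_ne_zero (norm_pos_iff.mp (l2.trans l1)) (norm_pos_iff.mp l2)
      have hd : ∀ i j, i ≠ j → x i ≠ x j := by
        rw [ex]
        exact vec2_ne fun e => by rw [e] at l1; exact lt_irrefl _ l1
      rw [div_eq_div_iff (R₁.den_ne_zero hz hd) (R.den_ne_zero hz hd)] at this
      simpa using this
  have hz := vec2_ne_zero h1 h2
  have hd := vec2_ne h12
  rw [RatFn.eval_eq, RatFn.eval_eq, div_eq_div_iff (R₁.den_ne_zero hz hd) (R.den_ne_zero hz hd),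
    ← map_mul, key, map_mul]

theorem act_X_pow_injective {ι M : Type*} [DecidableEq ι] [AddCommGroup M] [Module ℂ M] {i : ι}
    {c : ℕ} {F : (ι → ℤ) → M} (h : act (X i ^ c) F = 0) : F = 0 := by
  funext k
  have := congrFun h (k + Pi.single i (c : ℤ))
  rw [act_X_pow] at this
  simpa using this

theorem eval_tau (q : MvPolynomial (Fin 2) ℂ) (y z : ℂ) :
    MvPolynomial.eval ![y, z] (tau 0 1 q) = MvPolynomial.eval ![y + z, z] q := by
  induction q using MvPolynomial.induction_on with
  | C c => simp [tau]
  | add p q hp hq => simp [hp, hq]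
  | mul_X p i hp =>
    rw [map_mul, map_mul, map_mul, hp]
    fin_cases i
    · simp [tau]
    · simp [tau]

theorem tau_den (R : RatFn (Fin 2)) (C : ℕ) (hC : R.a 0 ≤ C) :
    tau 0 1 (X 0 ^ (C - R.a 0) * R.den) =
      X 0 ^ (R.b 0 1 + R.b 1 0) * (X 1 ^ R.a 1 * (X 0 + X 1) ^ C) *
        MvPolynomial.C ((-1 : ℂ) ^ R.b 1 0) := by
  have e : (Finset.univ : Finset (Fin 2)).offDiag = {(0, 1), (1, 0)} := by decide
  obtain ⟨d, rfl⟩ := Nat.exists_eq_add_of_le hC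
  rw [RatFn.den, e, Finset.prod_pair (by decide), Fin.prod_univ_two]
  simp only [map_mul, map_pow, map_sub, tau_X_self, tau_X_ne (show (1 : Fin 2) ≠ 0 by decide)]
  simp only [add_sub_cancel_right, sub_add_cancel_right, add_tsub_cancel_left, map_neg, map_one]
  rw [neg_pow (X 0 : MvPolynomial (Fin 2) ℂ) (R.b 1 0)]
  ring

theorem assoc_scalar {F H : ℤ → ℤ → ℂ} (hTB : TB F) {C : ℕ} {R₁ R : RatFn (Fin 2)}
    (hC : R₁.a 0 ≤ C)
    (h1 : ∀ z₁ z₂ : ℂ, ‖z₂‖ < ‖z₁‖ → 0 < ‖z₂‖ →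
      AbsConvTo (fun k : ℤ × ℤ => F k.1 k.2 * (z₁ ^ k.1 * z₂ ^ k.2)) (R₁.eval ![z₁, z₂]))
    (h2 : ∀ z₁ z₂ : ℂ, ‖z₂‖ < ‖z₁‖ → 0 < ‖z₂‖ →
      AbsConvTo (fun k : ℤ × ℤ => F k.1 k.2 * (z₁ ^ k.1 * z₂ ^ k.2)) (R.eval ![z₁, z₂]))
    (h3 : ∀ z₁ z₂ : ℂ, ‖z₁ - z₂‖ < ‖z₂‖ → 0 < ‖z₁ - z₂‖ →
      AbsConvTo (fun k : ℤ × ℤ => H k.1 k.2 * ((z₁ - z₂) ^ k.1 * z₂ ^ k.2))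
        (R.eval ![z₁, z₂])) :
    (Qe 1 ^ C) (T2 F - H) = 0 := by
  have hagree : ∀ z₁ z₂ : ℂ, z₁ ≠ 0 → z₂ ≠ 0 → z₁ ≠ z₂ →
      R₁.eval ![z₁, z₂] = R.eval ![z₁, z₂] := fun z₁ z₂ =>
    RatFn.agree fun z₁ z₂ hl hp => (h1 z₁ z₂ hl hp).2.unique (h2 z₁ z₂ hl hp).2
  have h01 : (0 : Fin 2) ≠ 1 := by decide
  set F' : (Fin 2 → ℤ) → ℂ := fun k => F (k 0) (k 1) with hF'
  set H' : (Fin 2 → ℤ) → ℂ := fun k => H (k 0) (k 1) with hH'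
  set P : MvPolynomial (Fin 2) ℂ := X 0 ^ (C - R₁.a 0) * R₁.den with hP
  set g : MvPolynomial (Fin 2) ℂ := X 0 ^ (C - R₁.a 0) * R₁.num with hg
  have hPg : ∀ z₁ z₂ : ℂ, z₁ ≠ 0 → z₂ ≠ 0 → z₁ ≠ z₂ →
      MvPolynomial.eval ![z₁, z₂] P * R₁.eval ![z₁, z₂] = MvPolynomial.eval ![z₁, z₂] g := by
    intro z₁ z₂ hz1 hz2 h12
    rw [RatFn.eval_eq, hP, hg, map_mul, map_mul]
    have := R₁.den_ne_zero (vec2_ne_zero hz1 hz2) (vec2_ne h12)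
    field_simp
  have hvec : ∀ z : Fin 2 → ℂ, z = ![z 0, z 1] := by
    intro z; ext i; fin_cases i <;> rfl
  have eq1 : act P F' = act g delta := by
    rw [← sub_eq_zero]
    refine AC_unique (r := 2) (s := 1) two_pos one_pos fun z hz0 hz1 => ?_
    rw [hvec z]
    have n0 : z 0 ≠ 0 := norm_pos_iff.mp (by rw [hz0]; norm_num)
    have n1 : z 1 ≠ 0 := norm_pos_iff.mp (by rw [hz1]; norm_num)
    have n01 : z 0 ≠ z 1 := fun e => by rw [e, hz1] at hz0; norm_num at hz0
    have hz := vec2_ne_zero n0 n1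
    have a1 : AC ![z 0, z 1] F' (R₁.eval ![z 0, z 1]) := by
      refine ((h1 (z 0) (z 1) (by rw [hz0, hz1]; norm_num) (by rw [hz1]; norm_num)).comp_equiv
        (finTwoArrowEquiv ℤ)).congr (fun k => ?_) rfl
      simp [hF', Fin.prod_univ_two]
    refine ((a1.act hz P).add (((AC_delta _).act hz g).mul_left (-1))).congr (fun k => ?_) ?_
    · simp only [Pi.sub_apply]
      ring
    · rw [hPg _ _ n0 n1 n01]
      ring
  have eq2 : act (tau 0 1 P) H' = act (tau 0 1 g) delta := by
    rw [← sub_eq_zero]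
    refine AC_unique (r := 1) (s := 2) one_pos two_pos fun z hz0 hz1 => ?_
    rw [hvec z]
    have n0 : z 0 ≠ 0 := norm_pos_iff.mp (by rw [hz0]; norm_num)
    have n1 : z 1 ≠ 0 := norm_pos_iff.mp (by rw [hz1]; norm_num)
    have n01 : z 0 + z 1 ≠ 0 := fun e => by
      rw [eq_neg_of_add_eq_zero_left e, norm_neg, hz1] at hz0
      norm_num at hz0
    have hz := vec2_ne_zero n0 n1
    have n2 : z 0 + z 1 ≠ z 1 := fun e => n0 (by simpa using e)
    have a1 : AC ![z 0, z 1] H' (R₁.eval ![z 0 + z 1, z 1]) := by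
      have := h3 (z 0 + z 1) (z 1) (by rw [add_sub_cancel_right, hz0, hz1]; norm_num)
        (by rw [add_sub_cancel_right, hz0]; norm_num)
      rw [add_sub_cancel_right] at this
      refine (this.comp_equiv (finTwoArrowEquiv ℤ)).congr (fun k => ?_)
        (hagree _ _ n01 n1 n2).symm
      simp [hH', Fin.prod_univ_two]
    refine ((a1.act hz (tau 0 1 P)).add
      (((AC_delta _).act hz (tau 0 1 g)).mul_left (-1))).congr (fun k => ?_) ?_
    · simp only [Pi.sub_apply]
      ring
    · rw [eval_tau, eval_tau, hPg _ _ n01 n1 n2]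
      ring
  have hLB : LB 0 1 F' := by
    obtain ⟨N, hN⟩ := hTB
    exact fun k => ⟨N, fun k' _ hlt => hN _ _ hlt⟩
  have hLd : LB 0 1 (delta : (Fin 2 → ℤ) → ℂ) := by
    refine fun k => ⟨0, fun k' _ hlt => ?_⟩
    have : k' ≠ 0 := by rintro rfl; simp at hlt
    simp [delta, this]
  have eq3 : act (tau 0 1 P) (TT 0 1 F' - H') = 0 := by
    rw [map_sub, eq2, ← TT_act h01 P hLB, eq1, TT_act h01 g hLd, TT_delta h01, sub_self]
  rw [hP, tau_den R₁ C hC, act_mul, act_mul, act_C] at eq3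
  have eq4 := act_X_pow_injective eq3
  rw [act_mul] at eq4
  have eq5 := act_X_pow_injective eq4
  rw [map_smul, smul_eq_zero] at eq5
  have eq6 := eq5.resolve_left (pow_ne_zero _ (by norm_num))
  have e : TT 0 1 F' - H' = fun k => (T2 F - H) (k 0) (k 1) := by
    funext k
    have := TT_family 0 1 h01 (fun _ => F) (fun _ _ _ => rfl) k
    rw [Pi.sub_apply, this]
    rfl
  rw [e] at eq6
  funext a b
  have := act_family 0 1 h01 1 C (fun _ => T2 F - H) (fun _ _ _ => rfl) ![a, b]
  rw [map_one, one_mul, eq6] at this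
  exact this.symm

theorem AbsConvTo.neg_sub_one {f : ℤ → ℤ → ℂ} {x y s : ℂ} (h : AbsConvTo (fun k : ℤ × ℤ =>
      f (-k.1 - 1) (-k.2 - 1) * x ^ (-k.1 - 1) * y ^ (-k.2 - 1)) s) :
    AbsConvTo (fun k : ℤ × ℤ => f k.1 k.2 * (x ^ k.1 * y ^ k.2)) s := by
  refine (h.comp_equiv ((Equiv.subLeft (-1 : ℤ)).prodCongr (Equiv.subLeft (-1 : ℤ)))).congr
    (fun k => ?_) rfl
  have e : ∀ k : ℤ, -(-1 - k) - 1 = k := fun k => by ring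
  simp only [Equiv.prodCongr_apply, Prod.map_fst, Prod.map_snd, Equiv.subLeft_apply, e, mul_assoc]

theorem assoc_formal {M : Type*} [AddCommGroup M] [Module ℂ M] (S : (M →ₗ[ℂ] ℂ) → Prop)
    (hS : ∀ x : M, (∀ φ, S φ → φ x = 0) → x = 0) {F H : ℤ → ℤ → M} (hTB : TB F) {C : ℕ}
    (h1 : ∀ φ, S φ → ∃ R : RatFn (Fin 2), R.a 0 ≤ C ∧ ∀ z₁ z₂ : ℂ, ‖z₂‖ < ‖z₁‖ → 0 < ‖z₂‖ →
      AbsConvTo (fun k : ℤ × ℤ => φ (F (-k.1 - 1) (-k.2 - 1)) * z₁ ^ (-k.1 - 1) * z₂ ^ (-k.2 - 1))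
        (R.eval ![z₁, z₂]))
    (h2 : ∀ φ, S φ → ∃ R : RatFn (Fin 2), (∀ z₁ z₂ : ℂ, ‖z₂‖ < ‖z₁‖ → 0 < ‖z₂‖ →
      AbsConvTo (fun k : ℤ × ℤ => φ (F (-k.1 - 1) (-k.2 - 1)) * z₁ ^ (-k.1 - 1) * z₂ ^ (-k.2 - 1))
        (R.eval ![z₁, z₂])) ∧ (∀ z₁ z₂ : ℂ, ‖z₁ - z₂‖ < ‖z₂‖ → 0 < ‖z₁ - z₂‖ →
      AbsConvTo (fun k : ℤ × ℤ =>
          φ (H (-k.1 - 1) (-k.2 - 1)) * (z₁ - z₂) ^ (-k.1 - 1) * z₂ ^ (-k.2 - 1))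
        (R.eval ![z₁, z₂]))) :
    (Qe 1 ^ C) (T2 F - H) = 0 := by
  suffices h : ∀ a b, (Qe 1 ^ C) (T2 F - H) a b = 0 from funext₂ h
  intro a b
  refine hS _ fun φ hφ => ?_
  obtain ⟨R₁, hC, hR₁⟩ := h1 φ hφ
  obtain ⟨R, hR, hR'⟩ := h2 φ hφ
  have hTB' : TB fun a b => φ (F a b) := by
    obtain ⟨N, hN⟩ := hTB
    exact ⟨N, fun a b hb => by simp only [hN a b hb, map_zero]⟩
  have k1 : ∀ z₁ z₂ : ℂ, ‖z₂‖ < ‖z₁‖ → 0 < ‖z₂‖ →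
      AbsConvTo (fun k : ℤ × ℤ => φ (F k.1 k.2) * (z₁ ^ k.1 * z₂ ^ k.2)) (R₁.eval ![z₁, z₂]) :=
    fun z₁ z₂ hl hp => AbsConvTo.neg_sub_one (f := fun a b => φ (F a b)) (hR₁ z₁ z₂ hl hp)
  have k2 : ∀ z₁ z₂ : ℂ, ‖z₂‖ < ‖z₁‖ → 0 < ‖z₂‖ →
      AbsConvTo (fun k : ℤ × ℤ => φ (F k.1 k.2) * (z₁ ^ k.1 * z₂ ^ k.2)) (R.eval ![z₁, z₂]) :=
    fun z₁ z₂ hl hp => AbsConvTo.neg_sub_one (f := fun a b => φ (F a b)) (hR z₁ z₂ hl hp)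
  have k3 : ∀ z₁ z₂ : ℂ, ‖z₁ - z₂‖ < ‖z₂‖ → 0 < ‖z₁ - z₂‖ →
      AbsConvTo (fun k : ℤ × ℤ => φ (H k.1 k.2) * ((z₁ - z₂) ^ k.1 * z₂ ^ k.2))
        (R.eval ![z₁, z₂]) :=
    fun z₁ z₂ hl hp => AbsConvTo.neg_sub_one (f := fun a b => φ (H a b)) (hR' z₁ z₂ hl hp)
  have key := assoc_scalar (F := fun a b => φ (F a b)) (H := fun a b => φ (H a b)) hTB' hC k1 k2 k3
  have e : (T2 (fun a b => φ (F a b)) - fun a b => φ (H a b)) =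
      fun a b => φ ((T2 F - H) a b) := by
    rw [T2_map φ hTB]
    funext a b
    simp
  rw [e, Qe_pow_map] at key
  have := congrFun₂ key a b
  simpa only [Pi.zero_apply] using this

end Assoc

/-! ### Exponentials of the derivation -/

section Exp

variable {M M' : Type*} [AddCommGroup M] [Module ℂ M] [AddCommGroup M'] [Module ℂ M']

/-- Truncation from below. -/
def BB (g : ℤ → M) : Prop := ∃ N : ℤ, ∀ a, a < N → g a = 0

omit [Module ℂ M] in
theorem BB.add {g h : ℤ → M} (hg : BB g) (hh : BB h) : BB (g + h) := by
  obtain ⟨N, hN⟩ := hg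
  obtain ⟨N', hN'⟩ := hh
  refine ⟨min N N', fun a ha => ?_⟩
  rw [Pi.add_apply, hN a (by omega), hN' a (by omega), add_zero]

theorem BB.smul (c : ℂ) {g : ℤ → M} (hg : BB g) : BB (c • g) := by
  obtain ⟨N, hN⟩ := hg
  exact ⟨N, fun a ha => by rw [Pi.smul_apply, hN a ha, smul_zero]⟩

omit [Module ℂ M] in
theorem BB.shift {g : ℤ → M} (hg : BB g) : BB (fun a => g (a - 1)) := by
  obtain ⟨N, hN⟩ := hg
  exact ⟨N, fun a ha => hN _ (by omega)⟩

/-- The substitution `x ↦ -x`. -/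
def sg : (ℤ → M) →ₗ[ℂ] (ℤ → M) where
  toFun g a := (-1 : ℂ) ^ a • g a
  map_add' g h := by funext a; simp
  map_smul' c g := by funext a; exact smul_comm _ _ _

theorem sg_apply (g : ℤ → M) (a : ℤ) : sg g a = (-1 : ℂ) ^ a • g a := rfl

theorem BB.sg {g : ℤ → M} (hg : BB g) : BB (sg g) := by
  obtain ⟨N, hN⟩ := hg
  exact ⟨N, fun a ha => by rw [sg_apply, hN a ha, smul_zero]⟩

theorem sg_shift (g : ℤ → M) : sg (fun a => g (a - 1)) = -fun a => sg g (a - 1) := by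
  funext a
  have h : (-1 : ℂ) ^ a = -(-1 : ℂ) ^ (a - 1) := by
    rw [zpow_sub_one₀ (by norm_num)]; norm_num
  rw [sg_apply, h, Pi.neg_apply, sg_apply, neg_smul]

/-- Multiplication by `e^{xD}`. -/
def expS (D : M →ₗ[ℂ] M) (g : ℤ → M) (a : ℤ) : M :=
  ∑ᶠ m : ℕ, ((m.factorial : ℂ))⁻¹ • (D ^ m) (g (a - m))

theorem expS_eq (D : M →ₗ[ℂ] M) {g : ℤ → M} {N : ℤ} (hN : ∀ a, a < N → g a = 0) {a : ℤ} {K : ℕ}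
    (hK : a - N < K) :
    expS D g a = ∑ m ∈ Finset.range K, ((m.factorial : ℂ))⁻¹ • (D ^ m) (g (a - m)) :=
  finsum_eq_range fun j hj => by rw [hN _ (by omega), map_zero, smul_zero]

theorem BB.expS (D : M →ₗ[ℂ] M) {g : ℤ → M} (hg : BB g) : BB (expS D g) := by
  obtain ⟨N, hN⟩ := hg
  exact ⟨N, fun a ha => by rw [expS_eq D hN (K := 0) (by omega)]; simp⟩

theorem expS_add (D : M →ₗ[ℂ] M) {g h : ℤ → M} (hg : BB g) (hh : BB h) :
    expS D (g + h) = expS D g + expS D h := by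
  obtain ⟨N, hN⟩ := hg
  obtain ⟨N', hN'⟩ := hh
  funext a
  have hN'' : ∀ a, a < min N N' → (g + h) a = 0 := fun a ha => by
    rw [Pi.add_apply, hN a (by omega), hN' a (by omega), add_zero]
  obtain ⟨K, hK⟩ : ∃ K : ℕ, a - min N N' < K := ⟨(a - min N N' + 1).toNat, by omega⟩
  rw [Pi.add_apply, expS_eq D hN (K := K) (by omega), expS_eq D hN' (K := K) (by omega),
    expS_eq D hN'' hK, ← Finset.sum_add_distrib]
  simp only [Pi.add_apply, map_add, smul_add]

theorem expS_smul (D : M →ₗ[ℂ] M) (c : ℂ) (g : ℤ → M) : expS D (c • g) = c • expS D g := by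
  funext a
  simp only [expS, Pi.smul_apply, smul_finsum, map_smul, smul_comm c]

theorem expS_neg (D : M →ₗ[ℂ] M) (g : ℤ → M) : expS D (-g) = -expS D g := by
  have := expS_smul D (-1) g
  simpa using this

theorem expS_shift (D : M →ₗ[ℂ] M) (g : ℤ → M) :
    expS D (fun a => g (a - 1)) = fun a => expS D g (a - 1) := by
  funext a
  simp only [expS]
  refine finsum_congr fun m => ?_
  rw [sub_right_comm]

/-- Rows are truncated from below. -/
def RB (K : ℤ → ℤ → M) : Prop := ∀ a, BB (K a)

theorem RB.Qe {K : ℤ → ℤ → M} (h : RB K) (ε : ℂ) : RB (Qe ε K) := fun a =>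
  (h (a - 1)).add ((h a).shift.smul ε)

theorem RB.sub {K L : ℤ → ℤ → M} (h : RB K) (h' : RB L) : RB (K - L) := fun a => by
  have := (h a).add ((h' a).smul (-1))
  rwa [neg_one_smul, ← sub_eq_add_neg] at this

/-- `K(x, -y) ↦ e^{yD} K(x, -y)`. -/
def E1 (D : M →ₗ[ℂ] M) (K : ℤ → ℤ → M) : ℤ → ℤ → M := fun a => expS D (sg (K a))

theorem E1_sub (D : M →ₗ[ℂ] M) {K L : ℤ → ℤ → M} (h : RB K) (h' : RB L) :
    E1 D (K - L) = E1 D K - E1 D L := by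
  funext a
  rw [E1, Pi.sub_apply, map_sub, sub_eq_add_neg, expS_add D (h a).sg, expS_neg, ← sub_eq_add_neg]
  · rfl
  · have := (h' a).sg.smul (-1)
    rwa [neg_one_smul] at this

theorem E1_Qe (D : M →ₗ[ℂ] M) {K : ℤ → ℤ → M} (h : RB K) (ε : ℂ) :
    E1 D (Qe ε K) = Qe (-ε) (E1 D K) := by
  funext a b
  have e : Qe ε K a = K (a - 1) + ε • fun b => K a (b - 1) := rfl
  rw [E1, e, map_add, map_smul, sg_shift, expS_add D (h _).sg, expS_smul, expS_neg, expS_shift,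
    Qe_apply]
  · simp [E1]
  · have := ((h a).sg.shift.smul (-1)).smul ε
    rwa [neg_one_smul] at this

theorem E1_Qe_pow (D : M →ₗ[ℂ] M) {K : ℤ → ℤ → M} (h : RB K) (ε : ℂ) (C : ℕ) :
    E1 D ((Qe ε ^ C) K) = (Qe (-ε) ^ C) (E1 D K) := by
  induction C generalizing K with
  | zero => rfl
  | succ C ih =>
    rw [pow_succ, Module.End.mul_apply, ih (h.Qe ε), E1_Qe D h, pow_succ, Module.End.mul_apply]

theorem E1_zero (D : M →ₗ[ℂ] M) : E1 D (0 : ℤ → ℤ → M) = 0 := by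
  funext a b
  simp [E1, expS]

theorem swap_Qe (K : ℤ → ℤ → M) :
    Qe (-1) (fun a b => K b a) = -fun a b => (Qe (-1) K) b a := by
  funext a b
  simp [Qe_apply]

theorem swap_Qe_pow (K : ℤ → ℤ → M) (C : ℕ) :
    (Qe (-1) ^ C) (fun a b => K b a) = (-1 : ℂ) ^ C • fun a b => ((Qe (-1) ^ C) K) b a := by
  induction C generalizing K with
  | zero => simp
  | succ C ih =>
    rw [pow_succ, Module.End.mul_apply, swap_Qe, map_neg, ih, Module.End.mul_apply, pow_succ,
      mul_neg_one, neg_smul]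

/-- Multiplication by a power of `x + y` commutes with `e^{(x+y)D}`. -/
theorem Qe_pow_E1_swap (D : M →ₗ[ℂ] M) {K : ℤ → ℤ → M} (h : RB K)
    (h' : RB fun a b => E1 D K b a) (C : ℕ) (hC : (Qe 1 ^ C) K = 0) :
    (Qe 1 ^ C) (E1 D fun a b => E1 D K b a) = 0 := by
  have := E1_Qe_pow D h' (-1) C
  rw [neg_neg] at this
  rw [← this, swap_Qe_pow, ← E1_Qe_pow D h, hC, E1_zero]
  exact (congrArg _ (smul_zero _)).trans (E1_zero D)

/-- The derivative in `x` of a family of series. -/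
def dX : Module.End ℂ (M →ₗ[ℂ] (ℤ → M')) where
  toFun f :=
    { toFun := fun v a => ((a : ℂ) + 1) • f v (a + 1)
      map_add' := fun v w => by funext a; simp
      map_smul' := fun c v => by
        funext a
        rw [map_smul]
        exact smul_comm _ _ _ }
  map_add' f g := by ext v a; simp
  map_smul' c f := by ext v a; exact smul_comm _ _ _

theorem dX_apply (f : M →ₗ[ℂ] (ℤ → M')) (v : M) (a : ℤ) :
    dX f v a = ((a : ℂ) + 1) • f v (a + 1) := rfl

/-- Composition with a linear map on the target. -/
def lC (D : M' →ₗ[ℂ] M') : Module.End ℂ (M →ₗ[ℂ] (ℤ → M')) where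
  toFun f :=
    { toFun := fun v a => D (f v a)
      map_add' := fun v w => by funext a; simp
      map_smul' := fun c v => by funext a; simp }
  map_add' f g := by ext v a; simp
  map_smul' c f := by ext v a; simp

theorem lC_apply (D : M' →ₗ[ℂ] M') (f : M →ₗ[ℂ] (ℤ → M')) (v : M) (a : ℤ) :
    lC D f v a = D (f v a) := rfl

/-- Composition with a linear map on the source. -/
def rC (D : M →ₗ[ℂ] M) : Module.End ℂ (M →ₗ[ℂ] (ℤ → M')) where
  toFun f := f ∘ₗ D
  map_add' _ _ := rfl
  map_smul' _ _ := rfl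

theorem rC_apply (D : M →ₗ[ℂ] M) (f : M →ₗ[ℂ] (ℤ → M')) (v : M) : rC D f v = f (D v) := rfl

theorem dX_pow_apply (j : ℕ) (f : M →ₗ[ℂ] (ℤ → M')) (v : M) (a : ℤ) :
    (dX ^ j) f v a = ((j.factorial : ℂ) * cf a j) • f v (a + j) := by
  induction j generalizing f with
  | zero => simp [cf_zero]
  | succ j ih =>
    rw [pow_succ, Module.End.mul_apply, ih, dX_apply, smul_smul]
    congr 1
    · have := cf_succ_mul a j
      rw [Nat.factorial_succ]
      push_cast
      linear_combination (-(j.factorial : ℂ)) * this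
    · push_cast; rw [add_assoc]

theorem lC_pow_apply (D : M' →ₗ[ℂ] M') (j : ℕ) (f : M →ₗ[ℂ] (ℤ → M')) (v : M) (a : ℤ) :
    (lC D ^ j) f v a = (D ^ j) (f v a) := by
  induction j generalizing f with
  | zero => rfl
  | succ j ih => rw [pow_succ, Module.End.mul_apply, ih, lC_apply, pow_succ, Module.End.mul_apply]

theorem rC_pow_apply (D : M →ₗ[ℂ] M) (j : ℕ) (f : M →ₗ[ℂ] (ℤ → M')) (v : M) :
    (rC D ^ j) f v = f ((D ^ j) v) := by
  induction j generalizing f v with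
  | zero => rfl
  | succ j ih => rw [pow_succ', Module.End.mul_apply, rC_apply, ih, pow_succ, Module.End.mul_apply]

theorem commute_rC_dX (D : M →ₗ[ℂ] M) :
    Commute (rC D : Module.End ℂ (M →ₗ[ℂ] (ℤ → M'))) dX := by
  ext f v a; rfl

theorem commute_lC_dX (D : M' →ₗ[ℂ] M') :
    Commute (lC D : Module.End ℂ (M →ₗ[ℂ] (ℤ → M'))) dX := by
  ext f v a
  exact map_smul D _ _

theorem commute_lC_rC (D : M' →ₗ[ℂ] M') (D' : M →ₗ[ℂ] M) :
    Commute (lC D : Module.End ℂ (M →ₗ[ℂ] (ℤ → M'))) (rC D') := by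
  ext f v a; rfl

theorem pow_apply_eq_of_commute {E : Type*} [AddCommGroup E] [Module ℂ E] {S T : Module.End ℂ E}
    (h : Commute S T) {x : E} (hx : S x = T x) (n : ℕ) : (S ^ n) x = (T ^ n) x := by
  induction n with
  | zero => rfl
  | succ n ih =>
    rw [pow_succ, Module.End.mul_apply, hx, ← Module.End.mul_apply, (h.pow_left n).eq,
      Module.End.mul_apply, ih, pow_succ', Module.End.mul_apply]

/-- The commutator formula of a family of series with the derivations. -/
def DF (f : M →ₗ[ℂ] (ℤ → M')) (D₁ : M →ₗ[ℂ] M) (D₂ : M' →ₗ[ℂ] M') : Prop :=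
  ∀ v a, D₂ (f v a) = f (D₁ v) a + ((a : ℂ) + 1) • f v (a + 1)

theorem choose_div (n : ℕ) {p : ℕ × ℕ} (hp : p ∈ Finset.HasAntidiagonal.antidiagonal n) :
    ((n.factorial : ℂ))⁻¹ * (n.choose p.1 : ℂ) * (p.2.factorial : ℂ) = ((p.1.factorial : ℂ))⁻¹ := by
  obtain ⟨i, j⟩ := p
  obtain rfl : i + j = n := Finset.HasAntidiagonal.mem_antidiagonal.mp hp
  have h1 : ((i + j).factorial : ℂ) ≠ 0 := by exact_mod_cast (i + j).factorial_ne_zero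
  have h2 : (i.factorial : ℂ) ≠ 0 := by exact_mod_cast i.factorial_ne_zero
  have := Nat.choose_mul_factorial_mul_factorial (Nat.le_add_right i j)
  rw [Nat.add_sub_cancel_left] at this
  have : ((i + j).choose i : ℂ) * i.factorial * j.factorial = (i + j).factorial := by
    exact_mod_cast this
  field_simp
  linear_combination this

theorem DF.left_pow {f : M →ₗ[ℂ] (ℤ → M')} {D₁ : M →ₗ[ℂ] M} {D₂ : M' →ₗ[ℂ] M'} (h : DF f D₁ D₂)
    (n : ℕ) (v : M) (a : ℤ) :
    ((n.factorial : ℂ))⁻¹ • (D₂ ^ n) (f v a) = ∑ p ∈ Finset.HasAntidiagonal.antidiagonal n,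
      cf a p.2 • f (((p.1.factorial : ℂ))⁻¹ • (D₁ ^ p.1) v) (a + p.2) := by
  have e : lC D₂ f = (rC D₁ + dX : Module.End ℂ (M →ₗ[ℂ] (ℤ → M'))) f := by ext v a; exact h v a
  have := pow_apply_eq_of_commute ((commute_lC_rC D₂ D₁).add_right (commute_lC_dX D₂)) e n
  rw [← lC_pow_apply, this, (commute_rC_dX D₁).add_pow', LinearMap.sum_apply, LinearMap.sum_apply,
    Finset.sum_apply, Finset.smul_sum]
  refine Finset.sum_congr rfl fun p hp => ?_
  rw [LinearMap.smul_apply, LinearMap.smul_apply, Pi.smul_apply, Module.End.mul_apply,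
    rC_pow_apply, dX_pow_apply, map_smul, Pi.smul_apply, ← Nat.cast_smul_eq_nsmul ℂ, smul_smul,
    smul_smul, smul_smul, ← choose_div n hp]
  congr 1
  ring

theorem DF.right_pow {f : M →ₗ[ℂ] (ℤ → M')} {D₁ : M →ₗ[ℂ] M} {D₂ : M' →ₗ[ℂ] M'} (h : DF f D₁ D₂)
    (n : ℕ) (v : M) (a : ℤ) :
    f (((n.factorial : ℂ))⁻¹ • (D₁ ^ n) v) a = ∑ p ∈ Finset.HasAntidiagonal.antidiagonal n,
      ((-1 : ℂ) ^ p.2 * cf a p.2) • ((p.1.factorial : ℂ))⁻¹ • (D₂ ^ p.1) (f v (a + p.2)) := by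
  have e : rC D₁ f = (lC D₂ + (-1 : ℂ) • dX : Module.End ℂ (M →ₗ[ℂ] (ℤ → M'))) f := by
    ext v a
    have := h v a
    change f (D₁ v) a = D₂ (f v a) + (-1 : ℂ) • (((a : ℂ) + 1) • f v (a + 1))
    rw [this, neg_one_smul, add_neg_cancel_right]
  have := pow_apply_eq_of_commute
    ((commute_lC_rC D₂ D₁).symm.add_right ((commute_rC_dX D₁).smul_right _)) e n
  rw [map_smul, ← rC_pow_apply, this, ((commute_lC_dX D₂).smul_right _).add_pow',
    LinearMap.sum_apply,
    LinearMap.sum_apply, Pi.smul_apply, Finset.sum_apply, Finset.smul_sum]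
  refine Finset.sum_congr rfl fun p hp => ?_
  rw [LinearMap.smul_apply, LinearMap.smul_apply, Pi.smul_apply, Module.End.mul_apply,
    lC_pow_apply, smul_pow, LinearMap.smul_apply, LinearMap.smul_apply, Pi.smul_apply,
    dX_pow_apply, map_smul, map_smul, ← Nat.cast_smul_eq_nsmul ℂ, smul_smul, smul_smul, smul_smul,
    smul_smul, ← choose_div n hp]
  congr 1
  ring

omit [Module ℂ M] in
theorem sum_range_antidiagonal (h : ℕ → ℕ → M) {K : ℕ} (hK : ∀ i j, K ≤ i + j → h i j = 0) :
    ∑ n ∈ Finset.range K, ∑ p ∈ Finset.HasAntidiagonal.antidiagonal n, h p.1 p.2 =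
      ∑ i ∈ Finset.range K, ∑ j ∈ Finset.range K, h i j := by
  rw [← Finset.sum_product', Finset.sum_sigma']
  refine Finset.sum_of_injOn (fun p => p.2) ?_ ?_ ?_ ?_
  · rintro ⟨n, p⟩ hp ⟨n', p'⟩ hp' (rfl : p = p')
    simp only [Finset.coe_sigma, Set.mem_sigma_iff, Finset.mem_coe,
      Finset.HasAntidiagonal.mem_antidiagonal] at hp hp'
    rw [Sigma.mk.injEq]
    exact ⟨hp.2.symm.trans hp'.2, HEq.rfl⟩
  · rintro ⟨n, p⟩ hp
    simp only [Finset.coe_sigma, Set.mem_sigma_iff, Finset.mem_coe, Finset.mem_range,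
      Finset.HasAntidiagonal.mem_antidiagonal] at hp
    simp only [Finset.coe_product, Finset.coe_range, Set.mem_prod, Set.mem_Iio]
    omega
  · rintro p - hp
    refine hK _ _ ?_
    by_contra hlt
    refine hp ⟨⟨p.1 + p.2, p⟩, ?_, rfl⟩
    simp only [Finset.coe_sigma, Set.mem_sigma_iff, Finset.mem_coe, Finset.mem_range,
      Finset.HasAntidiagonal.mem_antidiagonal, and_true]
    omega
  · intro p _
    rfl

theorem DF.T2_expS {f : M →ₗ[ℂ] (ℤ → M')} {D₁ : M →ₗ[ℂ] M} {D₂ : M' →ₗ[ℂ] M'} (h : DF f D₁ D₂)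
    {g : ℤ → M} (hg : BB g) (a b : ℤ) :
    T2 (fun a b => f (expS D₁ g b) a) a b = expS D₂ (fun b => f (g b) a) b := by
  obtain ⟨N, hN⟩ := hg
  obtain ⟨K, hK⟩ : ∃ K : ℕ, b - N < K := ⟨(b - N + 1).toNat, by omega⟩
  rw [expS_eq D₂ (N := N) (fun b hb => by rw [hN b hb, map_zero]; rfl) hK, T2,
    finsum_eq_range (K := K)]
  · let t : ℕ → ℕ → M' := fun m j =>
      cf a j • f (((m.factorial : ℂ))⁻¹ • (D₁ ^ m) (g (b - (m + j : ℕ)))) (a + j)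
    have e1 : ∀ j : ℕ, cf a j • f (expS D₁ g (b - j)) (a + j) = ∑ m ∈ Finset.range K, t m j := by
      intro j
      rw [expS_eq D₁ hN (K := K) (by omega), map_sum, Finset.sum_apply, Finset.smul_sum]
      refine Finset.sum_congr rfl fun m _ => ?_
      simp only [t, Nat.cast_add, sub_sub, add_comm (m : ℤ)]
    rw [Finset.sum_congr rfl fun j _ => e1 j, Finset.sum_comm, ← sum_range_antidiagonal t]
    · refine Finset.sum_congr rfl fun n _ => ?_
      rw [h.left_pow]
      refine Finset.sum_congr rfl fun p hp => ?_
      rw [← Finset.HasAntidiagonal.mem_antidiagonal.mp hp]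
    · intro i j hij
      simp only [t]
      rw [hN _ (by omega)]
      simp
  · intro j hj
    rw [expS_eq D₁ hN (K := 0) (by omega), Finset.sum_range_zero, map_zero, Pi.zero_apply,
      smul_zero]

theorem DF.apply_expS_sg {f : M →ₗ[ℂ] (ℤ → M')} {D₁ : M →ₗ[ℂ] M} {D₂ : M' →ₗ[ℂ] M'}
    (h : DF f D₁ D₂) {g : ℤ → M} (hg : BB g) (a c : ℤ) :
    f (expS D₁ (sg g) a) c = expS D₂ (sg (T2 (fun c a => f (g a) c) c)) a := by
  obtain ⟨N, hN⟩ := hg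
  obtain ⟨K, hK⟩ : ∃ K : ℕ, a - N < K := ⟨(a - N + 1).toNat, by omega⟩
  have hT : ∀ a : ℤ, a - N < K → T2 (fun c a => f (g a) c) c a =
      ∑ j ∈ Finset.range K, cf c j • f (g (a - j)) (c + j) := by
    intro a ha
    exact finsum_eq_range fun j hj => by
      beta_reduce
      rw [hN _ (by omega), map_zero, Pi.zero_apply, smul_zero]
  rw [expS_eq D₁ (N := N) (fun a ha => by rw [sg_apply, hN a ha, smul_zero]) hK,
    expS_eq D₂ (N := N) (K := K) _ hK, map_sum, Finset.sum_apply]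
  · let t : ℕ → ℕ → M' := fun i j => ((-1 : ℂ) ^ j * cf c j) •
      ((i.factorial : ℂ))⁻¹ • (D₂ ^ i) (f (sg g (a - (i + j : ℕ))) (c + j))
    have e1 : ∀ i : ℕ, ((i.factorial : ℂ))⁻¹ •
        (D₂ ^ i) (sg (T2 (fun c a => f (g a) c) c) (a - i)) = ∑ j ∈ Finset.range K, t i j := by
      intro i
      rw [sg_apply, hT _ (by omega), Finset.smul_sum, map_sum, Finset.smul_sum]
      refine Finset.sum_congr rfl fun j _ => ?_
      have e2 : (-1 : ℂ) ^ (a - i) = (-1) ^ j * (-1) ^ (a - (i + j : ℕ)) := by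
        have : a - i = j + (a - (i + j : ℕ)) := by push_cast; ring
        rw [this, zpow_add₀ (by norm_num), zpow_natCast]
      simp only [t, sg_apply, e2, map_smul, Pi.smul_apply, smul_smul]
      rw [Nat.cast_add, sub_sub]
      congr 1
      ring
    rw [Finset.sum_congr rfl fun i _ => e1 i, ← sum_range_antidiagonal t]
    · refine Finset.sum_congr rfl fun n _ => ?_
      rw [h.right_pow]
      refine Finset.sum_congr rfl fun p hp => ?_
      rw [← Finset.HasAntidiagonal.mem_antidiagonal.mp hp]
    · intro i j hij
      simp only [t, sg_apply]
      rw [hN _ (by omega)]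
      simp
  · intro a ha
    rw [sg_apply, hT a (by omega), Finset.sum_eq_zero, smul_zero]
    intro j _
    rw [hN _ (by omega), map_zero, Pi.zero_apply, smul_zero]

theorem T2_TB {F : ℤ → ℤ → M} {N : ℤ} (h : ∀ a b, b < N → F a b = 0) {a b : ℤ} (hb : b < N) :
    T2 F a b = 0 := by
  rw [T2, finsum_eq_zero_of_forall_eq_zero]
  intro j
  rw [h _ _ (by omega), smul_zero]

end Exp

/-! ### The opposite vertex operators -/

section Skew

variable {V W : Type*} [AddCommGroup V] [Module ℂ V] [AddCommGroup W] [Module ℂ W]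

/-- The opposite of a family of vertex operators, by coefficients. -/
def skew (D : W →ₗ[ℂ] W) (R : W →ₗ[ℂ] V →ₗ[ℂ] (ℤ → W)) (hR : ∀ w v, BB (R w v)) :
    V →ₗ[ℂ] W →ₗ[ℂ] (ℤ → W) :=
  LinearMap.mk₂ ℂ (fun v w => expS D (sg (R w v)))
    (fun v v' w => by rw [map_add, map_add, expS_add D (hR w v).sg (hR w v').sg])
    (fun c v w => by rw [map_smul, map_smul, expS_smul])
    (fun v w w' => by
      rw [map_add, LinearMap.add_apply, map_add, expS_add D (hR w v).sg (hR w' v).sg])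
    (fun c v w => by rw [map_smul, LinearMap.smul_apply, map_smul, expS_smul])

theorem skew_apply (D : W →ₗ[ℂ] W) (R : W →ₗ[ℂ] V →ₗ[ℂ] (ℤ → W)) (hR : ∀ w v, BB (R w v))
    (v : V) (w : W) : skew D R hR v w = expS D (sg (R w v)) := rfl

theorem skew_BB (D : W →ₗ[ℂ] W) (R : W →ₗ[ℂ] V →ₗ[ℂ] (ℤ → W)) (hR : ∀ w v, BB (R w v))
    (v : V) (w : W) : BB (skew D R hR v w) := (hR w v).sg.expS D

theorem expS_map_D (D : W →ₗ[ℂ] W) {g : ℤ → W} (hg : BB g) (a : ℤ) :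
    D (expS D g a) = expS D (fun a => D (g a)) a := by
  obtain ⟨N, hN⟩ := hg
  obtain ⟨K, hK⟩ : ∃ K : ℕ, a - N < K := ⟨(a - N + 1).toNat, by omega⟩
  rw [expS_eq D hN hK, expS_eq D (N := N) (fun b hb => by rw [hN b hb, map_zero]) hK, map_sum]
  refine Finset.sum_congr rfl fun m _ => ?_
  rw [map_smul, ← Module.End.mul_apply, ← Module.End.mul_apply, ← pow_succ, ← pow_succ']

/-- The derivative of `e^{xD} g(x)`. -/
theorem expS_deriv (D : W →ₗ[ℂ] W) {g : ℤ → W} (hg : BB g) (a : ℤ) :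
    ((a : ℂ) + 1) • expS D g (a + 1) =
      expS D (fun a => D (g a)) a + expS D (fun a => ((a : ℂ) + 1) • g (a + 1)) a := by
  obtain ⟨N, hN⟩ := hg
  obtain ⟨K, hK⟩ : ∃ K : ℕ, a - N + 1 < K := ⟨(a - N + 2).toNat, by omega⟩
  rw [expS_eq D hN (K := K + 1) (by push_cast; omega),
    expS_eq D (N := N) (K := K) (fun b hb => by rw [hN b hb, map_zero]) (by omega),
    expS_eq D (N := N - 1) (K := K + 1)
      (fun b hb => by rw [hN (b + 1) (by omega), smul_zero]) (by push_cast; omega), Finset.smul_sum]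
  have e : ∀ m : ℕ, ((a : ℂ) + 1) • ((m.factorial : ℂ))⁻¹ • (D ^ m) (g (a + 1 - m)) =
      (m : ℂ) • ((m.factorial : ℂ))⁻¹ • (D ^ m) (g (a + 1 - m)) +
      ((m.factorial : ℂ))⁻¹ • (D ^ m) (((a - m : ℤ) + 1 : ℂ) • g (a - m + 1)) := by
    intro m
    rw [map_smul, sub_add_eq_add_sub, smul_comm ((m.factorial : ℂ))⁻¹ ((a - m : ℤ) + 1 : ℂ),
      ← add_smul]
    congr 1
    push_cast
    ring
  rw [Finset.sum_congr rfl fun m _ => e m, Finset.sum_add_distrib]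
  congr 1
  rw [Finset.sum_range_succ']
  simp only [Nat.cast_zero, zero_smul, add_zero]
  refine Finset.sum_congr rfl fun m _ => ?_
  have h : (m.factorial : ℂ) ≠ 0 := by exact_mod_cast m.factorial_ne_zero
  have h' : (m : ℂ) + 1 ≠ 0 := by exact_mod_cast m.succ_ne_zero
  rw [smul_smul, pow_succ, Module.End.mul_apply, Nat.factorial_succ]
  congr 1
  · push_cast
    field_simp
  · congr 3
    push_cast
    ring

theorem skew_DF {D : W →ₗ[ℂ] W} {R : W →ₗ[ℂ] V →ₗ[ℂ] (ℤ → W)} (hR : ∀ w v, BB (R w v))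
    (hd : ∀ w v a, R (D w) v a = ((a : ℂ) + 1) • R w v (a + 1)) (v : V) :
    DF (skew D R hR v) D D := by
  intro w a
  rw [skew_apply, skew_apply, expS_map_D D (hR w v).sg, expS_deriv D (hR w v).sg, add_left_comm]
  refine (add_eq_left.mpr ?_).symm
  rw [← Pi.add_apply, ← expS_add D]
  · convert congrFun (expS_smul D 0 0) a using 2
    · funext a
      simp only [Pi.add_apply, sg_apply, hd]
      rw [zpow_add₀ (by norm_num), zpow_one, mul_neg_one, neg_smul, smul_neg, smul_comm]
      simp
    · simp
  · exact (hR _ v).sg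
  · obtain ⟨N, hN⟩ := hR w v
    exact ⟨N - 1, fun b hb => by
      beta_reduce; rw [sg_apply, hN (b + 1) (by omega), smul_zero, smul_zero]⟩

/-- Weak associativity of the opposite vertex operators. -/
theorem skew_weakAssoc {D : W →ₗ[ℂ] W} {DV : V →ₗ[ℂ] V} {R : W →ₗ[ℂ] V →ₗ[ℂ] (ℤ → W)}
    {Y : V →ₗ[ℂ] V →ₗ[ℂ] (ℤ → V)} (hR : ∀ w v, BB (R w v)) (hY : ∀ u v, BB (Y u v))
    (hd : ∀ w v a, R (D w) v a = ((a : ℂ) + 1) • R w v (a + 1))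
    (hc : ∀ w, DF (R w) DV D) {C : ℕ} {u₁ u₂ : V} {w : W}
    (h : (Qe 1 ^ C) (T2 (fun a b => R w (Y u₂ u₁ b) a) - fun a b => R (R w u₂ a) u₁ b) = 0) :
    WeakAssoc (skew DV Y hY) (skew D R hR) C u₁ u₂ w := by
  obtain ⟨N, hN⟩ := hY u₂ u₁
  obtain ⟨N', hN'⟩ := hR w u₂
  have rb1 : RB (T2 fun a b => R w (Y u₂ u₁ b) a) := fun a =>
    ⟨N, fun b hb => T2_TB (fun a b hb => by rw [hN b hb, map_zero]; rfl) hb⟩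
  have rb2 : RB fun a b => R (R w u₂ a) u₁ b := fun a => hR _ _
  have e1 : T2 (fun a b => skew D R hR u₁ (skew D R hR u₂ w b) a) =
      E1 D fun a b => E1 D (fun a b => R (R w u₂ a) u₁ b) b a := by
    funext a b
    rw [skew_apply, (skew_DF hR hd u₁).T2_expS (hR w u₂).sg]
    refine congrArg (fun g => expS D g b) (funext fun c => ?_)
    rw [sg_apply, map_smul, sg_apply]
    rfl
  have e2 : (fun a b => skew D R hR (skew DV Y hY u₁ u₂ a) w b) =
      E1 D fun a b => E1 D (T2 fun a b => R w (Y u₂ u₁ b) a) b a := by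
    funext a b
    rw [skew_apply, skew_apply]
    refine congrArg (fun g => expS D (sg g) b) (funext fun c => ?_)
    exact (hc w).apply_expS_sg (hY u₂ u₁) a c
  have s1 : RB fun a b => E1 D (fun a b => R (R w u₂ a) u₁ b) b a := fun a =>
    ⟨N', fun b hb => by
      have : (fun c => R (R w u₂ b) u₁ c) = 0 := by rw [hN' b hb, map_zero]; rfl
      simp only [E1]
      rw [this, map_zero]
      simp [expS]⟩
  have s2 : RB fun a b => E1 D (T2 fun a b => R w (Y u₂ u₁ b) a) b a := by
    intro a
    have hz : ∀ c b, b < N → T2 (fun a b => R w (Y u₂ u₁ b) a) c b = 0 := fun c b hb =>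
      T2_TB (fun a b hb => by rw [hN b hb, map_zero]; rfl) hb
    have hb : ∀ b : ℤ, ∃ N' : ℤ, ∀ c < N', T2 (fun a b => R w (Y u₂ u₁ b) a) c b = 0 := by
      intro b
      choose Nf hNf using fun j : ℕ => hR w (Y u₂ u₁ (b - j))
      obtain ⟨K, hK⟩ : ∃ K : ℕ, b - N < K := ⟨(b - N + 1).toNat, by omega⟩
      obtain ⟨m, hm⟩ := ((Finset.range K).image fun j : ℕ => Nf j - j).bddBelow
      refine ⟨m, fun c hc => ?_⟩
      refine finsum_eq_zero_of_forall_eq_zero fun j => ?_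
      rcases lt_or_ge j K with hj | hj
      · have := hm (Finset.mem_coe.mpr (Finset.mem_image_of_mem _ (Finset.mem_range.mpr hj)))
        beta_reduce
        rw [hNf j _ (by omega), smul_zero]
      · beta_reduce
        rw [hN _ (by omega), map_zero, Pi.zero_apply, smul_zero]
    choose Nf hNf using hb
    obtain ⟨K, hK⟩ : ∃ K : ℕ, a - N < K := ⟨(a - N + 1).toNat, by omega⟩
    obtain ⟨m, hm⟩ := ((Finset.range K).image fun j : ℕ => Nf (a - j)).bddBelow
    refine ⟨m, fun c hc => ?_⟩
    refine finsum_eq_zero_of_forall_eq_zero fun j => ?_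
    rcases lt_or_ge j K with hj | hj
    · have := hm (Finset.mem_coe.mpr (Finset.mem_image_of_mem _ (Finset.mem_range.mpr hj)))
      rw [sg_apply, hNf _ c (by omega), smul_zero, map_zero, smul_zero]
    · rw [sg_apply, hz _ _ (by omega), smul_zero, map_zero, smul_zero]
  unfold WeakAssoc
  rw [e1, e2]
  have rb := rb1.sub rb2
  have key := Qe_pow_E1_swap D rb ?_ C h
  · have e3 : (fun a b => E1 D (T2 (fun a b => R w (Y u₂ u₁ b) a) -
        fun a b => R (R w u₂ a) u₁ b) b a) =
        (fun a b => E1 D (T2 fun a b => R w (Y u₂ u₁ b) a) b a) -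
          fun a b => E1 D (fun a b => R (R w u₂ a) u₁ b) b a := by
      rw [E1_sub D rb1 rb2]; rfl
    rw [e3, E1_sub D s2 s1] at key
    rw [← neg_sub, map_neg, key, neg_zero]
  · rw [E1_sub D rb1 rb2]
    exact s2.sub s1

/-- Locality of left and opposite right vertex operators. -/
theorem skew_locality {D : W →ₗ[ℂ] W} {R : W →ₗ[ℂ] V →ₗ[ℂ] (ℤ → W)}
    {L : W →ₗ[ℂ] (ℤ → W)} (hR : ∀ w v, BB (R w v))  (hc : DF L D D) {C : ℕ} {v : V} {w : W}
    (h : (Qe 1 ^ C) (T2 (fun a b => L (R w v b) a) - fun a b => R (L w a) v b) = 0) :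
    (Qe (-1) ^ C) ((fun a b => L (skew D R hR v w b) a) -
      fun a b => skew D R hR v (L w a) b) = 0 := by
  obtain ⟨N, hN⟩ := hR w v
  have rb1 : RB (T2 fun a b => L (R w v b) a) := fun a =>
    ⟨N, fun b hb => T2_TB (fun a b hb => by rw [hN b hb, map_zero]; rfl) hb⟩
  have rb2 : RB fun a b => R (L w a) v b := fun a => hR _ _
  have e1 : (fun a b => L (skew D R hR v w b) a) = E1 D (T2 fun a b => L (R w v b) a) := by
    funext a b
    exact hc.apply_expS_sg (hR w v) b a
  have e2 : (fun a b => skew D R hR v (L w a) b) = E1 D fun a b => R (L w a) v b := rfl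
  rw [e1, e2, ← E1_sub D rb1 rb2, ← E1_Qe_pow D (rb1.sub rb2), h, E1_zero]

end Skew

section Modes

variable {M : Type*} [AddCommGroup M] [Module ℂ M]

theorem inGradedDual_comp_proj {ι : Type*} [DecidableEq ι] {proj : ι → M →ₗ[ℂ] M}
    (hc : ∀ m n, proj m ∘ₗ proj n = if m = n then proj n else 0) (ψ : M →ₗ[ℂ] ℂ) (n : ι) :
    InGradedDual proj (ψ ∘ₗ proj n) := by
  refine (Set.finite_singleton n).subset fun m hm => ?_
  by_contra hne
  refine hm ?_
  have hne' : n ≠ m := fun h => hne (by simp [h])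
  simp only [LinearMap.comp_assoc, hc, if_neg hne', LinearMap.comp_zero]

theorem eq_zero_of_proj {ι : Type*} {proj : ι → M →ₗ[ℂ] M}
    (hs : ∀ w, (∑ᶠ n, proj n w) = w) {x : M} (hx : ∀ n, proj n x = 0) : x = 0 := by
  rw [← hs x]
  exact finsum_eq_zero_of_forall_eq_zero hx

theorem gradedDual_separates {ι : Type*} [DecidableEq ι] {proj : ι → M →ₗ[ℂ] M}
    (hc : ∀ m n, proj m ∘ₗ proj n = if m = n then proj n else 0)
    (hs : ∀ w, (∑ᶠ n, proj n w) = w) (x : M)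
    (hx : ∀ φ, InGradedDual proj φ → φ x = 0) : x = 0 :=
  eq_zero_of_proj hs fun n => (Module.forall_dual_apply_eq_zero_iff ℂ _).mp fun ψ =>
    hx _ (inGradedDual_comp_proj hc ψ n)

theorem assoc_modes (S : (M →ₗ[ℂ] ℂ) → Prop) (hS : ∀ x, (∀ φ, S φ → φ x = 0) → x = 0)
    {F H : ℤ → ℤ → M} (hF : ∃ N : ℤ, ∀ k k', N ≤ k' → F k k' = 0) {C : ℕ}
    (h1 : ∀ φ, S φ → ∃ R : RatFn (Fin 2), R.a 0 ≤ C ∧ ∀ z₁ z₂ : ℂ, ‖z₂‖ < ‖z₁‖ → 0 < ‖z₂‖ →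
      AbsConvTo (fun k : ℤ × ℤ => φ (F k.1 k.2) * z₁ ^ (-k.1 - 1) * z₂ ^ (-k.2 - 1))
        (R.eval ![z₁, z₂]))
    (h2 : ∀ φ, S φ → ∃ R : RatFn (Fin 2),
      (∀ z₁ z₂ : ℂ, ‖z₂‖ < ‖z₁‖ → 0 < ‖z₂‖ →
        AbsConvTo (fun k : ℤ × ℤ => φ (F k.1 k.2) * z₁ ^ (-k.1 - 1) * z₂ ^ (-k.2 - 1))
          (R.eval ![z₁, z₂])) ∧
      (∀ z₁ z₂ : ℂ, ‖z₁ - z₂‖ < ‖z₂‖ → 0 < ‖z₁ - z₂‖ →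
        AbsConvTo (fun k : ℤ × ℤ => φ (H k.1 k.2) * (z₁ - z₂) ^ (-k.1 - 1) * z₂ ^ (-k.2 - 1))
          (R.eval ![z₁, z₂]))) :
    (Qe 1 ^ C) (T2 (fun a b => F (-a - 1) (-b - 1)) - fun a b => H (-a - 1) (-b - 1)) = 0 := by
  have hneg : ∀ k : ℤ, -(-k - 1) - 1 = k := fun k => by ring
  have hTB : TB fun a b => F (-a - 1) (-b - 1) := by
    obtain ⟨N, hN⟩ := hF
    exact ⟨-N, fun a b hb => hN _ _ (by omega)⟩
  refine assoc_formal S hS (F := fun a b => F (-a - 1) (-b - 1))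
    (H := fun a b => H (-a - 1) (-b - 1)) hTB ?_ ?_
  · simp only [hneg]
    exact h1
  · simp only [hneg]
    exact h2

theorem Qe_pow_mono {ε : ℂ} {C C' : ℕ} (h : C ≤ C') {K : ℤ → ℤ → M}
    (hK : (Qe ε ^ C) K = 0) : (Qe ε ^ C') K = 0 := by
  obtain ⟨d, rfl⟩ := Nat.exists_eq_add_of_le' h
  rw [pow_add, Module.End.mul_apply, hK, map_zero]

theorem Qe_pow_injective_of_trunc {ε : ℂ} {C : ℕ} {K : ℤ → ℤ → M} {N : ℤ}
    (hN : ∀ a b, b < N → K a b = 0) (hK : (Qe ε ^ C) K = 0) : K = 0 := by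
  induction C generalizing K with
  | zero => simpa using hK
  | succ C ih =>
    rw [pow_succ, Module.End.mul_apply] at hK
    have h := ih (K := Qe ε K) (fun a b hb => by
      rw [Qe_apply, hN _ _ hb, hN _ _ (by omega), smul_zero, add_zero]) hK
    have key : ∀ m : ℕ, ∀ a, K a (N + m) = 0 := by
      intro m
      induction m with
      | zero =>
        intro a
        have := congrFun (congrFun h (a + 1)) (N + (0 : ℕ))
        rw [Qe_apply, hN _ (N + (0 : ℕ) - 1) (by push_cast; omega), smul_zero, add_zero] at this
        simpa using this
      | succ m ihm =>
        intro a
        have := congrFun (congrFun h (a + 1)) (N + (m + 1 : ℕ))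
        rw [Qe_apply, show N + ((m + 1 : ℕ) : ℤ) - 1 = N + m by push_cast; ring, ihm,
          smul_zero, add_zero] at this
        simpa using this
    funext a b
    rcases lt_or_ge b N with hb | hb
    · exact hN a b hb
    · obtain ⟨m, hm⟩ := Int.eq_ofNat_of_zero_le (sub_nonneg.mpr hb)
      rw [show b = N + m by omega]
      exact key m a

/-- Reindexing of a mode map by the exponent of the formal variable. -/
def pw {M₁ M₂ : Type*} [AddCommGroup M₁] [Module ℂ M₁] [AddCommGroup M₂] [Module ℂ M₂]
    (f : M₁ →ₗ[ℂ] M₂ →ₗ[ℂ] (ℤ → M)) : M₁ →ₗ[ℂ] M₂ →ₗ[ℂ] (ℤ → M) :=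
  f.compr₂ (LinearMap.funLeft ℂ M fun a : ℤ => -a - 1)

theorem pw_apply {M₁ M₂ : Type*} [AddCommGroup M₁] [Module ℂ M₁] [AddCommGroup M₂] [Module ℂ M₂]
    (f : M₁ →ₗ[ℂ] M₂ →ₗ[ℂ] (ℤ → M)) (x : M₁) (y : M₂) (a : ℤ) :
    pw f x y a = f x y (-a - 1) := rfl

theorem pw_BB {M₁ M₂ : Type*} [AddCommGroup M₁] [Module ℂ M₁] [AddCommGroup M₂] [Module ℂ M₂]
    {f : M₁ →ₗ[ℂ] M₂ →ₗ[ℂ] (ℤ → M)} {x : M₁} {y : M₂}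
    (h : ∃ N : ℤ, ∀ k, N ≤ k → f x y k = 0) : BB (pw f x y) := by
  obtain ⟨N, hN⟩ := h
  exact ⟨-N, fun a ha => hN _ (show N ≤ -a - 1 by omega)⟩

/-- A weakly associative pair stays so with regular argument and exponent zero. -/
theorem WeakAssoc.of_regular {V : Type*} [AddCommGroup V] [Module ℂ V]
    {Y : V →ₗ[ℂ] V →ₗ[ℂ] (ℤ → V)} {YW : V →ₗ[ℂ] M →ₗ[ℂ] (ℤ → M)} {C : ℕ} {u₁ u₂ : V} {w : M}
    (hreg : ∀ v a, a < 0 → YW v w a = 0) (h : WeakAssoc Y YW C u₁ u₂ w) :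
    WeakAssoc Y YW 0 u₁ u₂ w := by
  refine (Qe_pow_injective_of_trunc (N := 0) (fun a b hb => ?_) h)
  change T2 (fun a b => YW u₁ (YW u₂ w b) a) a b - YW (Y u₁ u₂ a) w b = 0
  rw [hreg _ b hb, sub_zero]
  exact T2_TB (N := 0) (fun a b hb => by rw [hreg _ b hb, map_zero]; rfl) hb

end Modes

section VOA

variable {V : Type*} [AddCommGroup V] [Module ℂ V] {W : Type*} [AddCommGroup W] [Module ℂ W]
  {A : MOSVA V}

theorem MOSVA.exists_weakAssoc (hA : A.PoleOrder) (u₁ v : V) : ∃ C : ℕ, ∀ u₂,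
    (Qe 1 ^ C) (T2 (fun a b => pw A.Y u₁ (pw A.Y u₂ v b) a) -
      fun a b => pw A.Y (pw A.Y u₁ u₂ a) v b) = 0 := by
  obtain ⟨C, hC⟩ := hA u₁ v
  refine ⟨C, fun u₂ => ?_⟩
  refine assoc_modes (InGradedDual A.gr.proj)
    (gradedDual_separates A.gr.proj_comp A.gr.proj_sum)
    (F := fun k k' => A.Y u₁ (A.Y u₂ v k') k) (H := fun k k' => A.Y (A.Y u₁ u₂ k) v k')
    ?_ (fun φ hφ => hC φ hφ u₂) (fun φ hφ => A.associativity u₁ u₂ v φ hφ)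
  obtain ⟨N, hN⟩ := A.trunc u₂ v
  exact ⟨N, fun k k' hk => by rw [hN k' hk, map_zero]; rfl⟩

theorem Bimod.exists_weakAssocL {B : Bimod A W} (hB : B.PoleOrder) (u₁ : V) (w : W) :
    ∃ C : ℕ, ∀ u₂, WeakAssoc (pw A.Y) (pw B.YL) C u₁ u₂ w := by
  obtain ⟨C, hC⟩ := hB.1 u₁ w
  refine ⟨C, fun u₂ => ?_⟩
  refine assoc_modes (InGradedDual B.gr.proj)
    (gradedDual_separates B.gr.proj_comp B.gr.proj_sum)
    (F := fun k k' => B.YL u₁ (B.YL u₂ w k') k) (H := fun k k' => B.YL (A.Y u₁ u₂ k) w k')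
    ?_ (fun φ hφ => hC φ hφ u₂) (fun φ hφ => B.associativityL u₁ u₂ w φ hφ)
  obtain ⟨N, hN⟩ := B.truncL u₂ w
  exact ⟨N, fun k k' hk => by rw [hN k' hk, map_zero]; rfl⟩

theorem Bimod.exists_weakAssocR {B : Bimod A W} (hB : B.PoleOrder) (u₂ : V) (w : W) :
    ∃ C : ℕ, ∀ u₁, (Qe 1 ^ C) (T2 (fun a b => pw B.YR w (pw A.Y u₁ u₂ b) a) -
      fun a b => pw B.YR (pw B.YR w u₁ a) u₂ b) = 0 := by
  obtain ⟨C, hC⟩ := hB.2.1 u₂ w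
  refine ⟨C, fun u₁ => ?_⟩
  refine assoc_modes (InGradedDual B.gr.proj)
    (gradedDual_separates B.gr.proj_comp B.gr.proj_sum)
    (F := fun k k' => B.YR w (A.Y u₁ u₂ k') k) (H := fun k k' => B.YR (B.YR w u₁ k) u₂ k')
    ?_ (fun φ hφ => hC φ hφ u₁) (fun φ hφ => B.associativityR w u₁ u₂ φ hφ)
  obtain ⟨N, hN⟩ := A.trunc u₁ u₂
  exact ⟨N, fun k k' hk => by rw [hN k' hk, map_zero]; rfl⟩

theorem Bimod.exists_weakAssocLR {B : Bimod A W} (hB : B.PoleOrder) (u v : V) :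
    ∃ C : ℕ, ∀ w, (Qe 1 ^ C) (T2 (fun a b => pw B.YL u (pw B.YR w v b) a) -
      fun a b => pw B.YR (pw B.YL u w a) v b) = 0 := by
  obtain ⟨C, hC⟩ := hB.2.2 u v
  refine ⟨C, fun w => ?_⟩
  refine assoc_modes (InGradedDual B.gr.proj)
    (gradedDual_separates B.gr.proj_comp B.gr.proj_sum)
    (F := fun k k' => B.YL u (B.YR w v k') k) (H := fun k k' => B.YR (B.YL u w k) v k')
    ?_ (fun φ hφ => hC φ hφ w) (fun φ hφ => B.compatAssoc u v w φ hφ)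
  obtain ⟨N, hN⟩ := B.truncR w v
  exact ⟨N, fun k k' hk => by rw [hN k' hk, map_zero]; rfl⟩

/-- The operator `D` of a MOSVA as a linear map. -/
def MOSVA.Dl (A : MOSVA V) : V →ₗ[ℂ] V := LinearMap.proj (-2) ∘ₗ A.Y.flip A.vac

theorem MOSVA.pw_BB (A : MOSVA V) (u v : V) : BB (pw A.Y u v) := VA.pw_BB (A.trunc u v)

theorem Bimod.pwL_BB (B : Bimod A W) (u : V) (w : W) : BB (pw B.YL u w) :=
  VA.pw_BB (B.truncL u w)

theorem Bimod.pwR_BB (B : Bimod A W) (w : W) (u : V) : BB (pw B.YR w u) :=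
  VA.pw_BB (B.truncR w u)

theorem pw_DF {M₁ M₂ M₃ : Type*} [AddCommGroup M₁] [Module ℂ M₁] [AddCommGroup M₂] [Module ℂ M₂]
    [AddCommGroup M₃] [Module ℂ M₃] {f : M₁ →ₗ[ℂ] M₂ →ₗ[ℂ] (ℤ → M₃)} {D₂ : M₂ →ₗ[ℂ] M₂}
    {D₃ : M₃ →ₗ[ℂ] M₃} {u : M₁}
    (h : ∀ v k, D₃ (f u v k) - f u (D₂ v) k = (-(k : ℂ)) • f u v (k - 1)) :
    DF (pw f u) D₂ D₃ := by
  intro v a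
  have := h v (-a - 1)
  rw [sub_eq_iff_eq_add'] at this
  rw [pw_apply, this, pw_apply, pw_apply, show -a - 1 - 1 = -(a + 1) - 1 by ring]
  congr 2
  push_cast
  ring

theorem pw_deriv {M₁ M₂ M₃ : Type*} [AddCommGroup M₁] [Module ℂ M₁] [AddCommGroup M₂]
    [Module ℂ M₂] [AddCommGroup M₃] [Module ℂ M₃] {f : M₁ →ₗ[ℂ] M₂ →ₗ[ℂ] (ℤ → M₃)}
    {u u' : M₁} {v : M₂}
    (h : ∀ k, f u' v k = (-(k : ℂ)) • f u v (k - 1)) (a : ℤ) :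
    pw f u' v a = ((a : ℂ) + 1) • pw f u v (a + 1) := by
  rw [pw_apply, h, pw_apply, show -a - 1 - 1 = -(a + 1) - 1 by ring]
  congr 1
  push_cast
  ring

/-- The vertex operator map of the opposite algebra, indexed by exponents. -/
def MOSVA.Yop (A : MOSVA V) : V →ₗ[ℂ] V →ₗ[ℂ] (ℤ → V) := skew A.Dl (pw A.Y) A.pw_BB

/-- The opposite right vertex operator map as a bilinear map, indexed by exponents. -/
def Bimod.Yrp (B : Bimod A W) : V →ₗ[ℂ] W →ₗ[ℂ] (ℤ → W) := skew B.DW (pw B.YR) B.pwR_BB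

theorem Bimod.Yrp_apply (B : Bimod A W) (v : V) (w : W) (k : ℤ) :
    B.Yrp v w (-k - 1) = B.YsR v w k := by
  change expS B.DW (sg (pw B.YR w v)) (-k - 1) = _
  refine finsum_congr fun m => ?_
  have e : (-1 : ℂ) ^ (-k - 1 - (m : ℤ)) = (-1) ^ (k + m + 1) := by
    rw [show -k - 1 - (m : ℤ) = -(k + m + 1) by ring, zpow_neg, ← inv_zpow]
    norm_num
  rw [sg_apply, pw_apply, map_smul, smul_smul, e, mul_comm,
    show -(-k - 1 - (m : ℤ)) - 1 = k + m by ring]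

theorem MOSVA.Yop_weakAssoc (hA : A.PoleOrder) (u₁ v : V) :
    ∃ C : ℕ, ∀ u₂, WeakAssoc A.Yop A.Yop C u₁ u₂ v := by
  obtain ⟨C, hC⟩ := A.exists_weakAssoc hA v u₁
  refine ⟨C, fun u₂ => skew_weakAssoc A.pw_BB A.pw_BB ?_ ?_ (hC u₂)⟩
  · exact fun w v a => pw_deriv (A.D_deriv w v) a
  · exact fun w => pw_DF (A.D_comm w)

theorem Bimod.Yrp_weakAssoc {B : Bimod A W} (hB : B.PoleOrder) (u₁ : V) (w : W) :
    ∃ C : ℕ, ∀ u₂, WeakAssoc A.Yop B.Yrp C u₁ u₂ w := by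
  obtain ⟨C, hC⟩ := B.exists_weakAssocR hB u₁ w
  refine ⟨C, fun u₂ => skew_weakAssoc B.pwR_BB A.pw_BB ?_ ?_ (hC u₂)⟩
  · exact fun w v a => pw_deriv (B.D_derivR w v) a
  · exact fun w => pw_DF (B.D_commR w)

theorem Bimod.exists_locality {B : Bimod A W} (hB : B.PoleOrder) (u v : V) :
    ∃ C : ℕ, ∀ w, (Qe (-1) ^ C) ((fun a b => pw B.YL u (B.Yrp v w b) a) -
      fun a b => B.Yrp v (pw B.YL u w a) b) = 0 := by
  obtain ⟨C, hC⟩ := B.exists_weakAssocLR hB u v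
  exact ⟨C, fun w => skew_locality B.pwR_BB (pw_DF (B.D_commL u)) (hC w)⟩

end VOA

/-! ### Pole clearing for products of left and opposite right operators -/

section Clearing

variable {ι M : Type*} [AddCommGroup M] [Module ℂ M]

theorem clr_cons (p : ι → ℕ) (i j : ι) (L : List ι) : clr p i (j :: L) =
    (MvPolynomial.X i - MvPolynomial.X j) ^ p j * clr p i L := rfl

theorem clr_append (p : ι → ℕ) (i : ι) (L L' : List ι) :
    clr p i (L ++ L') = clr p i L * clr p i L' := by
  rw [clr, List.map_append, List.prod_append]; rfl

/-- The product of `(x_i - x_j) ^ p i j` over positions `i` before `j` of a list. -/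
def clrAll (p : ι → ι → ℕ) : List ι → MvPolynomial ι ℂ
  | [] => 1
  | i :: L => clr (p i) i L * clrAll p L

/-- The product of `(x_i - x_j) ^ p i j` over entries `i`, `j` of two lists. -/
def clrMix (p : ι → ι → ℕ) (L R : List ι) : MvPolynomial ι ℂ :=
  (L.map fun i => clr (p i) i R).prod

theorem clrMix_cons (p : ι → ι → ℕ) (i : ι) (L R : List ι) :
    clrMix p (i :: L) R = clr (p i) i R * clrMix p L R := rfl

theorem clr_dvd_clrAll (p : ι → ι → ℕ) (S T : List ι) (i : ι) :
    clr (p i) i T ∣ clrAll p (S ++ i :: T) := by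
  induction S with
  | nil => exact dvd_mul_right _ _
  | cons a S ih => exact ih.mul_left _

theorem clrMix_dvd_clrAll (p : ι → ι → ℕ) (L R : List ι) :
    clrMix p L R ∣ clrAll p (L ++ R) := by
  induction L with
  | nil => exact one_dvd _
  | cons a L ih =>
    rw [clrMix_cons, List.cons_append, clrAll, clr_append]
    exact mul_dvd_mul (dvd_mul_left _ _) ih

theorem clrMix_mul_dvd_clrAll (p : ι → ι → ℕ) (S T R : List ι) (i : ι) :
    clrMix p (S ++ i :: T) R * clr (p i) i T ∣ clrAll p (S ++ i :: T ++ R) := by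
  induction S with
  | nil =>
    rw [List.nil_append, List.cons_append, clrMix_cons, clrAll, clr_append,
      mul_comm (_ * _), ← mul_assoc]
    exact mul_dvd_mul_left _ (clrMix_dvd_clrAll p T R)
  | cons a S ih =>
    rw [List.cons_append, clrMix_cons, List.cons_append, clrAll, clr_append, mul_assoc]
    exact mul_dvd_mul (dvd_mul_left _ _) ih

theorem clr_mem {S : Subalgebra ℂ (MvPolynomial ι ℂ)} {p : ι → ℕ} {i : ι} {L : List ι}
    (hi : MvPolynomial.X i ∈ S) (hL : ∀ j ∈ L, MvPolynomial.X j ∈ S) : clr p i L ∈ S := by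
  induction L with
  | nil => exact S.one_mem
  | cons a L ih =>
    rw [clr_cons]
    exact S.mul_mem (S.pow_mem (S.sub_mem hi (hL a (by simp))) _)
      (ih fun j hj => hL j (by simp [hj]))

theorem clrMix_mem {S : Subalgebra ℂ (MvPolynomial ι ℂ)} {p : ι → ι → ℕ} {L R : List ι}
    (hL : ∀ j ∈ L, MvPolynomial.X j ∈ S) (hR : ∀ j ∈ R, MvPolynomial.X j ∈ S) :
    clrMix p L R ∈ S := by
  induction L with
  | nil => exact S.one_mem
  | cons a L ih =>
    rw [clrMix_cons]
    exact S.mul_mem (clr_mem (hL a (by simp)) hR) (ih fun j hj => hL j (by simp [hj]))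

variable [DecidableEq ι]

/-- The operator extracting the mode of `Z` prescribed by the coordinate `a`. -/
def modeOp (Z : M →ₗ[ℂ] (ℤ → M)) (a : ι) (k : ι → ℤ) : M →ₗ[ℂ] M := LinearMap.proj (k a) ∘ₗ Z

theorem X_mem_intertwiner_mode (Z : M →ₗ[ℂ] (ℤ → M)) {a j : ι} (h : j ≠ a) :
    MvPolynomial.X j ∈ intertwiner (ptw (modeOp Z a)) := by
  refine X_mem_intertwiner fun k => ?_
  simp [modeOp, h.symm]

theorem act_swap_one {ZL ZR : ι → M →ₗ[ℂ] (ℤ → M)} {p : ι → ι → ℕ}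
    (hloc : ∀ a b x, (Qe (-1) ^ p a b) ((fun s t => ZL a (ZR b x t) s) -
      fun s t => ZR b (ZL a x s) t) = 0)
    {a : ι} {R : List ι} (hnd : (a :: R).Nodup) {y : (ι → ℤ) → M}
    (hy : ∀ k k' : ι → ℤ, (∀ j, j ∉ a :: R → k j = k' j) → y k = y k') :
    act (clr (p a) a R) (fun k => ZL a (ops ZR R k (y k)) (k a) - ops ZR R k (ZL a (y k) (k a)))
      = 0 := by
  induction R with
  | nil =>
    have : (fun k : ι → ℤ => ZL a (ops ZR [] k (y k)) (k a) - ops ZR [] k (ZL a (y k) (k a)))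
        = 0 := by
      funext k; rw [ops_nil, ops_nil, sub_self]; rfl
    rw [this, map_zero]
  | cons b R ih =>
    have hab : a ≠ b := fun h => by simp [h] at hnd
    have haR : a ∉ R := fun h => by simp [h] at hnd
    have hbR : b ∉ R := fun h => by simp [h] at hnd
    have ih := ih (by simp at hnd; simp [hnd.1.2, hnd.2.2]) fun k k' h => hy k k' fun j hj =>
      h j fun hj' => hj (by simp at hj'; rcases hj' with h | h <;> simp [h])
    let K : (ι → ℤ) → ℤ → ℤ → M := fun k => (fun s t => ZL a (ZR b (ops ZR R k (y k)) t) s) -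
      fun s t => ZR b (ZL a (ops ZR R k (y k)) s) t
    have e : (fun k : ι → ℤ => ZL a (ops ZR (b :: R) k (y k)) (k a) -
        ops ZR (b :: R) k (ZL a (y k) (k a))) = (fun k => K k (k a) (k b)) +
        ptw (modeOp (ZR b) b)
          (fun k => ZL a (ops ZR R k (y k)) (k a) - ops ZR R k (ZL a (y k) (k a))) := by
      funext k
      change _ = ZL a (ZR b (ops ZR R k (y k)) (k b)) (k a) -
        ZR b (ZL a (ops ZR R k (y k)) (k a)) (k b) +
        ZR b (ZL a (ops ZR R k (y k)) (k a) - ops ZR R k (ZL a (y k) (k a))) (k b)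
      rw [ops_cons, ops_cons, map_sub, Pi.sub_apply]
      abel
    have h1 : act ((MvPolynomial.X a - MvPolynomial.X b) ^ p a b) (fun k => K k (k a) (k b))
        = 0 := by
      funext k
      have := act_family a b hab (-1) (p a b) K (fun k k' h => by
        have h1 : ops ZR R k = ops ZR R k' := ops_congr _ fun j hj =>
          h j (fun e => haR (e ▸ hj)) (fun e => hbR (e ▸ hj))
        have h2 : y k = y k' := hy k k' fun j hj =>
          h j (fun e => hj (by simp [e])) (fun e => hj (by simp [e]))
        simp only [K, h1, h2]) k
      rw [map_neg, map_one, neg_one_mul, ← sub_eq_add_neg] at this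
      rw [this]
      simp only [K, hloc]
      rfl
    have h2 : act (clr (p a) a R) (ptw (modeOp (ZR b) b)
        (fun k => ZL a (ops ZR R k (y k)) (k a) - ops ZR R k (ZL a (y k) (k a)))) = 0 := by
      have hm : clr (p a) a R ∈ intertwiner (ptw (modeOp (ZR b) b)) :=
        clr_mem (X_mem_intertwiner_mode _ hab) fun j hj =>
          X_mem_intertwiner_mode _ fun e => hbR (e ▸ hj)
      rw [← hm, ih, map_zero]
    rw [e, map_add, clr_cons, mul_comm, act_mul, act_mul, h1, map_zero, act_comm, h2, map_zero,
      add_zero]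

theorem act_swap {ZL ZR : ι → M →ₗ[ℂ] (ℤ → M)} {p : ι → ι → ℕ}
    (hloc : ∀ a b x, (Qe (-1) ^ p a b) ((fun s t => ZL a (ZR b x t) s) -
      fun s t => ZR b (ZL a x s) t) = 0)
    {L R : List ι} (hnd : (L ++ R).Nodup) (x : M) :
    act (clrMix p L R) (fun k => ops ZL L k (ops ZR R k x)) =
      act (clrMix p L R) (fun k => ops ZR R k (ops ZL L k x)) := by
  rw [← sub_eq_zero, ← map_sub]
  induction L with
  | nil =>
    have : ((fun k : ι → ℤ => ops ZL [] k (ops ZR R k x)) -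
        fun k => ops ZR R k (ops ZL [] k x)) = 0 := sub_self _
    rw [this, map_zero]
  | cons a L ih =>
    rw [List.cons_append, List.nodup_cons, List.mem_append] at hnd
    have ih := ih hnd.2
    have hd := List.nodup_append.mp hnd.2
    have e : ((fun k : ι → ℤ => ops ZL (a :: L) k (ops ZR R k x)) -
        fun k => ops ZR R k (ops ZL (a :: L) k x)) =
        ptw (modeOp (ZL a) a)
          ((fun k => ops ZL L k (ops ZR R k x)) - fun k => ops ZR R k (ops ZL L k x)) +
        fun k => ZL a (ops ZR R k (ops ZL L k x)) (k a) -
          ops ZR R k (ZL a (ops ZL L k x) (k a)) := by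
      funext k
      change _ = ZL a (ops ZL L k (ops ZR R k x) - ops ZR R k (ops ZL L k x)) (k a) +
        (ZL a (ops ZR R k (ops ZL L k x)) (k a) - ops ZR R k (ZL a (ops ZL L k x) (k a)))
      rw [Pi.sub_apply, ops_cons, ops_cons, map_sub, Pi.sub_apply]
      abel
    have h1 : act (clrMix p L R) (ptw (modeOp (ZL a) a)
          ((fun k => ops ZL L k (ops ZR R k x)) - fun k => ops ZR R k (ops ZL L k x))) = 0 := by
      have hm : clrMix p L R ∈ intertwiner (ptw (modeOp (ZL a) a)) :=
        clrMix_mem (fun j hj => X_mem_intertwiner_mode _ fun e => hnd.1 (.inl (e ▸ hj)))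
          fun j hj => X_mem_intertwiner_mode _ fun e => hnd.1 (.inr (e ▸ hj))
      rw [← hm, ih, map_zero]
    have h2 := act_swap_one hloc (a := a) (R := R) (y := fun k => ops ZL L k x)
      (by rw [List.nodup_cons]; exact ⟨fun h => hnd.1 (.inr h), hd.2.1⟩) fun k k' h => by
        have : ops ZL L k = ops ZL L k' := ops_congr _ fun j hj => h j fun hj' => by
          rcases List.mem_cons.mp hj' with e | h'
          · exact hnd.1 (.inl (e ▸ hj))
          · exact hd.2.2 j hj j h' rfl
        simp only [this]
    rw [e, map_add, clrMix_cons, act_mul, h1, map_zero, zero_add, mul_comm, act_mul, h2, map_zero]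

omit [DecidableEq ι] in
/-- Operators acting on the left do not affect regularity in a variable. -/
theorem NN.ops_left (Z : ι → M →ₗ[ℂ] (ℤ → M)) {S : List ι} {i : ι} {q : MvPolynomial ι ℂ}
    {F : (ι → ℤ) → M} (h : NN i (VA.act q F))
    (hq : q ∈ intertwiner (ptw (ops Z S))) :
    NN i (VA.act q fun k => ops Z S k (F k)) := by
  have e : (fun k => ops Z S k (F k)) = ptw (ops Z S) F := rfl
  rw [e, ← hq]
  intro k hk
  change ops Z S k (VA.act q F k) = 0
  rw [h k hk, map_zero]

/-- Regularity of a product of left and opposite right operators on a regular vector after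
clearing the diagonal poles. -/
theorem NN_ops_mixed {V : Type*} [AddCommGroup V] [Module ℂ V]
    {Y Yo : V →ₗ[ℂ] V →ₗ[ℂ] (ℤ → V)} {YL YR : V →ₗ[ℂ] M →ₗ[ℂ] (ℤ → M)} (C : V → V → ℕ)
    (hY : ∀ u v a, a < -(C u v : ℤ) → Y u v a = 0)
    (hYW : ∀ u₁ u₂ v, WeakAssoc Y Y (C u₁ v) u₁ u₂ v)
    (hYo : ∀ u v a, a < -(C u v : ℤ) → Yo u v a = 0)
    (hYoW : ∀ u₁ u₂ v, WeakAssoc Yo Yo (C u₁ v) u₁ u₂ v)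
    (hloc : ∀ u v x, (Qe (-1) ^ C u v) ((fun s t => YL u (YR v x t) s) -
      fun s t => YR v (YL u x s) t) = 0) {w : M}
    (hL : ∀ v a, a < 0 → YL v w a = 0) (hLW : ∀ u₁ u₂, WeakAssoc Y YL 0 u₁ u₂ w)
    (hR : ∀ v a, a < 0 → YR v w a = 0) (hRW : ∀ u₁ u₂, WeakAssoc Yo YR 0 u₁ u₂ w)
    (u : ι → V) {L R : List ι} (hnd : (L ++ R).Nodup) {i : ι} (hi : i ∈ L ++ R) :
    NN i (act (clrAll (fun i j => C (u i) (u j)) (L ++ R))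
      fun k => ops (fun j => YL (u j)) L k (ops (fun j => YR (u j)) R k w)) := by
  set p : ι → ι → ℕ := fun i j => C (u i) (u j) with hp
  have hd := List.nodup_append.mp hnd
  rcases List.mem_append.mp hi with hi | hi
  · obtain ⟨S, T, rfl⟩ := List.append_of_mem hi
    have hd' := List.nodup_append.mp hd.1
    have hiT : (i :: T).Nodup := hd'.2.1
    refine NN.of_dvd (clrMix_mul_dvd_clrAll p S T R i) ?_
    rw [mul_comm, act_mul, act_swap (p := p) (fun a b x => hloc (u a) (u b) x) hnd, act_comm]
    refine NN.act ?_ _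
    have h0 := NN_ops (YW := YL) C hY hYW w (fun _ => 0) (by simpa using hL) hLW u i T hiT
    rw [pow_zero, one_mul] at h0
    have h1 : NN i (act (clr (p i) i T) fun k => ops (fun j => YL (u j)) (S ++ i :: T) k w) := by
      simp only [ops_append]
      refine h0.ops_left _ (clr_mem (X_mem_intertwiner_ops _ fun h => ?_) fun j hj =>
        X_mem_intertwiner_ops _ fun h => ?_)
      · exact hd'.2.2 i h i (by simp) rfl
      · exact hd'.2.2 j h j (by simp [hj]) rfl
    refine h1.ops_left _ (clr_mem (X_mem_intertwiner_ops _ fun h => ?_) fun j hj =>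
      X_mem_intertwiner_ops _ fun h => ?_)
    · exact hd.2.2 i (by simp) i h rfl
    · exact hd.2.2 j (by simp [hj]) j h rfl
  · obtain ⟨S, T, rfl⟩ := List.append_of_mem hi
    have hd' := List.nodup_append.mp hd.2.1
    have hiT : (i :: T).Nodup := hd'.2.1
    refine NN.of_dvd (p := clr (p i) i T) ?_ ?_
    · rw [← List.append_assoc]
      exact clr_dvd_clrAll p (L ++ S) T i
    have h0 := NN_ops (YW := YR) C hYo hYoW w (fun _ => 0) (by simpa using hR) hRW u i T hiT
    rw [pow_zero, one_mul] at h0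
    have h1 : NN i (act (clr (p i) i T) fun k => ops (fun j => YR (u j)) (S ++ i :: T) k w) := by
      simp only [ops_append]
      refine h0.ops_left _ (clr_mem (X_mem_intertwiner_ops _ fun h => ?_) fun j hj =>
        X_mem_intertwiner_ops _ fun h => ?_)
      · exact hd'.2.2 i h i (by simp) rfl
      · exact hd'.2.2 j h j (by simp [hj]) rfl
    refine h1.ops_left _ (clr_mem (X_mem_intertwiner_ops _ fun h => ?_) fun j hj =>
      X_mem_intertwiner_ops _ fun h => ?_)
    · exact hd.2.2 i h i (by simp) rfl
    · exact hd.2.2 j h j (by simp [hj]) rfl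

end Clearing

/-! ### Convergence of a series from convergence after clearing poles -/

section Peel

variable {ι : Type*} [DecidableEq ι]

/-- Eventual vanishing of a family in the direction `e_i - e_j`. -/
def Tr {M : Type*} [Zero M] (i j : ι) (F : (ι → ℤ) → M) : Prop :=
  ∀ k : ι → ℤ, ∃ N : ℕ, ∀ m : ℕ, N ≤ m → F (k + Pi.single i (m : ℤ) - Pi.single j (m : ℤ)) = 0

theorem Tr.act {M : Type*} [AddCommGroup M] [Module ℂ M] {i j : ι} {F : (ι → ℤ) → M}
    (h : Tr i j F) (q : MvPolynomial ι ℂ) : Tr i j (act q F) := by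
  refine act_induction (Tr i j) (fun F G hF hG k => ?_) (fun c F hF k => ?_)
    (fun r F hF k => ?_) q F h
  · obtain ⟨N, hN⟩ := hF k
    obtain ⟨N', hN'⟩ := hG k
    refine ⟨max N N', fun m hm => ?_⟩
    rw [Pi.add_apply, hN m (le_trans (le_max_left _ _) hm),
      hN' m (le_trans (le_max_right _ _) hm), add_zero]
  · obtain ⟨N, hN⟩ := hF k
    exact ⟨N, fun m hm => by rw [Pi.smul_apply, hN m hm, smul_zero]⟩
  · obtain ⟨N, hN⟩ := hF (k - Pi.single r 1)
    refine ⟨N, fun m hm => ?_⟩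
    rw [act_X, ← hN m hm]
    congr 1
    abel

/-- The shift of exponents used to expand `1 / (x_i - x_j)`. -/
def peelShift (i j : ι) (m : ℕ) : ι → ℤ := Pi.single i ((m : ℤ) + 1) - Pi.single j (m : ℤ)

theorem hasSum_peel {i j : ι} {F : (ι → ℤ) → ℂ} (hF : Tr i j F) (k : ι → ℤ) :
    HasSum (fun m : ℕ => act (MvPolynomial.X i - MvPolynomial.X j) F (k + peelShift i j m))
      (F k) := by
  set g : ℕ → ℂ := fun m => F (k + Pi.single i (m : ℤ) - Pi.single j (m : ℤ)) with hg
  have e : ∀ m : ℕ, act (MvPolynomial.X i - MvPolynomial.X j) F (k + peelShift i j m) =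
      g m - g (m + 1) := by
    intro m
    rw [act_sub, Pi.sub_apply, act_X, act_X, hg, peelShift]
    congr 2
    · rw [Pi.single_add]; abel
    · push_cast; rw [Pi.single_add, Pi.single_add]; abel
  obtain ⟨N, hN⟩ := hF k
  have h0 : ∀ m ∉ Finset.range N,
      act (MvPolynomial.X i - MvPolynomial.X j) F (k + peelShift i j m) = 0 := by
    intro m hm
    rw [Finset.mem_range, not_lt] at hm
    rw [e, hg]
    simp only [hN m hm, hN (m + 1) (by omega), sub_zero]
  have : HasSum _ _ := hasSum_sum_of_ne_finset_zero (L := SummationFilter.unconditional ℕ) h0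
  rw [Finset.sum_congr rfl fun m _ => e m, Finset.sum_range_sub'] at this
  have h2 : g N = 0 := hN N le_rfl
  have h3 : g 0 = F k := by simp [hg]
  rwa [h2, h3, sub_zero] at this

variable [Fintype ι]

theorem AC.peel {z : ι → ℂ} (hz : ∀ i, z i ≠ 0) {i j : ι} (hij : ‖z j‖ < ‖z i‖)
    {F : (ι → ℤ) → ℂ} (hF : Tr i j F) {s : ℂ}
    (h : AC z (VA.act (MvPolynomial.X i - MvPolynomial.X j) F) s) : AC z F (s / (z i - z j)) := by
  set G := VA.act (MvPolynomial.X i - MvPolynomial.X j) F with hG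
  set r : ℕ → ℂ := fun m => (z i)⁻¹ * (z j / z i) ^ m with hr
  have hlt : ‖z j / z i‖ < 1 := by
    rw [norm_div, div_lt_one (norm_pos_iff.mpr (hz i))]; exact hij
  have hrs : HasSum r ((z i - z j)⁻¹) := by
    have := (hasSum_geometric_of_norm_lt_one hlt).mul_left (z i)⁻¹
    rwa [← mul_inv, mul_sub, mul_one, mul_div_cancel₀ _ (hz i)] at this
  have hrn : Summable fun m => ‖r m‖ := by
    simp only [hr, norm_mul, norm_pow]
    exact (summable_geometric_of_lt_one (norm_nonneg _) hlt).mul_left _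
  set E : ((ι → ℤ) × ℕ) ≃ ((ι → ℤ) × ℕ) :=
    { toFun := fun x => (x.1 + peelShift i j x.2, x.2)
      invFun := fun x => (x.1 - peelShift i j x.2, x.2)
      left_inv := fun x => by simp
      right_inv := fun x => by simp } with hE
  set f : (ι → ℤ) → ℂ := fun k => G k * ∏ l, z l ^ k l with hf
  have hs1 : Summable fun x : (ι → ℤ) × ℕ => ‖f x.1 * r x.2‖ := h.1.mul_norm hrn
  have hs2 : HasSum (fun x : (ι → ℤ) × ℕ => f x.1 * r x.2) (s * (z i - z j)⁻¹) :=
    HasSum.mul h.2 hrs hs1.of_norm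
  have key : ∀ k : ι → ℤ, ∀ m : ℕ, f (k + peelShift i j m) * r m =
      G (k + peelShift i j m) * ∏ l, z l ^ k l := by
    intro k m
    have e1 := prod_zpow_add hz (k + Pi.single i ((m : ℤ) + 1)) (-Pi.single j (m : ℤ))
    have e2 := prod_zpow_add hz k (Pi.single i ((m : ℤ) + 1))
    have e3 : (-Pi.single j (m : ℤ) : ι → ℤ) = Pi.single j (-(m : ℤ)) := by
      rw [Pi.single_neg]
    have e4 : k + peelShift i j m = k + Pi.single i ((m : ℤ) + 1) + -Pi.single j (m : ℤ) := by
      rw [peelShift]; abel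
    rw [hf]
    simp only
    rw [e4, e1, e2, e3, prod_zpow_single, prod_zpow_single]
    have hi := hz i
    have hj := hz j
    have : z i ^ ((m : ℤ) + 1) * z j ^ (-(m : ℤ)) * r m = 1 := by
      rw [hr]
      simp only
      rw [zpow_neg, zpow_natCast, zpow_add₀ hi, zpow_natCast, zpow_one, div_pow]
      field_simp
    linear_combination (G (k + Pi.single i ((m : ℤ) + 1) + Pi.single j (-(m : ℤ))) *
      ∏ l, z l ^ k l) * this
  have hs1' := (E.summable_iff (f := fun x : (ι → ℤ) × ℕ => ‖f x.1 * r x.2‖)).mpr hs1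
  have hs2' := (E.hasSum_iff (f := fun x : (ι → ℤ) × ℕ => f x.1 * r x.2)).mpr hs2
  have hfib : ∀ k, HasSum (fun m : ℕ => f (k + peelShift i j m) * r m)
      (F k * ∏ l, z l ^ k l) := by
    intro k
    simp only [key]
    exact (hasSum_peel hF k).mul_right _
  have hS : HasSum (fun k => F k * ∏ l, z l ^ k l) (s * (z i - z j)⁻¹) :=
    hs2'.prod_fiberwise hfib
  refine ⟨?_, by rw [div_eq_mul_inv]; exact hS⟩
  have hn : Summable fun x : (ι → ℤ) × ℕ => ‖f (x.1 + peelShift i j x.2) * r x.2‖ := hs1'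
  refine Summable.of_nonneg_of_le (fun _ => norm_nonneg _) (fun k => ?_) hn.prod
  beta_reduce
  rw [← (hfib k).tsum_eq]
  exact norm_tsum_le_tsum_norm (hn.prod_factor k)

/-- Polynomials that can be divided out of convergent expansions in the ordered region. -/
def peelable {n : ℕ} (z : Fin n → ℂ) : Submonoid (MvPolynomial (Fin n) ℂ) where
  carrier := {q | ∀ F : (Fin n → ℤ) → ℂ, (∀ i j, i < j → Tr i j F) → ∀ s,
    AC z (act q F) s → AC z F (s / MvPolynomial.eval z q)}
  one_mem' F _ s h := by simpa [act_one] using h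
  mul_mem' {p q} hp hq F hF s h := by
    rw [map_mul, ← div_div]
    exact hq F hF _ (hp (act q F) (fun i j hij => (hF i j hij).act q) s (by rwa [← act_mul]))

theorem X_sub_X_mem_peelable {n : ℕ} {z : Fin n → ℂ} (hz : OrderedPos z) {i j : Fin n}
    (hij : i < j) : MvPolynomial.X i - MvPolynomial.X j ∈ peelable z := by
  intro F hF s h
  rw [map_sub, MvPolynomial.eval_X, MvPolynomial.eval_X]
  exact AC.peel (fun i => norm_pos_iff.mp (hz.2 i)) (hz.1 i j hij) (hF i j hij) h

theorem clrAll_mem_peelable {n : ℕ} {z : Fin n → ℂ} (hz : OrderedPos z)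
    (p : Fin n → Fin n → ℕ) {L : List (Fin n)} (hL : L.Pairwise (· < ·)) :
    clrAll p L ∈ peelable z := by
  induction L with
  | nil => exact Submonoid.one_mem _
  | cons i L ih =>
    rw [List.pairwise_cons] at hL
    refine Submonoid.mul_mem _ (Submonoid.list_prod_mem _ fun q hq => ?_) (ih hL.2)
    obtain ⟨j, hj, rfl⟩ := List.mem_map.mp hq
    exact Submonoid.pow_mem _ (X_sub_X_mem_peelable hz (hL.1 j hj)) _

theorem eval_clrAll {n : ℕ} (z : Fin n → ℂ) (p : Fin n → Fin n → ℕ) {L : List (Fin n)}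
    (hL : L.Pairwise (· < ·)) : MvPolynomial.eval z (clrAll p L) =
      ∏ i ∈ L.toFinset, ∏ j ∈ L.toFinset, (z i - z j) ^ (if i < j then p i j else 0) := by
  induction L with
  | nil => simp [clrAll]
  | cons i L ih =>
    rw [List.pairwise_cons] at hL
    have hi : i ∉ L.toFinset := fun h => lt_irrefl _ (hL.1 i (List.mem_toFinset.mp h))
    rw [clrAll, map_mul, ih hL.2, List.toFinset_cons, Finset.prod_insert hi,
      Finset.prod_insert hi]
    congr 1
    · rw [if_neg (lt_irrefl _), pow_zero, one_mul, List.prod_toFinset _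
        (hL.2.imp fun h => h.ne), clr, map_list_prod, List.map_map]
      congr 1
      refine List.map_congr_left fun j hj => ?_
      simp [hL.1 j hj]
    · refine Finset.prod_congr rfl fun a ha => ?_
      rw [Finset.prod_insert hi, if_neg (not_lt.mpr (hL.1 a (List.mem_toFinset.mp ha)).le),
        pow_zero, one_mul]

theorem eval_clrAll_finRange {n : ℕ} (z : Fin n → ℂ) (p : Fin n → Fin n → ℕ) :
    MvPolynomial.eval z (clrAll p (List.finRange n)) =
      ∏ q ∈ Finset.univ.offDiag, (z q.1 - z q.2) ^ (if q.1 < q.2 then p q.1 q.2 else 0) := by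
  rw [eval_clrAll z p (List.pairwise_lt_finRange n), List.toFinset_finRange,
    ← Finset.prod_product']
  refine (Finset.prod_subset (fun x _ => by simp) fun x _ hx => ?_).symm
  have : x.1 = x.2 := by simpa using hx
  simp [this]

end Peel

section Weights

variable {W : Type*} [AddCommGroup W] [Module ℂ W] (G : CGrading W)

/-- The vectors whose components of weight with real part less than `r` vanish. -/
def CGrading.wge (r : ℝ) : Submodule ℂ W where
  carrier := {x | ∀ m : ℂ, m.re < r → G.proj m x = 0}
  add_mem' hx hy m hm := by rw [map_add, hx m hm, hy m hm, add_zero]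
  zero_mem' m _ := map_zero _
  smul_mem' c x hx m hm := by rw [map_smul, hx m hm, smul_zero]

variable {G}

theorem CGrading.wge_antitone {r s : ℝ} (h : s ≤ r) {x : W} (hx : x ∈ G.wge r) : x ∈ G.wge s :=
  fun m hm => hx m (hm.trans_le h)

theorem CGrading.proj_proj (m n : ℂ) (x : W) :
    G.proj m (G.proj n x) = if m = n then G.proj n x else 0 := by
  have := congrArg (fun T : W →ₗ[ℂ] W => T x) (G.proj_comp m n)
  split_ifs with h <;> simpa [h] using this

theorem ZGrading.proj_proj {V : Type*} [AddCommGroup V] [Module ℂ V] (G : ZGrading V)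
    (m n : ℤ) (x : V) : G.proj m (G.proj n x) = if m = n then G.proj n x else 0 := by
  have := congrArg (fun T : V →ₗ[ℂ] V => T x) (G.proj_comp m n)
  split_ifs with h <;> simpa [h] using this

theorem ZGrading.d_proj {V : Type*} [AddCommGroup V] [Module ℂ V] (G : ZGrading V)
    (n : ℤ) (x : V) : G.d (G.proj n x) = (n : ℂ) • G.proj n x := by
  rw [ZGrading.d, finsum_eq_single _ n fun m hm => by rw [G.proj_proj, if_neg hm, smul_zero],
    G.proj_proj, if_pos rfl]

theorem CGrading.d_proj (n : ℂ) (x : W) : G.d (G.proj n x) = n • G.proj n x := by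
  rw [CGrading.d, finsum_eq_single _ n fun m hm => by rw [G.proj_proj, if_neg hm, smul_zero],
    G.proj_proj, if_pos rfl]

theorem CGrading.proj_d (m : ℂ) (x : W) : G.proj m (G.d x) = m • G.proj m x := by
  have hf : (Function.support fun n : ℂ => n • G.proj n x).Finite :=
    (G.proj_finite x).subset fun n hn h => hn (by simp [show G.proj n x = 0 from h])
  have h1 := AddMonoidHom.map_finsum (G.proj m).toAddMonoidHom hf
  simp only [LinearMap.toAddMonoidHom_coe] at h1
  rw [CGrading.d, h1, finsum_eq_single _ m fun n hn => by
    rw [map_smul, G.proj_proj, if_neg hn.symm, smul_zero], map_smul, G.proj_proj, if_pos rfl]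

theorem CGrading.mem_wge_of_d {x : W} {c : ℂ} (h : G.d x = c • x) {r : ℝ} (hr : r ≤ c.re) :
    x ∈ G.wge r := by
  intro m hm
  have h1 := G.proj_d m x
  rw [h, map_smul, ← sub_eq_zero, ← sub_smul, smul_eq_zero, sub_eq_zero] at h1
  rcases h1 with rfl | h1
  · exact absurd hm (not_lt.mpr hr)
  · exact h1

theorem CGrading.mem_of_proj {x : W} (S : Submodule ℂ W) (h : ∀ n, G.proj n x ∈ S) : x ∈ S := by
  rw [← G.proj_sum x]
  exact finsum_induction (· ∈ S) S.zero_mem (fun _ _ => S.add_mem) h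

theorem ZGrading.mem_of_proj {V : Type*} [AddCommGroup V] [Module ℂ V] (G : ZGrading V) {x : V}
    (S : Submodule ℂ V) (h : ∀ n, G.proj n x ∈ S) : x ∈ S := by
  rw [← G.proj_sum x]
  exact finsum_induction (· ∈ S) S.zero_mem (fun _ _ => S.add_mem) h

theorem CGrading.bilinear_mem_wge {V : Type*} [AddCommGroup V] [Module ℂ V] {GV : ZGrading V}
    {B₀ : ℤ} (hB₀ : ∀ n < B₀, GV.proj n = 0) {T : V →ₗ[ℂ] W →ₗ[ℂ] W} {c : ℂ}
    (hT : ∀ u x, G.d (T u x) = T (GV.d u) x + c • T u x + T u (G.d x)) {r : ℝ} (u : V) {x : W}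
    (hx : x ∈ G.wge r) : T u x ∈ G.wge (r + B₀ + c.re) := by
  refine GV.mem_of_proj ((G.wge (r + B₀ + c.re)).comap (T.flip x)) fun n => ?_
  refine G.mem_of_proj ((G.wge (r + B₀ + c.re)).comap (T (GV.proj n u))) fun m => ?_
  change T (GV.proj n u) (G.proj m x) ∈ G.wge (r + B₀ + c.re)
  by_cases hn : n < B₀
  · rw [hB₀ n hn]
    simp
  by_cases hm : m.re < r
  · rw [hx m hm, map_zero]
    exact Submodule.zero_mem _
  refine G.mem_wge_of_d (c := n + c + m) ?_ ?_
  · rw [hT, GV.d_proj, G.d_proj, map_smul, map_smul, LinearMap.smul_apply, ← add_smul, ← add_smul]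
  · have : (B₀ : ℝ) ≤ n := by exact_mod_cast not_lt.mp hn
    simp only [Complex.add_re, Complex.intCast_re]
    linarith [not_lt.mp hm]

theorem CGrading.exists_dual_vanish {φ : W →ₗ[ℂ] ℂ} (hφ : InGradedDual G.proj φ) :
    ∃ R : ℝ, ∀ x ∈ G.wge R, φ x = 0 := by
  obtain ⟨b, hb⟩ := (hφ.image Complex.re).bddAbove
  refine ⟨b + 1, fun x hx => ?_⟩
  refine G.mem_of_proj (LinearMap.ker φ) fun n => ?_
  by_cases hn : n.re < b + 1
  · rw [hx n hn]
    exact Submodule.zero_mem _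
  · by_contra h
    exact hn ((hb ⟨n, fun h0 => h (LinearMap.congr_fun h0 x), rfl⟩).trans_lt (lt_add_one b))

theorem CGrading.exists_mem_wge (G : CGrading W) : ∃ r : ℝ, ∀ x, x ∈ G.wge r := by
  obtain ⟨r, hr⟩ := G.lower_bound
  exact ⟨r, fun x m hm => by rw [hr m hm]; rfl⟩

section Filtered

variable {ι : Type*} [DecidableEq ι] [Fintype ι]

variable (G) in
/-- Formal distributions whose coefficients have weight growing with the total exponent. -/
def CGrading.Filt (F : (ι → ℤ) → W) : Prop :=
  ∃ r : ℝ, ∀ k, F k ∈ G.wge (r + ∑ i, (k i : ℝ))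

theorem CGrading.Filt.act {F : (ι → ℤ) → W} (h : G.Filt F) (q : MvPolynomial ι ℂ) :
    G.Filt (act q F) := by
  refine act_induction G.Filt ?_ ?_ ?_ q F h
  · rintro F F' ⟨r, hr⟩ ⟨s, hs⟩
    refine ⟨min r s, fun k => Submodule.add_mem _ (G.wge_antitone ?_ (hr k))
      (G.wge_antitone ?_ (hs k))⟩
    · gcongr; exact min_le_left _ _
    · gcongr; exact min_le_right _ _
  · rintro c F ⟨r, hr⟩
    exact ⟨r, fun k => Submodule.smul_mem _ _ (hr k)⟩
  · rintro i F ⟨r, hr⟩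
    refine ⟨r - 1, fun k => ?_⟩
    rw [act_X]
    convert hr (k - Pi.single i 1) using 2
    simp [Finset.sum_sub_distrib, Pi.single_apply]
    ring

omit [DecidableEq ι] [Fintype ι] in
theorem CGrading.ops_mem_wge {Z : ι → W →ₗ[ℂ] (ℤ → W)} {c : ℝ}
    (hZ : ∀ j r x, x ∈ G.wge r → ∀ a : ℤ, Z j x a ∈ G.wge (r + c + a)) {r : ℝ} {x : W}
    (hx : x ∈ G.wge r) (L : List ι) (k : ι → ℤ) :
    ops Z L k x ∈ G.wge (r + (L.map fun j => c + (k j : ℝ)).sum) := by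
  induction L with
  | nil => simpa [ops_nil] using hx
  | cons j L ih =>
    rw [ops_cons]
    convert hZ j _ _ ih (k j) using 2
    simp only [List.map_cons, List.sum_cons]
    ring

theorem CGrading.filt_ops {n : ℕ} {Z : Fin n → W →ₗ[ℂ] (ℤ → W)} {c : ℝ}
    (hZ : ∀ j r x, x ∈ G.wge r → ∀ a : ℤ, Z j x a ∈ G.wge (r + c + a)) (x : W) :
    G.Filt fun k => ops Z (List.finRange n) k x := by
  obtain ⟨r, hr⟩ := G.exists_mem_wge
  refine ⟨r + n * c, fun k => ?_⟩
  convert G.ops_mem_wge hZ (hr x) (List.finRange n) k using 2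
  rw [← List.ofFn_eq_map, List.sum_ofFn, Finset.sum_add_distrib]
  simp
  ring

end Filtered

end Weights

section BimodWeights

variable {V : Type*} [AddCommGroup V] [Module ℂ V] {W : Type*} [AddCommGroup W] [Module ℂ W]
  {A : MOSVA V} (B : Bimod A W) {B₀ : ℤ}

theorem Bimod.pwL_mem_wge (hB₀ : ∀ n < B₀, A.gr.proj n = 0) (u : V) {r : ℝ} {x : W}
    (hx : x ∈ B.gr.wge r) (a : ℤ) : pw B.YL u x a ∈ B.gr.wge (r + B₀ + a) := by
  have := B.gr.bilinear_mem_wge hB₀ (T := B.YL.compr₂ (LinearMap.proj (-a - 1)))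
    (c := -((-a - 1 : ℤ) : ℂ) - 1) (fun u x => B.d_commL u x _) u hx
  convert this using 2
  · simp
  · rfl

theorem Bimod.pwR_mem_wge (hB₀ : ∀ n < B₀, A.gr.proj n = 0) (u : V) {r : ℝ} {x : W}
    (hx : x ∈ B.gr.wge r) (a : ℤ) : pw B.YR x u a ∈ B.gr.wge (r + B₀ + a) := by
  have := B.gr.bilinear_mem_wge hB₀ (T := B.YR.flip.compr₂ (LinearMap.proj (-a - 1)))
    (c := -((-a - 1 : ℤ) : ℂ) - 1)
    (fun u x => (B.d_commR x u _).trans (by rw [add_comm, ← add_assoc, add_right_comm]; rfl)) u hx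
  convert this using 2
  · simp
  · rfl

theorem Bimod.DW_mem_wge {r : ℝ} {x : W} (hx : x ∈ B.gr.wge r) : B.DW x ∈ B.gr.wge (r + 1) := by
  refine B.gr.mem_of_proj ((B.gr.wge (r + 1)).comap B.DW) fun n => ?_
  by_cases hn : n.re < r
  · rw [hx n hn]
    exact Submodule.zero_mem _
  · intro m hm
    have h := LinearMap.congr_fun (B.DW_wt n) x
    simp only [LinearMap.comp_apply] at h
    rw [h, B.gr.proj_proj, if_neg]
    rintro rfl
    rw [Complex.add_re, Complex.one_re] at hm
    linarith

theorem Bimod.DW_pow_mem_wge {r : ℝ} {x : W} (hx : x ∈ B.gr.wge r) (m : ℕ) :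
    (B.DW ^ m) x ∈ B.gr.wge (r + m) := by
  induction m with
  | zero => simpa using hx
  | succ m ih =>
    rw [pow_succ', Module.End.mul_apply, Nat.cast_succ, ← add_assoc]
    exact B.DW_mem_wge ih

theorem Bimod.Yrp_mem_wge (hB₀ : ∀ n < B₀, A.gr.proj n = 0) (u : V) {r : ℝ} {x : W}
    (hx : x ∈ B.gr.wge r) (a : ℤ) : B.Yrp u x a ∈ B.gr.wge (r + B₀ + a) := by
  change expS B.DW (sg (pw B.YR x u)) a ∈ B.gr.wge (r + B₀ + a)
  refine finsum_induction (· ∈ B.gr.wge (r + B₀ + a)) (Submodule.zero_mem _)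
    (fun _ _ => Submodule.add_mem _) fun m => Submodule.smul_mem _ _ ?_
  have h := B.DW_pow_mem_wge (B.pwR_mem_wge hB₀ u hx (a - m)) m
  rw [sg_apply, map_smul]
  convert Submodule.smul_mem _ ((-1 : ℂ) ^ (a - m)) h using 2
  push_cast
  ring

end BimodWeights

section Realization

variable {W : Type*} [AddCommGroup W] [Module ℂ W] {G : CGrading W} {n : ℕ}

theorem act_comp_apply {ι M M' : Type*} [DecidableEq ι] [AddCommGroup M] [Module ℂ M]
    [AddCommGroup M'] [Module ℂ M'] (φ : M →ₗ[ℂ] M') (q : MvPolynomial ι ℂ) (F : (ι → ℤ) → M)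
    (k : ι → ℤ) : act q (fun k => φ (F k)) k = φ (act q F k) := by
  have h : q ∈ intertwiner (ptw fun _ : ι → ℤ => φ) := by
    have h1 : Algebra.adjoin ℂ (Set.range MvPolynomial.X) ≤ intertwiner (ptw fun _ : ι → ℤ => φ) :=
      Algebra.adjoin_le (Set.range_subset_iff.mpr fun i => X_mem_intertwiner fun _ => rfl)
    rw [MvPolynomial.adjoin_range_X] at h1
    exact h1 trivial
  exact (congrFun (h F) k).symm

/-- The power series with coefficients `b`, evaluated in the algebraic completion. -/
def CGrading.evalComp (G : CGrading W) (b : (Fin n → ℕ) → W) (z : Fin n → ℂ) : G.Comp :=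
  ⟨fun m => ∑ᶠ k : Fin n → ℕ, (∏ i, z i ^ k i) • G.proj m (b k), fun m => by
    refine finsum_induction (fun x => G.proj m x = x) (map_zero _)
      (fun x y hx hy => by rw [map_add, hx, hy]) fun k => ?_
    rw [map_smul, G.proj_proj, if_pos rfl]⟩

theorem CGrading.finite_sum_lt (r R : ℝ) :
    {k : Fin n → ℕ | r + ∑ i, (k i : ℝ) < R}.Finite := by
  obtain ⟨N, hN⟩ := exists_nat_gt (R - r)
  refine (Set.finite_Iic fun _ : Fin n => N).subset fun k hk i => ?_
  have h1 : (k i : ℝ) ≤ ∑ i, (k i : ℝ) :=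
    Finset.single_le_sum (f := fun i => (k i : ℝ)) (fun i _ => Nat.cast_nonneg _)
      (Finset.mem_univ i)
  have h2 : r + ∑ i, (k i : ℝ) < R := hk
  have : (k i : ℝ) < N := by linarith
  exact_mod_cast this.le

theorem CGrading.finite_support_dual {r : ℝ} {b : (Fin n → ℕ) → W}
    (hb : ∀ k, b k ∈ G.wge (r + ∑ i, (k i : ℝ))) {φ : W →ₗ[ℂ] ℂ} (hφ : InGradedDual G.proj φ) :
    (Function.support fun k => φ (b k)).Finite := by
  obtain ⟨R, hR⟩ := G.exists_dual_vanish hφ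
  refine (CGrading.finite_sum_lt r R).subset fun k hk => ?_
  by_contra h
  exact hk (hR _ (G.wge_antitone (not_lt.mp h) (hb k)))

theorem CGrading.pair_smul_evalComp {r : ℝ} {b : (Fin n → ℕ) → W}
    (hb : ∀ k, b k ∈ G.wge (r + ∑ i, (k i : ℝ))) {φ : W →ₗ[ℂ] ℂ} (hφ : InGradedDual G.proj φ)
    (c : ℂ) (z : Fin n → ℂ) :
    G.pair φ (c • G.evalComp b z) = c * ∑ᶠ k, φ (b k) * ∏ i, z i ^ k i := by
  have hφ' : (Function.support fun i => φ ∘ₗ G.proj i).Finite := hφ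
  obtain ⟨R, hR⟩ := (hφ'.image Complex.re).bddAbove
  have hfin := CGrading.finite_sum_lt (n := n) r (R + 1)
  have hout : ∀ k ∉ hfin.toFinset, ∀ m ∈ hφ'.toFinset, G.proj m (b k) = 0 := by
    intro k hk m hm
    rw [Set.Finite.mem_toFinset] at hk hm
    refine hb k m (lt_of_lt_of_le ?_ (not_lt.mp hk))
    exact (hR ⟨m, hm, rfl⟩).trans_lt (lt_add_one R)
  have hsum : ∀ x, φ x = ∑ m ∈ hφ'.toFinset, φ (G.proj m x) := by
    intro x
    have h1 := AddMonoidHom.map_finsum φ.toAddMonoidHom (G.proj_finite x)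
    rw [G.proj_sum x] at h1
    refine h1.trans (finsum_eq_sum_of_support_subset _ fun m hm => ?_)
    rw [Finset.mem_coe, Set.Finite.mem_toFinset]
    exact fun h0 => hm (LinearMap.congr_fun h0 x)
  have hcomp : ∀ m ∈ hφ'.toFinset, φ ((c • G.evalComp b z).1 m) =
      ∑ k ∈ hfin.toFinset, c * ((∏ i, z i ^ k i) * φ (G.proj m (b k))) := by
    intro m hm
    change φ (c • ∑ᶠ k : Fin n → ℕ, (∏ i, z i ^ k i) • G.proj m (b k)) = _
    rw [finsum_eq_sum_of_support_subset (s := hfin.toFinset) _ fun k hk => ?_, map_smul, map_sum,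
      smul_eq_mul, Finset.mul_sum]
    · simp only [map_smul, smul_eq_mul]
    · by_contra h
      exact hk (by simp [hout k h m hm])
  rw [CGrading.pair, finsum_eq_sum_of_support_subset (s := hφ'.toFinset) _ fun m hm => ?_,
    Finset.sum_congr rfl hcomp, Finset.sum_comm,
    finsum_eq_sum_of_support_subset (s := hfin.toFinset) _ fun k hk => ?_, Finset.mul_sum]
  · refine Finset.sum_congr rfl fun k _ => ?_
    rw [hsum (b k), ← Finset.mul_sum, ← Finset.mul_sum]
    ring
  · by_contra h
    refine hk ?_
    beta_reduce
    rw [hsum, Finset.sum_eq_zero fun m hm => by rw [hout k h m hm, map_zero], zero_mul]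
  · rw [Finset.mem_coe, Set.Finite.mem_toFinset]
    intro h0
    refine hm ?_
    change φ ((c • G.evalComp b z).1 m) = 0
    rw [← (c • G.evalComp b z).2 m]
    exact LinearMap.congr_fun h0 _

theorem AC_of_nonneg_finite {H : (Fin n → ℤ) → ℂ} (hH : ∀ i, NN i H)
    (hfin : (Function.support fun k : Fin n → ℕ => H fun i => k i).Finite) (z : Fin n → ℂ) :
    AC z H (∑ᶠ k : Fin n → ℕ, H (fun i => k i) * ∏ i, z i ^ k i) := by
  set e : (Fin n → ℕ) → (Fin n → ℤ) := fun k i => k i with he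
  have hinj : Function.Injective e := fun k k' h => funext fun i =>
    Int.natCast_inj.mp (congrFun h i)
  have hout : ∀ k ∉ Set.range e, H k = 0 := by
    intro k hk
    by_contra h
    refine hk ⟨fun i => (k i).toNat, funext fun i => Int.toNat_of_nonneg ?_⟩
    by_contra hi
    exact h (hH i k (not_le.mp hi))
  have hsub : (Function.support fun k : Fin n → ℕ => H (e k) * ∏ i, z i ^ k i).Finite :=
    hfin.subset fun k hk h => hk (by
      change H (e k) * _ = 0
      rw [show H (e k) = 0 from h, zero_mul])
  have hs : HasSum (fun k : Fin n → ℕ => H (e k) * ∏ i, z i ^ k i)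
      (∑ᶠ k : Fin n → ℕ, H (e k) * ∏ i, z i ^ k i) := by
    rw [finsum_eq_sum _ hsub]
    exact hasSum_sum_of_ne_finset_zero fun k hk => by
      by_contra h
      exact hk (hsub.mem_toFinset.mpr h)
  constructor
  · refine (hinj.summable_iff fun k hk => by
      beta_reduce
      rw [hout k hk, zero_mul, norm_zero]).mp ?_
    simpa [Function.comp_def, he] using hs.summable.norm
  · refine (hinj.hasSum_iff fun k hk => by rw [hout k hk, zero_mul]).mp ?_
    simpa [Function.comp_def, he] using hs

theorem exists_realization {F : (Fin n → ℤ) → W} (hF : G.Filt F) (p : Fin n → Fin n → ℕ)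
    (hNN : ∀ i, NN i (act (clrAll p (List.finRange n)) F)) (hTr : ∀ i j, i < j → Tr i j F) :
    ∃ f : (Fin n → ℂ) → G.Comp, G.WTilde f ∧
      ∀ φ : W →ₗ[ℂ] ℂ, InGradedDual G.proj φ → ∀ z : Fin n → ℂ, OrderedPos z →
        AC z (fun k => φ (F k)) (G.pair φ (f z)) := by
  set q := clrAll p (List.finRange n) with hq
  set pp : Fin n → Fin n → ℕ := fun i j => if i < j then p i j else 0 with hpp
  obtain ⟨r, hr⟩ := hF.act q
  set b : (Fin n → ℕ) → W := fun k => act q F fun i => k i with hb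
  have hbr : ∀ k, b k ∈ G.wge (r + ∑ i, (k i : ℝ)) := fun k => by
    have := hr fun i => k i
    simpa using this
  set Δ : (Fin n → ℂ) → ℂ := fun z =>
    ∏ x ∈ Finset.univ.offDiag, (z x.1 - z x.2) ^ pp x.1 x.2 with hΔ
  have hpair := fun (φ : W →ₗ[ℂ] ℂ) (hφ : InGradedDual G.proj φ) (z : Fin n → ℂ) =>
    G.pair_smul_evalComp hbr hφ (Δ z)⁻¹ z
  refine ⟨fun z => (Δ z)⁻¹ • G.evalComp b z, ⟨fun φ hφ => ?_, fun i j => pp i j, b,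
    fun φ hφ => ⟨G.finite_support_dual hbr hφ, fun z hz => ?_⟩⟩, fun φ hφ z hz => ?_⟩
  · have hfin := G.finite_support_dual hbr hφ
    refine ⟨⟨∑ k ∈ hfin.toFinset, MvPolynomial.C (φ (b k)) * ∏ i, MvPolynomial.X i ^ k i, pp⟩,
      fun z _ => ?_⟩
    rw [hpair φ hφ, finsum_eq_sum_of_support_subset (s := hfin.toFinset) _ fun k hk => ?_,
      DiagRatFn.eval, div_eq_inv_mul]
    · simp [map_sum, map_prod, hΔ]
    · rw [Finset.mem_coe, hfin.mem_toFinset]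
      exact left_ne_zero_of_mul hk
  · have hne : Δ z ≠ 0 := Finset.prod_ne_zero_iff.mpr fun x hx =>
      pow_ne_zero _ (sub_ne_zero.mpr (hz _ _ (Finset.mem_offDiag.mp hx).2.2))
    simp only [zpow_natCast]
    rw [hpair φ hφ]
    exact mul_inv_cancel_left₀ hne _
  · rw [hpair φ hφ, mul_comm, ← div_eq_mul_inv, hΔ]
    simp only
    rw [← eval_clrAll_finRange z p]
    refine clrAll_mem_peelable hz p (List.pairwise_lt_finRange n) _ (fun i j hij k => ?_) _ ?_
    · obtain ⟨N, hN⟩ := hTr i j hij k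
      exact ⟨N, fun m hm => by rw [hN m hm, map_zero]⟩
    · have h1 : act (clrAll p (List.finRange n)) (fun k => φ (F k)) = fun k => φ (act q F k) :=
        funext fun k => act_comp_apply φ q F k
      rw [h1]
      exact AC_of_nonneg_finite (fun i k hk => by rw [hNN i k hk, map_zero])
        (G.finite_support_dual hbr hφ) z

end Realization

section Products

theorem ops_map {ι κ M : Type*} [AddCommGroup M] [Module ℂ M] (Z : ι → M →ₗ[ℂ] (ℤ → M))
    (e : κ → ι) (L : List κ) (k : ι → ℤ) (x : M) :
    ops Z (L.map e) k x = ops (fun j => Z (e j)) L (fun j => k (e j)) x := by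
  induction L with
  | nil => rfl
  | cons j L ih => rw [List.map_cons, ops_cons, ops_cons, ih]

theorem ops_congr_family {ι M : Type*} [AddCommGroup M] [Module ℂ M]
    {Z Z' : ι → M →ₗ[ℂ] (ℤ → M)} {L : List ι} (h : ∀ j ∈ L, Z j = Z' j) (k : ι → ℤ) (x : M) :
    ops Z L k x = ops Z' L k x := by
  induction L with
  | nil => rfl
  | cons j L ih =>
    rw [ops_cons, ops_cons, ih fun i hi => h i (List.mem_cons_of_mem _ hi),
      h j List.mem_cons_self]

theorem compApply_eq_ops {M : Type*} [AddCommGroup M] [Module ℂ M] {n : ℕ}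
    (Z : Fin n → M →ₗ[ℂ] (ℤ → M)) (k : Fin n → ℤ) (x : M) :
    compApply n (fun i y => Z i y (k i)) x = ops Z (List.finRange n) k x := by
  induction n with
  | zero => rfl
  | succ n ih =>
    rw [List.finRange_succ, ops_cons, ops_map]
    change Z 0 (compApply n (fun i y => Z i.succ y (k i.succ)) x) (k 0) = _
    rw [ih (fun i => Z i.succ) (fun i => k i.succ)]

theorem Tr_ops {M : Type*} [AddCommGroup M] [Module ℂ M] {n : ℕ} {Z : Fin n → M →ₗ[ℂ] (ℤ → M)}
    (hZ : ∀ j y, BB (Z j y)) (x : M) {i j : Fin n} (hij : i < j) :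
    Tr i j fun k => ops Z (List.finRange n) k x := by
  obtain ⟨S, T, hST⟩ := List.append_of_mem (List.mem_finRange j)
  have hp := List.pairwise_lt_finRange n
  rw [hST, List.pairwise_append, List.pairwise_cons] at hp
  intro k
  obtain ⟨N, hN⟩ := hZ j (ops Z T k x)
  refine ⟨(k j - N + 1).toNat, fun m hm => ?_⟩
  have hT : ops Z T (k + Pi.single i (m : ℤ) - Pi.single j (m : ℤ)) = ops Z T k := by
    refine ops_congr Z fun s hs => ?_
    have hs' := hp.2.1.1 s hs
    simp [hs'.ne', (hij.trans hs').ne']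
  beta_reduce
  rw [hST, ops_append, ops_cons, hT, hN _ ?_, map_zero]
  simp only [Pi.add_apply, Pi.sub_apply, Pi.single_eq_same, Pi.single_eq_of_ne hij.ne']
  omega

end Products

section Main

variable {V : Type*} [AddCommGroup V] [Module ℂ V] {W : Type*} [AddCommGroup W] [Module ℂ W]
  {A : MOSVA V} {B : Bimod A W}

theorem BB.exists_nat {M : Type*} [AddCommGroup M] [Module ℂ M] {g : ℤ → M} (h : BB g) :
    ∃ C : ℕ, ∀ a, a < -(C : ℤ) → g a = 0 := by
  obtain ⟨N, hN⟩ := h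
  exact ⟨(-N).toNat, fun a ha => hN a (by omega)⟩

theorem Bimod.exists_poleBound (hA : A.PoleOrder) (hB : B.PoleOrder) (u v : V) : ∃ C : ℕ,
    (∀ a, a < -(C : ℤ) → pw A.Y u v a = 0) ∧ (∀ u₂, WeakAssoc (pw A.Y) (pw A.Y) C u u₂ v) ∧
    (∀ a, a < -(C : ℤ) → A.Yop u v a = 0) ∧ (∀ u₂, WeakAssoc A.Yop A.Yop C u u₂ v) ∧
    ∀ x, (Qe (-1) ^ C) ((fun a b => pw B.YL u (B.Yrp v x b) a) -
      fun a b => B.Yrp v (pw B.YL u x a) b) = 0 := by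
  obtain ⟨C₁, h₁⟩ := (A.pw_BB u v).exists_nat
  obtain ⟨C₂, h₂⟩ := A.exists_weakAssoc hA u v
  obtain ⟨C₃, h₃⟩ := (skew_BB A.Dl (pw A.Y) A.pw_BB u v).exists_nat
  obtain ⟨C₄, h₄⟩ := A.Yop_weakAssoc hA u v
  obtain ⟨C₅, h₅⟩ := B.exists_locality hB u v
  refine ⟨C₁ + C₂ + C₃ + C₄ + C₅, fun a ha => h₁ a (by push_cast at ha; omega),
    fun u₂ => Qe_pow_mono (by omega) (h₂ u₂), fun a ha => h₃ a (by push_cast at ha; omega),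
    fun u₂ => Qe_pow_mono (by omega) (h₄ u₂), fun x => Qe_pow_mono (by omega) (h₅ x)⟩

/-- The `j`-th factor, `Y_W^L(u j, x)` if `j < l` and `Y_W^{s(R)}(u j, x)` otherwise, indexed by
exponents. -/
def Bimod.factor (B : Bimod A W) {n : ℕ} (l : ℕ) (u : Fin n → V) (j : Fin n) :
    W →ₗ[ℂ] (ℤ → W) :=
  if (j : ℕ) < l then pw B.YL (u j) else B.Yrp (u j)

theorem Bimod.factor_BB {n : ℕ} (l : ℕ) (u : Fin n → V) (j : Fin n) (x : W) :
    BB (B.factor l u j x) := by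
  rw [Bimod.factor]
  split_ifs
  · exact B.pwL_BB _ _
  · exact skew_BB B.DW (pw B.YR) B.pwR_BB _ _

theorem Bimod.filt_factor {n : ℕ} (l : ℕ) (u : Fin n → V) (w : W) :
    B.gr.Filt fun k => ops (B.factor l u) (List.finRange n) k w := by
  obtain ⟨B₀, hB₀⟩ := A.gr.lower_bound
  refine B.gr.filt_ops (c := B₀) (fun j r x hx a => ?_) w
  rw [Bimod.factor]
  split_ifs
  · exact B.pwL_mem_wge hB₀ _ hx a
  · exact B.Yrp_mem_wge hB₀ _ hx a

theorem Bimod.patOps_prefixPat {n : ℕ} (l : ℕ) (u : Fin n → V) (k : Fin n → ℤ) :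
    patOps B (prefixPat n l) u k = fun i x => B.factor l u i x (-k i - 1) := by
  funext i x
  by_cases h : (i : ℕ) < l
  · simp [patOps, prefixPat, Bimod.factor, h, pw_apply]
  · simp [patOps, prefixPat, Bimod.factor, h, Bimod.Yrp_apply]

theorem Bimod.RegVec.pwL {w : W} (hw : B.RegVec w) (v : V) (a : ℤ) (ha : a < 0) :
    pw B.YL v w a = 0 := (hw v (-a - 1) (by omega)).1

theorem Bimod.RegVec.Yrp {w : W} (hw : B.RegVec w) (v : V) (a : ℤ) (ha : a < 0) :
    B.Yrp v w a = 0 := by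
  rw [← (hw v (-a - 1) (by omega)).2, ← Bimod.Yrp_apply, show -(-a - 1) - 1 = a by ring]

theorem Bimod.exists_NN_factor (hA : A.PoleOrder) (hB : B.PoleOrder) {n : ℕ} (l : ℕ) {w : W}
    (hw : B.RegVec w) (u : Fin n → V) : ∃ p : Fin n → Fin n → ℕ, ∀ i,
      NN i (act (clrAll p (List.finRange n))
        fun k => ops (B.factor l u) (List.finRange n) k w) := by
  choose C hC using B.exists_poleBound hA hB
  refine ⟨fun i j => C (u i) (u j), fun i => ?_⟩
  have hL : ∀ j ∈ (List.finRange n).take l, B.factor l u j = pw B.YL (u j) := by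
    intro j hj
    obtain ⟨s, hs, rfl⟩ := List.mem_take_iff_getElem.mp hj
    rw [Bimod.factor, if_pos]
    simp only [List.getElem_finRange, Fin.val_cast]
    omega
  have hR : ∀ j ∈ (List.finRange n).drop l, B.factor l u j = B.Yrp (u j) := by
    intro j hj
    obtain ⟨s, hs, rfl⟩ := List.mem_drop_iff_getElem.mp hj
    rw [Bimod.factor, if_neg]
    simp
  have hnd := List.nodup_finRange n
  have hi := List.mem_finRange i
  rw [← List.take_append_drop l (List.finRange n)] at hnd hi ⊢
  have key := NN_ops_mixed C (fun u v => (hC u v).1) (fun u₁ u₂ v => (hC u₁ v).2.1 u₂)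
    (fun u v => (hC u v).2.2.1) (fun u₁ u₂ v => (hC u₁ v).2.2.2.1 u₂)
    (fun u v => (hC u v).2.2.2.2) hw.pwL
    (fun u₁ u₂ => by
      obtain ⟨c, hc⟩ := B.exists_weakAssocL hB u₁ w
      exact (hc u₂).of_regular hw.pwL)
    hw.Yrp
    (fun u₁ u₂ => by
      obtain ⟨c, hc⟩ := B.Yrp_weakAssoc hB u₁ w
      exact (hc u₂).of_regular hw.Yrp) u hnd hi
  have e : (fun k => ops (B.factor l u) ((List.finRange n).take l ++ (List.finRange n).drop l) k w)
      = fun k => ops (fun j => pw B.YL (u j)) ((List.finRange n).take l) k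
        (ops (fun j => B.Yrp (u j)) ((List.finRange n).drop l) k w) := by
    funext k
    rw [ops_append, ops_congr_family hR, ops_congr_family hL]
  rw [e]
  exact key

end Main

/-- Let `V` be a MOSVA and `W` a `V`-bimodule, both satisfying the
pole-order condition. Fix `0 < n`, `0 ≤ l ≤ n` and `w ∈ W` with
`Y_W^L(u,x)w ∈ W[[x]]` and `Y_W^{s(R)}(u,x)w ∈ W[[x]]` for every `u ∈ V`. Then for
all `u₁,…,uₙ ∈ V` the map
`(z₁,…,zₙ) ↦ E(Y_W^L(u₁,z₁)⋯Y_W^L(u_l,z_l)Y_W^{s(R)}(u_{l+1},z_{l+1})⋯Y_W^{s(R)}(uₙ,zₙ)w)`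
is a `W̄`-valued rational function with the only possible poles at `z_i = z_j`,
i.e. there is an element `f` of `W̃_{z₁,…,zₙ}` to which the series of matrix
coefficients converges absolutely on the region `|z₁| > ⋯ > |zₙ| > 0`. -/
theorem statement3 {V : Type*} [AddCommGroup V] [Module ℂ V]
    {W : Type*} [AddCommGroup W] [Module ℂ W]
    (A : MOSVA V) (B : Bimod A W) (hA : A.PoleOrder) (hB : B.PoleOrder)
    (n : ℕ) (hn : 0 < n) (l : ℕ) (hl : l ≤ n)
    (w : W) (hw : B.RegVec w) (u : Fin n → V) :
    ∃ f : (Fin n → ℂ) → B.gr.Comp, RepEPat B (prefixPat n l) u w f := by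
  obtain ⟨p, hp⟩ := B.exists_NN_factor hA hB l hw u
  obtain ⟨f, hf, hf'⟩ := exists_realization (B.filt_factor l u w) p hp
    fun _ _ => Tr_ops (B.factor_BB l u) w
  refine ⟨f, hf, fun φ hφ z hz => ?_⟩
  refine ((hf' φ hφ z hz).comp_equiv (Equiv.subLeft (-1 : Fin n → ℤ))).congr (fun k => ?_) rfl
  have hk : Equiv.subLeft (-1 : Fin n → ℤ) k = fun i => -k i - 1 := by
    funext i
    simp only [Equiv.subLeft_apply, Pi.sub_apply, Pi.neg_apply, Pi.one_apply]
    ring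
  rw [hk, Bimod.patOps_prefixPat, compApply_eq_ops _ fun i => -k i - 1]

end VA
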